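/- Fix even k ≥ 2 and set x = 4g/(15k). Define A(D) = Σ_{n monic, deg n ≤ x} χ_D(n)/√|n|. Then S₁ := Σ_{D ∈ H_{2g+1}} L(1/2, χ_D) A(D)^{k-1} satisfies S₁ ≫_k q^{2g+1} g^{k(k+1)/2} as g → ∞. -/

import Mathlib

open Polynomial Filter Asymptotics
open scoped Classical

variable {Fq : Type} [Field Fq] [Fintype Fq]

/-- Norm of a polynomial: `|f| = q^(deg f)` for `f ≠ 0`, and `|0| = 0`. -/
noncomputable def pnorm (f : Polynomial Fq) : ℝ :=
  if f = 0 then 0 else (Fintype.card Fq : ℝ) ^ f.natDegree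

/-- Monic polynomials of degree `n`. -/
def monicDeg (Fq : Type) [Field Fq] (n : ℕ) : Set (Polynomial Fq) :=
  {f | f.Monic ∧ f.natDegree = n}

/-- `H_{2g+1}`: monic square-free polynomials of degree `2g+1`. -/
def Hset (Fq : Type) [Field Fq] (g : ℕ) : Set (Polynomial Fq) :=
  {D | D.Monic ∧ Squarefree D ∧ D.natDegree = 2 * g + 1}

/-- Quadratic residue symbol `(D/P)` for an irreducible `P`. -/
noncomputable def quadCharP (D P : Polynomial Fq) : ℤ :=
  if P ∣ D then 0 else if ∃ x : Polynomial Fq, P ∣ (x ^ 2 - D) then 1 else -1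

/-- Jacobi-type quadratic residue symbol `(D/n)`, extended multiplicatively over
irreducible factors of `n`. -/
noncomputable def jacobi (D n : Polynomial Fq) : ℤ :=
  ((UniqueFactorizationMonoid.factors n).map (quadCharP D)).prod

/-- The quadratic Dirichlet L-function `L(s, χ_D)` as a finite sum
`Σ_{n=0}^{deg D - 1} (Σ_{f monic, deg f = n} χ_D(f)) q^{-ns}`. -/
noncomputable def Lfun (D : Polynomial Fq) (s : ℂ) : ℂ :=
  ∑ n ∈ Finset.range D.natDegree,
    (∑ᶠ f ∈ monicDeg Fq n, (jacobi D f : ℂ)) * (Fintype.card Fq : ℂ) ^ (-(n : ℂ) * s)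

/-- The central value `L(1/2, χ_D)` as a real number. -/
noncomputable def LhalfR (D : Polynomial Fq) : ℝ :=
  ∑ n ∈ Finset.range D.natDegree,
    (∑ᶠ f ∈ monicDeg Fq n, (jacobi D f : ℝ)) * (Real.sqrt (Fintype.card Fq))⁻¹ ^ n

/-- `a_m = Π_{P | m} |P|/(|P|+1)` over monic irreducible divisors `P` of `m`. -/
noncomputable def am (m : Polynomial Fq) : ℝ :=
  ∏ᶠ (P : Polynomial Fq) (_ : P.Monic ∧ Irreducible P ∧ P ∣ m), pnorm P / (pnorm P + 1)

/-- `d_k(m)`: the number of ordered `k`-tuples of monic polynomials with product `m`. -/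
noncomputable def dfold (k : ℕ) (m : Polynomial Fq) : ℕ :=
  Nat.card {t : Fin k → Polynomial Fq // (∀ i, (t i).Monic) ∧ ∏ i, t i = m}

/-- Möbius function on `F_q[T]`. -/
noncomputable def moebiusP (f : Polynomial Fq) : ℤ :=
  if Squarefree f then (-1) ^ (UniqueFactorizationMonoid.factors f).card else 0

/-- The Dirichlet polynomial `A(D) = Σ_{n monic, deg n ≤ 4g/(15k)} χ_D(n)/√|n|`. -/
noncomputable def AD (k g : ℕ) (D : Polynomial Fq) : ℝ :=
  ∑ᶠ n ∈ {n : Polynomial Fq | n.Monic ∧ n.natDegree ≤ 4 * g / (15 * k)},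
    (jacobi D n : ℝ) / Real.sqrt (pnorm n)

section Symbol

lemma finite_adjoinRoot {P : Fq[X]} (hP : P ≠ 0) : Finite (AdjoinRoot P) :=
  haveI := (AdjoinRoot.powerBasis hP).finite
  Module.finite_of_finite Fq

lemma quadCharP_eq_quadraticChar {P : Fq[X]} [Fact (Irreducible P)] [Fintype (AdjoinRoot P)]
    (D : Fq[X]) : quadCharP D P = quadraticChar (AdjoinRoot P) (AdjoinRoot.mk P D) := by
  rw [quadraticChar_apply, quadraticCharFun, quadCharP]
  simp only [AdjoinRoot.mk_eq_zero]
  refine if_congr Iff.rfl rfl (if_congr ?_ rfl rfl)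
  constructor
  · rintro ⟨x, hx⟩
    refine ⟨AdjoinRoot.mk P x, ?_⟩
    rw [← map_mul, eq_comm, AdjoinRoot.mk_eq_mk, ← pow_two]
    exact hx
  · rintro ⟨y, hy⟩
    obtain ⟨x, rfl⟩ := AdjoinRoot.mk_surjective y
    refine ⟨x, ?_⟩
    rw [← map_mul, eq_comm, AdjoinRoot.mk_eq_mk, ← pow_two] at hy
    exact hy

lemma quadCharP_mul {P : Fq[X]} (hP : Irreducible P) (D E : Fq[X]) :
    quadCharP (D * E) P = quadCharP D P * quadCharP E P := by
  have := Fact.mk hP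
  have := finite_adjoinRoot hP.ne_zero
  have := Fintype.ofFinite (AdjoinRoot P)
  simp only [quadCharP_eq_quadraticChar, map_mul]

lemma quadCharP_associated {P Q : Fq[X]} (h : Associated P Q) (D : Fq[X]) :
    quadCharP D P = quadCharP D Q := by
  simp only [quadCharP, h.dvd_iff_dvd_left]

lemma quadCharP_congr {P D E : Fq[X]} (h : P ∣ D - E) : quadCharP D P = quadCharP E P := by
  have h1 : P ∣ D ↔ P ∣ E := (dvd_iff_dvd_of_dvd_sub h)
  have h2 : ∀ x : Fq[X], P ∣ x ^ 2 - D ↔ P ∣ x ^ 2 - E := fun x =>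
    dvd_iff_dvd_of_dvd_sub (by
      have : x ^ 2 - D - (x ^ 2 - E) = -(D - E) := by ring
      rw [this]; exact (dvd_neg).2 h)
  simp only [quadCharP, h1, h2]

lemma quadCharP_eq_zero_iff {P D : Fq[X]} : quadCharP D P = 0 ↔ P ∣ D := by
  unfold quadCharP; split_ifs <;> simp_all

lemma quadCharP_sq {P D : Fq[X]} (h : ¬ P ∣ D) : quadCharP D P ^ 2 = 1 := by
  unfold quadCharP; split_ifs <;> simp

lemma quadCharP_one {P : Fq[X]} (hP : Irreducible P) : quadCharP 1 P = 1 := by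
  have h : ¬ P ∣ 1 := fun h => hP.not_isUnit (isUnit_of_dvd_one h)
  rw [quadCharP, if_neg h, if_pos ⟨1, by simp⟩]

lemma jacobi_one_right (D : Fq[X]) : jacobi D 1 = 1 := by
  simp [jacobi, UniqueFactorizationMonoid.factors_one]

lemma map_quadCharP_eq_of_rel {s t : Multiset Fq[X]} (D : Fq[X]) (h : Multiset.Rel Associated s t) :
    s.map (quadCharP D) = t.map (quadCharP D) := by
  rw [← Multiset.rel_eq, Multiset.rel_map]
  exact h.mono fun a _ b _ hab => quadCharP_associated hab D

lemma jacobi_mul_right (D : Fq[X]) {m n : Fq[X]} (hm : m ≠ 0) (hn : n ≠ 0) :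
    jacobi D (m * n) = jacobi D m * jacobi D n := by
  rw [jacobi, map_quadCharP_eq_of_rel D (UniqueFactorizationMonoid.factors_mul hm hn),
    Multiset.map_add, Multiset.prod_add]
  rfl

lemma jacobi_pow_right (D : Fq[X]) {m : Fq[X]} (hm : m ≠ 0) (n : ℕ) :
    jacobi D (m ^ n) = jacobi D m ^ n := by
  induction n with
  | zero => simp [jacobi_one_right]
  | succ n ih => rw [pow_succ, jacobi_mul_right D (pow_ne_zero _ hm) hm, ih, pow_succ]

lemma jacobi_prod_right (D : Fq[X]) {ι : Type*} (s : Finset ι) (f : ι → Fq[X])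
    (hf : ∀ i ∈ s, f i ≠ 0) : jacobi D (∏ i ∈ s, f i) = ∏ i ∈ s, jacobi D (f i) := by
  induction s using Finset.induction_on with
  | empty => simp [jacobi_one_right]
  | insert a s ha ih =>
    rw [Finset.prod_insert ha, Finset.prod_insert ha, jacobi_mul_right, ih]
    · exact fun i hi => hf i (Finset.mem_insert_of_mem hi)
    · exact hf a (Finset.mem_insert_self _ _)
    · exact Finset.prod_ne_zero_iff.2 fun i hi => hf i (Finset.mem_insert_of_mem hi)

lemma jacobi_irreducible (D : Fq[X]) {P : Fq[X]} (hP : Irreducible P) :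
    jacobi D P = quadCharP D P := by
  have h := UniqueFactorizationMonoid.factors_rel_of_associated (Associated.refl P)
  obtain ⟨Q, hQ, hPQ⟩ := UniqueFactorizationMonoid.factors_eq_singleton_of_irreducible hP
  rw [jacobi, hPQ, Multiset.map_singleton, Multiset.prod_singleton]
  exact quadCharP_associated hQ.symm D

lemma jacobi_mul_left (D E n : Fq[X]) : jacobi (D * E) n = jacobi D n * jacobi E n := by
  rw [jacobi, jacobi, jacobi, ← Multiset.prod_map_mul]
  congr 1
  exact Multiset.map_congr rfl fun P hP =>
    quadCharP_mul (UniqueFactorizationMonoid.irreducible_of_factor P hP) D E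

lemma jacobi_one_left (n : Fq[X]) : jacobi 1 n = 1 := by
  rw [jacobi]
  apply Multiset.prod_eq_one
  intro x hx
  obtain ⟨P, hP, rfl⟩ := Multiset.mem_map.1 hx
  exact quadCharP_one (UniqueFactorizationMonoid.irreducible_of_factor P hP)

lemma jacobi_congr {D E n : Fq[X]} (h : n ∣ D - E) : jacobi D n = jacobi E n := by
  rw [jacobi, jacobi]
  congr 1
  exact Multiset.map_congr rfl fun P hP =>
    quadCharP_congr ((UniqueFactorizationMonoid.dvd_of_mem_factors hP).trans h)

lemma jacobi_eq_zero_iff {D n : Fq[X]} (hn : n ≠ 0) : jacobi D n = 0 ↔ ¬ IsCoprime D n := by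
  rw [jacobi, Multiset.prod_eq_zero_iff, Multiset.mem_map]
  constructor
  · rintro ⟨P, hP, h⟩ hc
    have h1 := UniqueFactorizationMonoid.irreducible_of_factor P hP
    exact h1.not_isUnit (hc.isUnit_of_dvd' (quadCharP_eq_zero_iff.1 h)
      (UniqueFactorizationMonoid.dvd_of_mem_factors hP))
  · intro h
    have : ¬ IsRelPrime D n := fun h' => h h'.isCoprime
    rw [isRelPrime_comm, UniqueFactorizationMonoid.isRelPrime_iff_no_prime_factors hn] at this
    push Not at this
    obtain ⟨P, h1, h2, h3⟩ := this
    obtain ⟨Q, hQ, hPQ⟩ :=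
      UniqueFactorizationMonoid.exists_mem_factors_of_dvd hn h3.irreducible h1
    exact ⟨Q, hQ, quadCharP_eq_zero_iff.2 (hPQ.dvd_iff_dvd_left.1 h2)⟩

lemma jacobi_sq {D n : Fq[X]} (h : IsCoprime D n) : jacobi D n ^ 2 = 1 := by
  rw [jacobi, ← Multiset.prod_map_pow]
  apply Multiset.prod_eq_one
  intro x hx
  obtain ⟨P, hP, rfl⟩ := Multiset.mem_map.1 hx
  refine quadCharP_sq fun h1 => ?_
  exact (UniqueFactorizationMonoid.irreducible_of_factor P hP).not_isUnit
    (h.isUnit_of_dvd' h1 (UniqueFactorizationMonoid.dvd_of_mem_factors hP))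

lemma abs_jacobi_le_one {n : Fq[X]} (D : Fq[X]) (hn : n ≠ 0) : |jacobi D n| ≤ 1 := by
  by_cases h : IsCoprime D n
  · exact (sq_le_one_iff_abs_le_one _).1 (jacobi_sq h).le
  · rw [(jacobi_eq_zero_iff hn).2 h]; simp

end Symbol

section Reciprocity

lemma monic_induction {p : Fq[X] → Prop} (h1 : p 1)
    (hmul : ∀ P n : Fq[X], P.Monic → Irreducible P → n.Monic → p n → p (P * n)) :
    ∀ n : Fq[X], n.Monic → p n := by
  intro n
  induction hd : n.natDegree using Nat.strong_induction_on generalizing n with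
  | _ d ih =>
    intro hn
    by_cases hu : IsUnit n
    · rw [hn.eq_one_of_isUnit hu]; exact h1
    · obtain ⟨P, hPm, hPi, m, rfl⟩ := exists_monic_irreducible_factor n hu
      have hm : m.Monic := hPm.of_mul_monic_left hn
      refine hmul P m hPm hPi hm (ih _ ?_ m rfl hm)
      rw [← hd, hPm.natDegree_mul hm]
      have := hPi.natDegree_pos
      omega

lemma norm_adjoinRoot_mk {P : Fq[X]} [Fact (Irreducible P)] (hP : P.Monic) (g : Fq[X]) :
    Algebra.norm Fq (AdjoinRoot.mk P g) = resultant P g P.natDegree g.natDegree := by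
  have hP0 : P ≠ 0 := hP.ne_zero
  have := finite_adjoinRoot hP0
  let E := AlgebraicClosure Fq
  have hsep : P.Separable := PerfectField.separable_of_irreducible Fact.out
  apply (algebraMap Fq E).injective
  rw [Algebra.norm_eq_prod_embeddings, ← resultant_map_map]
  have key := resultant_eq_prod_eval (P.map (algebraMap Fq E)) (g.map (algebraMap Fq E))
    g.natDegree (natDegree_map_le) (IsAlgClosed.splits _)
  rw [natDegree_map] at key
  rw [key, (hP.map _).leadingCoeff, one_pow, one_mul]
  rw [Fintype.prod_equiv (AdjoinRoot.equiv E Fq P hP0) (fun σ => σ (AdjoinRoot.mk P g))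
    (fun x => (g.map (algebraMap Fq E)).eval (x : E))]
  · have hnd : (P.map (algebraMap Fq E)).roots.Nodup := nodup_roots hsep.map
    refine (Finset.prod_mem_multiset (P.aroots E) _
      (fun x => (g.map (algebraMap Fq E)).eval x) (fun _ => rfl)).trans ?_
    rw [Finset.prod_eq_multiset_prod, Multiset.toFinset_val, Multiset.dedup_eq_self.2 hnd]
  · intro σ
    have : ((AdjoinRoot.equiv E Fq P hP0 σ : {x // x ∈ P.aroots E}) : E) = σ (AdjoinRoot.root P) :=
      rfl
    rw [this, eval_map_algebraMap, ← AdjoinRoot.aeval_eq, aeval_algHom_apply]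

lemma quadraticChar_norm {F : Type} [Field F] [Fintype F] [Algebra Fq F] (x : F)
    (hq : ringChar Fq ≠ 2) :
    quadraticChar Fq (Algebra.norm Fq x) = quadraticChar F x := by
  have hc : ringChar F = ringChar Fq :=  (Algebra.ringChar_eq Fq F).symm
  have hF : ringChar F ≠ 2 := by rwa [hc]
  have hcast : (quadraticChar F x : F) = (quadraticChar Fq (Algebra.norm Fq x) : F) := by
    rw [quadraticChar_eq_pow_of_char_ne_two' hF]
    have h := congrArg (algebraMap Fq F)
      (quadraticChar_eq_pow_of_char_ne_two' hq (Algebra.norm Fq x))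
    rw [map_intCast] at h
    rw [h, map_pow, FiniteField.algebraMap_norm_eq_pow, ← pow_mul]
    congr 1
    have hodd := FiniteField.odd_card_of_char_ne_two hq
    obtain ⟨r, hr⟩ := Nat.odd_iff.2 hodd
    rw [Nat.card_eq_fintype_card, Nat.card_eq_fintype_card]
    have hd : Fintype.card Fq - 1 ∣ Fintype.card F - 1 := by
      rw [Module.card_eq_pow_finrank (K := Fq) (V := F)]
      simpa using Nat.sub_dvd_pow_sub_pow (Fintype.card Fq) 1 (Module.finrank Fq F)
    obtain ⟨t, ht⟩ := hd
    have hq1 : 1 < Fintype.card Fq := Fintype.one_lt_card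
    have hF1 : 1 < Fintype.card F := Fintype.one_lt_card
    have hr0 : 0 < r := by omega
    have e1 : Fintype.card Fq / 2 = r := by omega
    have e2 : Fintype.card Fq - 1 = 2 * r := by omega
    rw [e1, e2]
    rw [e2] at ht
    rw [ht, Nat.mul_div_cancel_left _ (by omega)]
    have : Fintype.card F = 2 * (r * t) + 1 := by rw [← mul_assoc]; omega
    rw [this, mul_comm t r]; omega
  rcases quadraticChar_isQuadratic F x with h1 | h1 | h1 <;>
  rcases quadraticChar_isQuadratic Fq (Algebra.norm Fq x) with h2 | h2 | h2 <;>
  rw [h1, h2] at hcast ⊢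
  · simp at hcast
  · simp at hcast
  · simp at hcast
  · exact absurd hcast.symm (by simpa using Ring.neg_one_ne_one_of_char_ne_two hF)
  · simp at hcast
  · exact absurd hcast (by simpa using Ring.neg_one_ne_one_of_char_ne_two hF)

lemma jacobi_eq_quadraticChar_resultant (hq : ringChar Fq ≠ 2) (D : Fq[X]) :
    ∀ n : Fq[X], n.Monic →
      jacobi D n = quadraticChar Fq (resultant n D n.natDegree D.natDegree) := by
  apply monic_induction
  · simp [jacobi_one_right]
  · intro P n hP hPi hn ih
    have := Fact.mk hPi
    have := finite_adjoinRoot hP.ne_zero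
    have := Fintype.ofFinite (AdjoinRoot P)
    rw [jacobi_mul_right D hP.ne_zero hn.ne_zero, hP.natDegree_mul hn,
      resultant_mul_left _ _ _ _ le_rfl, map_mul, ← ih, jacobi_irreducible D hPi,
      quadCharP_eq_quadraticChar, ← quadraticChar_norm _ hq, norm_adjoinRoot_mk hP]

/-- Quadratic reciprocity in `Fq[T]`. -/
lemma jacobi_reciprocity (hq : ringChar Fq ≠ 2) {D n : Fq[X]} (hD : D.Monic) (hn : n.Monic) :
    jacobi D n = quadraticChar Fq (-1) ^ (n.natDegree * D.natDegree) * jacobi n D := by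
  rw [jacobi_eq_quadraticChar_resultant hq D n hn, jacobi_eq_quadraticChar_resultant hq n D hD,
    resultant_comm, map_mul, map_pow]

/-- The symbol `(c/D)` for a constant `c`. -/
lemma jacobi_C (hq : ringChar Fq ≠ 2) {D : Fq[X]} (hD : D.Monic) (c : Fq) :
    jacobi (C c) D = quadraticChar Fq c ^ D.natDegree := by
  rw [jacobi_eq_quadraticChar_resultant hq _ _ hD, natDegree_C, resultant_zero_right_deg, coeff_C_zero, map_pow]

end Reciprocity

section FiniteSets

variable (Fq) in
lemma finite_degree_lt (n : ℕ) : {f : Fq[X] | f.degree < n}.Finite := by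
  have : {f : Fq[X] | f.degree < n} = (degreeLT Fq n : Set Fq[X]) := by
    ext f; simp [mem_degreeLT]
  rw [this]
  have : Finite (degreeLT Fq n) := Finite.of_equiv _ (degreeLTEquiv Fq n).symm.toEquiv
  exact Set.toFinite _

variable (Fq) in
/-- The polynomials of degree less than `n`. -/
noncomputable def lowDegree (n : ℕ) : Finset Fq[X] := (finite_degree_lt Fq n).toFinset

@[simp] lemma mem_lowDegree {n : ℕ} {f : Fq[X]} : f ∈ lowDegree Fq n ↔ f.degree < n := by
  simp [lowDegree]

variable (Fq) in
lemma card_lowDegree (n : ℕ) : (lowDegree Fq n).card = Fintype.card Fq ^ n := by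
  have h1 : Nat.card (lowDegree Fq n) = Nat.card (Fin n → Fq) :=
    Nat.card_congr (((Equiv.subtypeEquivRight fun f => by
      rw [mem_lowDegree, mem_degreeLT])).trans (degreeLTEquiv Fq n).toEquiv)
  rw [Nat.card_eq_fintype_card, Fintype.card_coe] at h1
  rw [h1, Nat.card_eq_fintype_card, Fintype.card_fun, Fintype.card_fin]

variable (Fq) in
lemma finite_monicDeg (n : ℕ) : (monicDeg Fq n).Finite :=
  (finite_degree_lt Fq (n + 1)).subset fun f hf => by
    have : f.degree = n := by rw [degree_eq_natDegree hf.1.ne_zero, hf.2]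
    simp only [Set.mem_ofPred_eq, this]
    exact_mod_cast Nat.lt_succ_self n

variable (Fq) in
/-- The monic polynomials of degree `n`, as a `Finset`. -/
noncomputable def monicOfDegree (n : ℕ) : Finset Fq[X] := (finite_monicDeg Fq n).toFinset

lemma mem_monicOfDegree {n : ℕ} {f : Fq[X]} :
    f ∈ monicOfDegree Fq n ↔ f.Monic ∧ f.natDegree = n := by
  simp [monicOfDegree, monicDeg]

variable (Fq) in
lemma card_monicOfDegree (n : ℕ) : (monicOfDegree Fq n).card = Fintype.card Fq ^ n := by
  rw [← card_lowDegree]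
  have h1 : Nat.card (monicOfDegree Fq n) = Nat.card (lowDegree Fq n) :=
    Nat.card_congr (((Equiv.subtypeEquivRight fun f => by
      rw [mem_monicOfDegree])).trans ((monicEquivDegreeLT n).trans
        (Equiv.subtypeEquivRight fun f => by rw [mem_lowDegree, mem_degreeLT])))
  rwa [Nat.card_eq_fintype_card, Fintype.card_coe, Nat.card_eq_fintype_card, Fintype.card_coe] at h1

variable (Fq) in
/-- The monic polynomials of degree at most `n`. -/
noncomputable def monicUpTo (n : ℕ) : Finset Fq[X] :=
  (Finset.range (n + 1)).biUnion (monicOfDegree Fq)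

lemma mem_monicUpTo {n : ℕ} {f : Fq[X]} :
    f ∈ monicUpTo Fq n ↔ f.Monic ∧ f.natDegree ≤ n := by
  simp only [monicUpTo, Finset.mem_biUnion, Finset.mem_range, mem_monicOfDegree]
  constructor
  · rintro ⟨a, ha, h1, rfl⟩; exact ⟨h1, by omega⟩
  · rintro ⟨h1, h2⟩; exact ⟨_, by omega, h1, rfl⟩

lemma sum_monicUpTo {R : Type*} [AddCommMonoid R] (n : ℕ) (F : Fq[X] → R) :
    ∑ f ∈ monicUpTo Fq n, F f = ∑ j ∈ Finset.range (n + 1), ∑ f ∈ monicOfDegree Fq j, F f := by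
  rw [monicUpTo, Finset.sum_biUnion]
  intro i _ j _ hij
  refine Finset.disjoint_left.2 fun f hi hj => hij ?_
  rw [mem_monicOfDegree] at hi hj
  rw [← hi.2, hj.2]

lemma sum_monicOfDegree_const (n : ℕ) (u : ℕ → ℝ) :
    ∑ f ∈ monicOfDegree Fq n, u f.natDegree = (Fintype.card Fq : ℝ) ^ n * u n := by
  rw [Finset.sum_congr rfl fun f hf => by rw [(mem_monicOfDegree.1 hf).2],
    Finset.sum_const, card_monicOfDegree, nsmul_eq_mul, Nat.cast_pow]

lemma sum_monicUpTo_const (n : ℕ) (u : ℕ → ℝ) :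
    ∑ f ∈ monicUpTo Fq n, u f.natDegree =
      ∑ j ∈ Finset.range (n + 1), (Fintype.card Fq : ℝ) ^ j * u j := by
  rw [sum_monicUpTo]
  exact Finset.sum_congr rfl fun j _ => sum_monicOfDegree_const j u

/-- Monic polynomials of degree `N` divisible by `s` are the multiples `E * s`. -/
lemma sum_filter_dvd {R : Type*} [AddCommMonoid R] {N : ℕ} {s : Fq[X]} (hs : s.Monic)
    (hN : s.natDegree ≤ N) (F : Fq[X] → R) :
    ∑ B ∈ (monicOfDegree Fq N).filter (s ∣ ·), F B =
      ∑ E ∈ monicOfDegree Fq (N - s.natDegree), F (E * s) := by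
  symm
  refine Finset.sum_bij (fun E _ => E * s) ?_ ?_ ?_ ?_
  · intro E hE
    rw [mem_monicOfDegree] at hE
    rw [Finset.mem_filter, mem_monicOfDegree, hE.1.natDegree_mul hs, hE.2]
    exact ⟨⟨hE.1.mul hs, by omega⟩, Dvd.intro_left _ rfl⟩
  · intro E _ E' _ h
    exact mul_right_cancel₀ hs.ne_zero h
  · intro B hB
    rw [Finset.mem_filter, mem_monicOfDegree] at hB
    obtain ⟨⟨h1, h2⟩, E, rfl⟩ := hB
    have hE : E.Monic := hs.of_mul_monic_left h1
    refine ⟨E, ?_, mul_comm _ _⟩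
    rw [mem_monicOfDegree]
    rw [hs.natDegree_mul hE] at h2
    exact ⟨hE, by omega⟩
  · intros; rfl

lemma card_filter_dvd_le {N : ℕ} {s : Fq[X]} (hs : s.Monic) :
    (((monicOfDegree Fq N).filter (s ∣ ·)).card : ℝ) ≤
      (Fintype.card Fq : ℝ) ^ N / (Fintype.card Fq : ℝ) ^ s.natDegree := by
  have hq : (0 : ℝ) < Fintype.card Fq := by exact_mod_cast Fintype.card_pos
  by_cases hN : s.natDegree ≤ N
  · have := sum_filter_dvd hs hN (fun _ => (1 : ℝ))
    simp only [Finset.sum_const, card_monicOfDegree, nsmul_eq_mul, mul_one] at this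
    rw [this, Nat.cast_pow, pow_sub₀ _ hq.ne' hN, div_eq_mul_inv]
  · rw [Finset.filter_false_of_mem]
    · simp only [Finset.card_empty, Nat.cast_zero]; positivity
    · intro B hB h
      rw [mem_monicOfDegree] at hB
      have := natDegree_le_of_dvd h hB.1.ne_zero
      omega

lemma sum_monicOfDegree_divMod {R : Type*} [AddCommMonoid R] {N : ℕ} {h : Fq[X]} (hh : h.Monic)
    (hN : h.natDegree ≤ N) (F : Fq[X] → R) :
    ∑ E ∈ monicOfDegree Fq N, F E =
      ∑ t ∈ monicOfDegree Fq (N - h.natDegree), ∑ r ∈ lowDegree Fq h.natDegree, F (r + h * t) := by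
  rw [← Finset.sum_product']
  have hdeg : ∀ r t : Fq[X], r.degree < h.natDegree → t.Monic →
      r.degree < (h * t).degree := by
    intro r t hr ht
    refine hr.trans_le ?_
    rw [degree_mul, degree_eq_natDegree hh.ne_zero, degree_eq_natDegree ht.ne_zero]
    exact_mod_cast Nat.le_add_right _ _
  symm
  refine Finset.sum_bij (fun x _ => x.2 + h * x.1) ?_ ?_ ?_ ?_
  · rintro ⟨t, r⟩ hx
    rw [Finset.mem_product, mem_monicOfDegree, mem_lowDegree] at hx
    obtain ⟨⟨h1, h2⟩, h3⟩ := hx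
    simp only at h1 h2 h3
    rw [mem_monicOfDegree]
    refine ⟨(hh.mul h1).add_of_right (hdeg r t h3 h1), ?_⟩
    rw [natDegree_add_eq_right_of_degree_lt (hdeg r t h3 h1), hh.natDegree_mul h1]
    omega
  · rintro ⟨t, r⟩ hx ⟨t', r'⟩ hx' he
    rw [Finset.mem_product, mem_monicOfDegree, mem_lowDegree] at hx hx'
    simp only at hx hx' he
    have e := div_modByMonic_unique t r hh ⟨rfl, by
      rw [degree_eq_natDegree hh.ne_zero]; exact hx.2⟩
    have e' := div_modByMonic_unique t' r' hh ⟨rfl, by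
      rw [degree_eq_natDegree hh.ne_zero]; exact hx'.2⟩
    rw [he] at e
    rw [← e.1, ← e.2, e'.1, e'.2]
  · intro E hE
    rw [mem_monicOfDegree] at hE
    have hle : h.degree ≤ E.degree := by
      rw [degree_eq_natDegree hh.ne_zero, degree_eq_natDegree hE.1.ne_zero, hE.2]
      exact_mod_cast hN
    refine ⟨(E /ₘ h, E %ₘ h), ?_, modByMonic_add_div E h⟩
    rw [Finset.mem_product, mem_monicOfDegree, mem_lowDegree]
    refine ⟨⟨?_, ?_⟩, ?_⟩
    · rw [Monic, leadingCoeff_divByMonic_of_monic hh hle]; exact hE.1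
    · rw [natDegree_divByMonic _ hh, hE.2]
    · rw [← degree_eq_natDegree hh.ne_zero]; exact degree_modByMonic_lt _ hh
  · intros; rfl

lemma eq_of_dvd_sub_of_degree_lt {h a b : Fq[X]} (hab : h ∣ a - b) (ha : a.degree < h.degree)
    (hb : b.degree < h.degree) : a = b :=
  sub_eq_zero.1 (eq_zero_of_dvd_of_degree_lt hab ((degree_sub_le a b).trans_lt (max_lt ha hb)))

/-- Multiplication by a unit modulo `h` permutes the residues. -/
lemma sum_lowDegree_mul_mod {R : Type*} [AddCommMonoid R] {h u : Fq[X]} (hh : h.Monic)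
    (hu : IsCoprime u h) (F : Fq[X] → R) :
    ∑ c ∈ lowDegree Fq h.natDegree, F ((u * c) %ₘ h) = ∑ c ∈ lowDegree Fq h.natDegree, F c := by
  obtain ⟨v, w, hvw⟩ := hu
  have hd := degree_eq_natDegree hh.ne_zero
  have hmem : ∀ c : Fq[X], c %ₘ h ∈ lowDegree Fq h.natDegree := fun c => by
    rw [mem_lowDegree, ← hd]; exact degree_modByMonic_lt _ hh
  have hmod : ∀ c : Fq[X], h ∣ c - c %ₘ h := fun c =>
    ⟨c /ₘ h, by rw [sub_eq_iff_eq_add]; rw [add_comm]; exact (modByMonic_add_div c h).symm⟩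
  have inv : ∀ a b : Fq[X], h ∣ a * b - 1 → ∀ c ∈ lowDegree Fq h.natDegree,
      (a * ((b * c) %ₘ h)) %ₘ h = c := by
    intro a b hab c hc
    rw [mem_lowDegree, ← hd] at hc
    refine eq_of_dvd_sub_of_degree_lt ?_ (degree_modByMonic_lt _ hh) hc
    have : (a * ((b * c) %ₘ h)) %ₘ h - c = (a * b - 1) * c - a * (b * c - (b * c) %ₘ h) -
      (a * ((b * c) %ₘ h) - (a * ((b * c) %ₘ h)) %ₘ h) := by ring
    rw [this]
    exact ((hab.mul_right c).sub ((hmod _).mul_left a)).sub (hmod _)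
  have hvu : h ∣ v * u - 1 := ⟨-w, by rw [← hvw]; ring⟩
  refine Finset.sum_nbij' (fun c => (u * c) %ₘ h) (fun c => (v * c) %ₘ h) (fun c _ => hmem _)
    (fun c _ => hmem _) (inv v u hvu) (inv u v (by rwa [mul_comm])) (fun _ _ => rfl)

end FiniteSets

section Vanishing

lemma exists_quadCharP_eq_neg_one (hq : ringChar Fq ≠ 2) {P : Fq[X]} (hP : Irreducible P) :
    ∃ a : Fq[X], quadCharP a P = -1 := by
  have := Fact.mk hP
  have := finite_adjoinRoot hP.ne_zero
  have := Fintype.ofFinite (AdjoinRoot P)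
  have hc : ringChar (AdjoinRoot P) ≠ 2 := by rwa [← Algebra.ringChar_eq Fq (AdjoinRoot P)]
  obtain ⟨a, ha⟩ := quadraticChar_exists_neg_one hc
  obtain ⟨b, rfl⟩ := AdjoinRoot.mk_surjective a
  exact ⟨b, by rw [quadCharP_eq_quadraticChar, ha]⟩

lemma exists_pow_mul_of_ne_zero {h P : Fq[X]} (hh : h.Monic) (hP : P.Monic) (hPi : Irreducible P) :
    ∃ (e : ℕ) (h₁ : Fq[X]), h₁.Monic ∧ ¬ P ∣ h₁ ∧ h = P ^ e * h₁ := by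
  obtain ⟨e, h₁, h1, h2⟩ := WfDvdMonoid.max_power_factor hh.ne_zero hPi
  exact ⟨e, h₁, (hP.pow e).of_mul_monic_left (h2 ▸ hh), h1, h2⟩

lemma exists_monic_irreducible_dvd {h : Fq[X]} (hh : h.Monic) (h1 : h ≠ 1) :
    ∃ P : Fq[X], P.Monic ∧ Irreducible P ∧ P ∣ h := by
  obtain ⟨Q, hQ, hQd⟩ := WfDvdMonoid.exists_irreducible_factor
    (fun hu => h1 (hh.eq_one_of_isUnit hu)) hh.ne_zero
  refine ⟨normalize Q, monic_normalize hQ.ne_zero, ?_, ?_⟩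
  · exact (associated_normalize Q).irreducible hQ
  · exact (normalize_dvd_iff).2 hQd

/-- A monic non-square polynomial has a prime factor of odd multiplicity. -/
lemma exists_odd_prime_power_factor : ∀ {h : Fq[X]}, h.Monic → ¬ IsSquare h →
    ∃ (P : Fq[X]) (e : ℕ) (h₁ : Fq[X]), P.Monic ∧ Irreducible P ∧ Odd e ∧ h₁.Monic ∧
      ¬ P ∣ h₁ ∧ h = P ^ e * h₁ := by
  intro h
  induction hd : h.natDegree using Nat.strong_induction_on generalizing h with
  | _ d ih =>
  intro hh hs
  have h1 : h ≠ 1 := by rintro rfl; exact hs ⟨1, by simp⟩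
  obtain ⟨P, hP, hPi, hPh⟩ := exists_monic_irreducible_dvd hh h1
  obtain ⟨e, h₁, hh₁, hP₁, rfl⟩ := exists_pow_mul_of_ne_zero hh hP hPi
  rcases Nat.even_or_odd e with he | he
  · have he0 : e ≠ 0 := by rintro rfl; simp at hPh; exact hP₁ hPh
    have hPd : 0 < P.natDegree := hPi.natDegree_pos
    obtain ⟨Q, f, h₂, hQ, hQi, hf, hh₂, hQ₂, e2⟩ := ih h₁.natDegree (by
      rw [← hd, (hP.pow e).natDegree_mul hh₁, hP.natDegree_pow]
      have := Nat.mul_pos (Nat.pos_of_ne_zero he0) hPd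
      omega) rfl hh₁ (fun hsq => hs ((he.isSquare_pow P).mul hsq))
    refine ⟨Q, f, P ^ e * h₂, hQ, hQi, hf, (hP.pow e).mul hh₂, ?_, by rw [e2]; ring⟩
    intro hdv
    rcases hQi.prime.dvd_or_dvd hdv with h3 | h3
    · have h4 := (hQi.associated_of_dvd hPi (hQi.prime.dvd_of_dvd_pow h3))
      apply hP₁
      rw [e2]
      exact (h4.symm.dvd.trans (dvd_pow_self Q hf.pos.ne')).mul_right _
    · exact hQ₂ h3
  · exact ⟨P, e, h₁, hP, hPi, he, hh₁, hP₁, rfl⟩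

/-- Given coprime moduli, one may prescribe residues. -/
lemma exists_crt {m n : Fq[X]} (h : IsCoprime m n) (a b : Fq[X]) :
    ∃ u, m ∣ u - a ∧ n ∣ u - b := by
  obtain ⟨x, y, hxy⟩ := h
  refine ⟨b * (x * m) + a * (y * n), ⟨b * x - a * x, ?_⟩, ⟨a * y - b * y, ?_⟩⟩
  · linear_combination a * hxy
  · linear_combination b * hxy

lemma isCoprime_of_not_dvd {P h : Fq[X]} (hP : Irreducible P) (h1 : ¬ P ∣ h) : IsCoprime P h :=
  (hP.coprime_iff_not_dvd).2 h1

lemma exists_jacobi_eq_neg_one (hq : ringChar Fq ≠ 2) {P h₁ : Fq[X]} {e : ℕ} (hPi : Irreducible P)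
    (he : Odd e) (hh₁ : h₁ ≠ 0) (hP₁ : ¬ P ∣ h₁) :
    ∃ u : Fq[X], jacobi u (P ^ e * h₁) = -1 ∧ h₁ ∣ u - 1 := by
  obtain ⟨a, ha⟩ := exists_quadCharP_eq_neg_one hq hPi
  obtain ⟨u, hu1, hu2⟩ := exists_crt (isCoprime_of_not_dvd hPi hP₁) a 1
  refine ⟨u, ?_, hu2⟩
  rw [jacobi_mul_right _ (pow_ne_zero _ hPi.ne_zero) hh₁, jacobi_pow_right _ hPi.ne_zero,
    jacobi_irreducible _ hPi, quadCharP_congr hu1, ha, jacobi_congr hu2, jacobi_one_left,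
    he.neg_one_pow, mul_one]

lemma isCoprime_of_jacobi_ne_zero {u h : Fq[X]} (hh : h ≠ 0) (hu : jacobi u h ≠ 0) :
    IsCoprime u h := by
  by_contra hc
  exact hu ((jacobi_eq_zero_iff hh).2 hc)

lemma dvd_sub_modByMonic (h c : Fq[X]) : h ∣ c - c %ₘ h :=
  ⟨c /ₘ h, by rw [sub_eq_iff_eq_add, add_comm]; exact (modByMonic_add_div c h).symm⟩

lemma jacobi_modByMonic (h c : Fq[X]) : jacobi (c %ₘ h) h = jacobi c h :=
  (jacobi_congr (dvd_sub_modByMonic h c)).symm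

lemma sum_lowDegree_jacobi_eq_zero (hq : ringChar Fq ≠ 2) {h : Fq[X]} (hh : h.Monic)
    (hs : ¬ IsSquare h) : ∑ c ∈ lowDegree Fq h.natDegree, jacobi c h = 0 := by
  obtain ⟨P, e, h₁, hP, hPi, he, hh₁, hP₁, rfl⟩ := exists_odd_prime_power_factor hh hs
  obtain ⟨u, hu, -⟩ := exists_jacobi_eq_neg_one hq hPi he hh₁.ne_zero hP₁
  have h1 := sum_lowDegree_mul_mod hh (isCoprime_of_jacobi_ne_zero hh.ne_zero (by rw [hu]; simp))
    (fun c => jacobi c (P ^ e * h₁))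
  simp only [jacobi_modByMonic, jacobi_mul_left, hu, neg_mul, one_mul,
    Finset.sum_neg_distrib] at h1
  omega

/-- Sums of a nontrivial character over monic polynomials of large degree vanish. -/
lemma sum_monicOfDegree_jacobi_eq_zero (hq : ringChar Fq ≠ 2) {h : Fq[X]} (hh : h.Monic)
    (hs : ¬ IsSquare h) {N : ℕ} (hN : h.natDegree ≤ N) :
    ∑ E ∈ monicOfDegree Fq N, jacobi E h = 0 := by
  rw [sum_monicOfDegree_divMod hh hN]
  refine Finset.sum_eq_zero fun t _ => ?_
  rw [← sum_lowDegree_jacobi_eq_zero hq hh hs]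
  exact Finset.sum_congr rfl fun c _ => jacobi_congr ⟨t, by ring⟩

end Vanishing

section FunctionalEquation

lemma natDegree_le_of_mem_lowDegree {m : ℕ} {c : Fq[X]} (hc : c ∈ lowDegree Fq (m + 1)) :
    c.natDegree ≤ m := by
  by_cases h0 : c = 0
  · simp [h0]
  · exact Nat.lt_succ_iff.1 ((natDegree_lt_iff_degree_lt h0).2 (mem_lowDegree.1 hc))

/-- The coefficient of `T ^ m` in the residue of `y` modulo `D`. -/
noncomputable def resCoeff (D : Fq[X]) (m : ℕ) (y : Fq[X]) : Fq := (y %ₘ D).coeff m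

lemma resCoeff_add (D : Fq[X]) (m : ℕ) (y z : Fq[X]) :
    resCoeff D m (y + z) = resCoeff D m y + resCoeff D m z := by
  simp [resCoeff, add_modByMonic]

lemma resCoeff_C_mul (D : Fq[X]) (m : ℕ) (a : Fq) (z : Fq[X]) :
    resCoeff D m (C a * z) = a * resCoeff D m z := by
  simp [resCoeff, ← smul_eq_C_mul, smul_modByMonic]

lemma resCoeff_of_degree_lt {D y : Fq[X]} (hD : D.Monic) (m : ℕ) (h : y.degree < D.degree) :
    resCoeff D m y = y.coeff m := by
  rw [resCoeff, (modByMonic_eq_self_iff hD).2 h]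

lemma resCoeff_congr {D y z : Fq[X]} (hD : D.Monic) (m : ℕ) (h : D ∣ y - z) :
    resCoeff D m y = resCoeff D m z := by
  rw [resCoeff, resCoeff, modByMonic_eq_of_dvd_sub hD h]

/-- The partial character sum attached to the additive condition `resCoeff D m (b * c) = 1`. -/
noncomputable def twistedSum (D : Fq[X]) (m : ℕ) (b : Fq[X]) : ℤ :=
  ∑ c ∈ lowDegree Fq D.natDegree, if resCoeff D m (b * c) = 1 then jacobi c D else 0

lemma twistedSum_congr {D b b' : Fq[X]} (hD : D.Monic) (m : ℕ) (h : D ∣ b - b') :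
    twistedSum D m b = twistedSum D m b' := by
  refine Finset.sum_congr rfl fun c _ => ?_
  rw [resCoeff_congr hD m (show D ∣ b * c - b' * c by rw [← sub_mul]; exact h.mul_right c)]

lemma jacobi_mul_twistedSum {D u : Fq[X]} (hD : D.Monic) (m : ℕ) (b : Fq[X])
    (hu : IsCoprime u D) : jacobi u D * twistedSum D m (b * u) = twistedSum D m b := by
  have h := sum_lowDegree_mul_mod hD hu
    (fun c => if resCoeff D m (b * c) = 1 then jacobi c D else 0)
  rw [twistedSum, twistedSum, ← h, Finset.mul_sum]
  refine Finset.sum_congr rfl fun c _ => ?_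
  rw [jacobi_modByMonic, resCoeff_congr hD m (y := b * (u * c %ₘ D)) (z := b * u * c), mul_ite,
    mul_zero, jacobi_mul_left]
  rw [mul_assoc, ← mul_sub]
  exact ((dvd_sub_comm).1 (dvd_sub_modByMonic D (u * c))).mul_left b

lemma twistedSum_eq_mul (hq : ringChar Fq ≠ 2) {D : Fq[X]} (hD : D.Monic) (hsq : Squarefree D)
    (m : ℕ) (b : Fq[X]) : twistedSum D m b = jacobi b D * twistedSum D m 1 := by
  by_cases hb : IsCoprime b D
  · have h := jacobi_mul_twistedSum hD m 1 hb
    rw [one_mul] at h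
    rw [← h, ← mul_assoc, ← pow_two, jacobi_sq hb, one_mul]
  · rw [(jacobi_eq_zero_iff hD.ne_zero).2 hb, zero_mul]
    obtain ⟨P, hP, h1⟩ : ∃ P : Fq[X], Irreducible P ∧ P ∣ b ∧ P ∣ D := by
      by_contra hcon
      push Not at hcon
      exact hb (isCoprime_of_irreducible_dvd (fun h => hD.ne_zero h.2)
        fun z hz hzb hzD => hcon z hz hzb hzD)
    obtain ⟨hPb, D', rfl⟩ := h1
    have hPD : ¬ P ∣ D' := fun hd => hP.not_isUnit (hsq P (mul_dvd_mul_left P hd))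
    have hD' : D' ≠ 0 := right_ne_zero_of_mul hD.ne_zero
    obtain ⟨u, hu, hu1⟩ := exists_jacobi_eq_neg_one hq hP odd_one hD' hPD
    rw [pow_one] at hu
    have h2 := jacobi_mul_twistedSum hD m b
      (isCoprime_of_jacobi_ne_zero hD.ne_zero (by rw [hu]; simp))
    rw [twistedSum_congr hD m (b := b * u) (b' := b), hu] at h2
    · omega
    · rw [show b * u - b = b * (u - 1) by ring]
      exact mul_dvd_mul hPb hu1

lemma twistedSum_one {D : Fq[X]} (hD : D.Monic) {m : ℕ} (hm : D.natDegree = m + 1) :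
    twistedSum D m 1 = ∑ c ∈ monicOfDegree Fq m, jacobi c D := by
  rw [twistedSum, ← Finset.sum_filter]
  refine Finset.sum_congr ?_ fun _ _ => rfl
  ext c
  rw [Finset.mem_filter, mem_lowDegree, mem_monicOfDegree, one_mul, hm]
  constructor
  · rintro ⟨h1, h2⟩
    rw [resCoeff_of_degree_lt hD _ (by rwa [degree_eq_natDegree hD.ne_zero, hm])] at h2
    have h3 : c.natDegree ≤ m := natDegree_le_of_mem_lowDegree (mem_lowDegree.2 h1)
    have h4 := le_natDegree_of_ne_zero (p := c) (n := m) (by rw [h2]; simp)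
    have h5 : c.natDegree = m := le_antisymm h3 h4
    exact ⟨by rw [Monic, leadingCoeff, h5, h2], h5⟩
  · rintro ⟨h1, h2⟩
    have h3 : c.degree < (m + 1 : ℕ) := by
      rw [degree_eq_natDegree h1.ne_zero, h2]; exact_mod_cast Nat.lt_succ_self m
    refine ⟨h3, ?_⟩
    rw [resCoeff_of_degree_lt hD _ (by rwa [degree_eq_natDegree hD.ne_zero, hm]), ← h2]
    exact h1

/-- Adding a multiple of `T ^ (2g - deg c)` changes `resCoeff` of the product in a controlled
way. -/
lemma resCoeff_X_pow_mul {D c : Fq[X]} (hD : D.Monic) {m : ℕ} (hm : D.natDegree = m + 1)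
    (hc0 : c ≠ 0) (hc : c.natDegree ≤ m) :
    resCoeff D m (X ^ (m - c.natDegree) * c) = c.leadingCoeff := by
  rw [resCoeff_of_degree_lt hD]
  · conv_lhs => rw [← Nat.sub_add_cancel hc]
    rw [Nat.sub_add_cancel hc]
    have := coeff_X_pow_mul c (m - c.natDegree) c.natDegree
    rwa [Nat.add_sub_cancel' hc] at this
  · rw [degree_eq_natDegree hD.ne_zero, hm, degree_mul, degree_X_pow, degree_eq_natDegree hc0]
    norm_cast
    omega

lemma card_filter_resCoeff_eq {D c : Fq[X]} (hD : D.Monic) {m n : ℕ} (hm : D.natDegree = m + 1)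
    (hc0 : c ≠ 0) (hc : c.natDegree ≤ m) (hn : m < c.natDegree + n) (v w : Fq) :
    ((monicOfDegree Fq n).filter fun b => resCoeff D m (b * c) = v).card =
      ((monicOfDegree Fq n).filter fun b => resCoeff D m (b * c) = w).card := by
  have hl : c.leadingCoeff ≠ 0 := leadingCoeff_ne_zero.2 hc0
  have key : ∀ v w : Fq, ∀ b ∈ (monicOfDegree Fq n).filter fun b => resCoeff D m (b * c) = v,
      b + C ((w - v) / c.leadingCoeff) * X ^ (m - c.natDegree) ∈
        (monicOfDegree Fq n).filter fun b => resCoeff D m (b * c) = w := by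
    intro v w b hb
    rw [Finset.mem_filter, mem_monicOfDegree] at hb ⊢
    obtain ⟨⟨h1, h2⟩, h3⟩ := hb
    have hlt : (C ((w - v) / c.leadingCoeff) * X ^ (m - c.natDegree)).degree < b.degree := by
      refine (degree_C_mul_X_pow_le _ _).trans_lt ?_
      rw [degree_eq_natDegree h1.ne_zero, h2]
      norm_cast
      omega
    refine ⟨⟨h1.add_of_left hlt, by rw [natDegree_add_eq_left_of_degree_lt hlt, h2]⟩, ?_⟩
    rw [add_mul, resCoeff_add, h3, mul_assoc, resCoeff_C_mul, resCoeff_X_pow_mul hD hm hc0 hc,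
      div_mul_cancel₀ _ hl]
    ring
  refine Finset.card_nbij' (fun b => b + C ((w - v) / c.leadingCoeff) * X ^ (m - c.natDegree))
    (fun b => b + C ((v - w) / c.leadingCoeff) * X ^ (m - c.natDegree)) (key v w) (key w v) ?_ ?_
  · intro b _
    have : (v - w) / c.leadingCoeff = -((w - v) / c.leadingCoeff) := by ring
    simp only [this, C_neg]; ring
  · intro b _
    have : (v - w) / c.leadingCoeff = -((w - v) / c.leadingCoeff) := by ring
    simp only [this, C_neg]; ring

lemma sum_mul_sum_jacobi (hq : ringChar Fq ≠ 2) {D : Fq[X]} (hD : D.Monic) (hsq : Squarefree D)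
    {m n : ℕ} (hm : D.natDegree = m + 1) (hme : Even m) (hn : n ≤ m) :
    (∑ c ∈ monicOfDegree Fq m, jacobi c D) * (∑ c ∈ monicOfDegree Fq n, jacobi c D) =
      (Fintype.card Fq : ℤ) ^ n * ∑ c ∈ monicOfDegree Fq (m - n), jacobi c D := by
  set cnt : Fq[X] → ℕ := fun c =>
    ((monicOfDegree Fq n).filter fun b => resCoeff D m (b * c) = 1).card with hcnt
  have h1 : (∑ c ∈ monicOfDegree Fq m, jacobi c D) * (∑ c ∈ monicOfDegree Fq n, jacobi c D) =
      ∑ c ∈ lowDegree Fq (m + 1), (cnt c : ℤ) * jacobi c D := by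
    rw [← twistedSum_one hD hm, mul_comm, Finset.sum_mul]
    simp_rw [← twistedSum_eq_mul hq hD hsq m, twistedSum]
    rw [Finset.sum_comm, hm]
    refine Finset.sum_congr rfl fun c _ => ?_
    rw [← Finset.sum_filter, Finset.sum_const, nsmul_eq_mul]
  have hdeg : ∀ c ∈ lowDegree Fq (m + 1), c.natDegree ≤ m :=
    fun c hc => natDegree_le_of_mem_lowDegree hc
  rw [h1, ← Finset.sum_filter_add_sum_filter_not _ (fun c => m < c.natDegree + n)]
  have h2 : ∑ c ∈ (lowDegree Fq (m + 1)).filter (fun c => m < c.natDegree + n),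
      (cnt c : ℤ) * jacobi c D = 0 := by
    obtain ⟨α, hα⟩ := quadraticChar_exists_neg_one hq
    have hα0 : α ≠ 0 := by rintro rfl; simp at hα
    have hCα : ∀ β : Fq, β ≠ 0 → ∀ c : Fq[X],
        c ∈ (lowDegree Fq (m + 1)).filter (fun c => m < c.natDegree + n) →
        C β * c ∈ (lowDegree Fq (m + 1)).filter (fun c => m < c.natDegree + n) := by
      intro β hβ c hc
      rw [Finset.mem_filter, mem_lowDegree] at hc ⊢
      rw [degree_C_mul hβ, natDegree_C_mul hβ]
      exact hc
    have h3 : ∑ c ∈ (lowDegree Fq (m + 1)).filter (fun c => m < c.natDegree + n),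
        (cnt c : ℤ) * jacobi c D =
        ∑ c ∈ (lowDegree Fq (m + 1)).filter (fun c => m < c.natDegree + n),
        -((cnt c : ℤ) * jacobi c D) := by
      symm
      refine Finset.sum_nbij' (fun c => C α * c) (fun c => C α⁻¹ * c) (hCα α hα0)
        (hCα α⁻¹ (inv_ne_zero hα0)) ?_ ?_ ?_
      · intro c _; rw [← mul_assoc, ← C_mul, inv_mul_cancel₀ hα0, C_1, one_mul]
      · intro c _; rw [← mul_assoc, ← C_mul, mul_inv_cancel₀ hα0, C_1, one_mul]
      · intro c hc
        have hc' := Finset.mem_filter.1 hc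
        have hcd := hdeg c hc'.1
        rw [jacobi_mul_left, jacobi_C hq hD, hα, hm, (Even.add_one hme).neg_one_pow]
        by_cases hc0 : c = 0
        · subst hc0
          simp only [natDegree_zero] at hc'
          omega
        have : cnt (C α * c) = cnt c := by
          rw [hcnt]
          simp only
          rw [← card_filter_resCoeff_eq hD hm hc0 hcd hc'.2 α⁻¹ 1]
          congr 1
          refine Finset.filter_congr fun b _ => ?_
          rw [show b * (C α * c) = C α * (b * c) by ring, resCoeff_C_mul, mul_comm α,
            mul_eq_one_iff_eq_inv₀ hα0]
        rw [this]; ring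
    rw [Finset.sum_neg_distrib] at h3
    omega
  rw [h2, zero_add, Finset.mul_sum, ← Finset.sum_filter_add_sum_filter_not
    ((lowDegree Fq (m + 1)).filter fun c => ¬ m < c.natDegree + n) (· ∈ monicOfDegree Fq (m - n))]
  have hlow : ∀ b ∈ monicOfDegree Fq n, ∀ c : Fq[X], ¬ m < c.natDegree + n →
      resCoeff D m (b * c) = (b * c).coeff m := by
    intro b hb c hc
    rw [mem_monicOfDegree] at hb
    refine resCoeff_of_degree_lt hD _ (degree_le_natDegree.trans_lt ?_)
    rw [degree_eq_natDegree hD.ne_zero, hm]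
    have := natDegree_mul_le (p := b) (q := c)
    norm_cast
    omega
  have h5 : ∑ c ∈ ((lowDegree Fq (m + 1)).filter fun c => ¬ m < c.natDegree + n).filter
      (¬ · ∈ monicOfDegree Fq (m - n)), (cnt c : ℤ) * jacobi c D = 0 := by
    refine Finset.sum_eq_zero fun c hc => ?_
    rw [Finset.mem_filter, Finset.mem_filter] at hc
    obtain ⟨⟨h3, h4⟩, h5⟩ := hc
    have : cnt c = 0 := by
      rw [hcnt]
      simp only
      rw [Finset.card_eq_zero, Finset.filter_eq_empty_iff]
      intro b hb he
      rw [hlow b hb c h4] at he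
      rw [mem_monicOfDegree] at hb
      apply h5
      have h6 := le_natDegree_of_ne_zero (p := b * c) (n := m) (by rw [he]; simp)
      have h7 := natDegree_mul_le (p := b) (q := c)
      have h8 : c.natDegree = m - n := by omega
      have h9 : (b * c).natDegree = m := by omega
      rw [mem_monicOfDegree]
      refine ⟨?_, h8⟩
      apply hb.1.of_mul_monic_left
      rw [Monic, leadingCoeff, h9, he]
    rw [this]; simp
  rw [h5, add_zero]
  refine Finset.sum_congr ?_ fun c hc => ?_
  · ext c
    rw [Finset.mem_filter, Finset.mem_filter, mem_lowDegree, mem_monicOfDegree]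
    constructor
    · exact fun h => h.2
    · rintro ⟨h3, h4⟩
      refine ⟨⟨?_, by omega⟩, h3, h4⟩
      rw [degree_eq_natDegree h3.ne_zero]; norm_cast; omega
  · have : cnt c = Fintype.card Fq ^ n := by
      rw [← card_monicOfDegree, hcnt]
      simp only
      rw [Finset.filter_true_of_mem]
      intro b hb
      rw [mem_monicOfDegree] at hc
      rw [hlow b hb c (by omega)]
      rw [mem_monicOfDegree] at hb
      have h3 := (hb.1.mul hc.1)
      rw [Monic, leadingCoeff, hb.1.natDegree_mul hc.1, hb.2, hc.2, Nat.add_sub_cancel' hn] at h3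
      exact h3
    rw [this]; push_cast; ring

end FunctionalEquation

section SquareRoots

/-- The residues modulo `D` whose square is congruent to `c`. -/
noncomputable def sqrtsMod (D c : Fq[X]) : Finset Fq[X] :=
  (lowDegree Fq D.natDegree).filter fun b => D ∣ b ^ 2 - c

/-- The monic divisors of a polynomial. -/
noncomputable def monicDivisors (D : Fq[X]) : Finset Fq[X] :=
  (monicUpTo Fq D.natDegree).filter (· ∣ D)

lemma mem_monicDivisors {D d : Fq[X]} (hD : D ≠ 0) : d ∈ monicDivisors D ↔ d.Monic ∧ d ∣ D := by
  rw [monicDivisors, Finset.mem_filter, mem_monicUpTo]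
  exact ⟨fun h => ⟨h.1.1, h.2⟩, fun h => ⟨⟨h.1, natDegree_le_of_dvd h.2 hD⟩, h.2⟩⟩

lemma modByMonic_mem_lowDegree {h : Fq[X]} (hh : h.Monic) (c : Fq[X]) :
    c %ₘ h ∈ lowDegree Fq h.natDegree := by
  rw [mem_lowDegree, ← degree_eq_natDegree hh.ne_zero]; exact degree_modByMonic_lt _ hh

lemma dvd_sq_sub_congr {D b b' c : Fq[X]} (h : D ∣ b - b') : D ∣ b ^ 2 - c ↔ D ∣ b' ^ 2 - c :=
  dvd_iff_dvd_of_dvd_sub (by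
    rw [show b ^ 2 - c - (b' ^ 2 - c) = (b - b') * (b + b') by ring]; exact h.mul_right _)

lemma card_sqrtsMod_irreducible (hq : ringChar Fq ≠ 2) {P : Fq[X]} (hP : P.Monic)
    (hPi : Irreducible P) (c : Fq[X]) : ((sqrtsMod P c).card : ℤ) = quadCharP c P + 1 := by
  have := Fact.mk hPi
  have := finite_adjoinRoot hPi.ne_zero
  have := Fintype.ofFinite (AdjoinRoot P)
  have hc : ringChar (AdjoinRoot P) ≠ 2 := by rwa [← Algebra.ringChar_eq Fq (AdjoinRoot P)]
  rw [quadCharP_eq_quadraticChar, ← quadraticChar_card_sqrts hc]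
  norm_cast
  have hd := degree_eq_natDegree hP.ne_zero
  refine Finset.card_bij (fun b _ => AdjoinRoot.mk P b) ?_ ?_ ?_
  · intro b hb
    rw [sqrtsMod, Finset.mem_filter] at hb
    rw [Set.mem_toFinset, Set.mem_ofPred_eq, ← map_pow, ← sub_eq_zero, ← map_sub,
      AdjoinRoot.mk_eq_zero]
    exact hb.2
  · intro a ha b hb hab
    rw [sqrtsMod, Finset.mem_filter, mem_lowDegree, ← hd] at ha hb
    exact eq_of_dvd_sub_of_degree_lt (AdjoinRoot.mk_eq_mk.1 hab) ha.1 hb.1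
  · intro x hx
    obtain ⟨b, rfl⟩ := AdjoinRoot.mk_surjective x
    rw [Set.mem_toFinset, Set.mem_ofPred_eq, ← map_pow, ← sub_eq_zero, ← map_sub,
      AdjoinRoot.mk_eq_zero] at hx
    refine ⟨b %ₘ P, ?_, ?_⟩
    · rw [sqrtsMod, Finset.mem_filter]
      exact ⟨modByMonic_mem_lowDegree hP b, (dvd_sq_sub_congr (dvd_sub_modByMonic P b)).1 hx⟩
    · exact (AdjoinRoot.mk_eq_mk.2 (dvd_sub_modByMonic P b)).symm

lemma card_sqrtsMod_mul {m n : Fq[X]} (hm : m.Monic) (hn : n.Monic) (hmn : IsCoprime m n)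
    (c : Fq[X]) : (sqrtsMod (m * n) c).card = (sqrtsMod m c).card * (sqrtsMod n c).card := by
  rw [← Finset.card_product]
  have hd := degree_eq_natDegree (hm.mul hn).ne_zero
  refine Finset.card_bij (fun b _ => (b %ₘ m, b %ₘ n)) ?_ ?_ ?_
  · intro b hb
    rw [sqrtsMod, Finset.mem_filter] at hb
    rw [Finset.mem_product, sqrtsMod, Finset.mem_filter, sqrtsMod, Finset.mem_filter]
    exact ⟨⟨modByMonic_mem_lowDegree hm b, (dvd_sq_sub_congr (dvd_sub_modByMonic m b)).1
      ((dvd_mul_right m n).trans hb.2)⟩, modByMonic_mem_lowDegree hn b,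
      (dvd_sq_sub_congr (dvd_sub_modByMonic n b)).1 ((dvd_mul_left n m).trans hb.2)⟩
  · intro a ha b hb hab
    rw [sqrtsMod, Finset.mem_filter, mem_lowDegree, ← hd] at ha hb
    rw [Prod.mk.injEq] at hab
    refine eq_of_dvd_sub_of_degree_lt (hmn.mul_dvd ?_ ?_) ha.1 hb.1
    · have := (dvd_sub_modByMonic m a).sub (dvd_sub_modByMonic m b)
      rw [hab.1] at this
      convert this using 1; ring
    · have := (dvd_sub_modByMonic n a).sub (dvd_sub_modByMonic n b)
      rw [hab.2] at this
      convert this using 1; ring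
  · rintro ⟨x, y⟩ hxy
    rw [Finset.mem_product, sqrtsMod, Finset.mem_filter, sqrtsMod, Finset.mem_filter,
      mem_lowDegree, mem_lowDegree, ← degree_eq_natDegree hm.ne_zero,
      ← degree_eq_natDegree hn.ne_zero] at hxy
    obtain ⟨u, hu1, hu2⟩ := exists_crt hmn x y
    have h1 : m ∣ u %ₘ (m * n) - x := by
      have := hu1.sub ((dvd_mul_right m n).trans (dvd_sub_modByMonic (m * n) u))
      convert this using 1; ring
    have h2 : n ∣ u %ₘ (m * n) - y := by
      have := hu2.sub ((dvd_mul_left n m).trans (dvd_sub_modByMonic (m * n) u))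
      convert this using 1; ring
    refine ⟨u %ₘ (m * n), ?_, ?_⟩
    · rw [sqrtsMod, Finset.mem_filter]
      exact ⟨modByMonic_mem_lowDegree (hm.mul hn) u, hmn.mul_dvd
        ((dvd_sq_sub_congr h1).2 hxy.1.2) ((dvd_sq_sub_congr h2).2 hxy.2.2)⟩
    · ext1
      · simp only
        rw [modByMonic_eq_of_dvd_sub hm h1]
        exact (modByMonic_eq_self_iff hm).2 hxy.1.1
      · simp only
        rw [modByMonic_eq_of_dvd_sub hn h2]
        exact (modByMonic_eq_self_iff hn).2 hxy.2.1

lemma sum_monicDivisors_irreducible_mul {P n : Fq[X]} (hP : P.Monic) (hPi : Irreducible P)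
    (hn : n.Monic) (hPn : ¬ P ∣ n) (F : Fq[X] → ℤ) :
    ∑ d ∈ monicDivisors (P * n), F d =
      ∑ d ∈ monicDivisors n, F d + ∑ d ∈ monicDivisors n, F (P * d) := by
  rw [← Finset.sum_filter_not_add_sum_filter (monicDivisors (P * n)) (P ∣ ·)]
  congr 1
  · refine Finset.sum_congr ?_ fun _ _ => rfl
    ext d
    rw [Finset.mem_filter, mem_monicDivisors (hP.mul hn).ne_zero, mem_monicDivisors hn.ne_zero]
    constructor
    · rintro ⟨⟨h1, h2⟩, h3⟩
      exact ⟨h1, (isCoprime_of_not_dvd hPi h3).symm.dvd_of_dvd_mul_left h2⟩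
    · rintro ⟨h1, h2⟩
      exact ⟨⟨h1, h2.mul_left P⟩, fun h => hPn (h.trans h2)⟩
  · symm
    refine Finset.sum_bij (fun d _ => P * d) ?_ ?_ ?_ (fun _ _ => rfl)
    · intro d hd
      rw [mem_monicDivisors hn.ne_zero] at hd
      rw [Finset.mem_filter, mem_monicDivisors (hP.mul hn).ne_zero]
      exact ⟨⟨hP.mul hd.1, mul_dvd_mul_left P hd.2⟩, dvd_mul_right _ _⟩
    · intro a _ b _ h
      exact mul_left_cancel₀ hP.ne_zero h
    · intro b hb
      rw [Finset.mem_filter, mem_monicDivisors (hP.mul hn).ne_zero] at hb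
      obtain ⟨⟨h1, h2⟩, d, rfl⟩ := hb
      exact ⟨d, (mem_monicDivisors hn.ne_zero).2
        ⟨hP.of_mul_monic_left h1, (mul_dvd_mul_iff_left hP.ne_zero).1 h2⟩, rfl⟩

lemma card_sqrtsMod (hq : ringChar Fq ≠ 2) (c : Fq[X]) : ∀ D : Fq[X], D.Monic → Squarefree D →
    ((sqrtsMod D c).card : ℤ) = ∑ d ∈ monicDivisors D, jacobi c d := by
  apply monic_induction
  · intro _
    have h1 : sqrtsMod (1 : Fq[X]) c = {0} := by
      ext b
      simp [sqrtsMod]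
    have h2 : monicDivisors (1 : Fq[X]) = {1} := by
      ext b
      rw [mem_monicDivisors one_ne_zero, Finset.mem_singleton]
      exact ⟨fun h => h.1.eq_one_of_isUnit (isUnit_of_dvd_one h.2), fun h => by simp [h, monic_one]⟩
    rw [h1, h2, Finset.sum_singleton, jacobi_one_right]; rfl
  · intro P n hP hPi hn ih hsq
    have hPn : ¬ P ∣ n := fun hd => hPi.not_isUnit (hsq P (mul_dvd_mul_left P hd))
    rw [card_sqrtsMod_mul hP hn (isCoprime_of_not_dvd hPi hPn), Nat.cast_mul,
      card_sqrtsMod_irreducible hq hP hPi, ih (hsq.squarefree_of_dvd (dvd_mul_left _ _)),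
      sum_monicDivisors_irreducible_mul hP hPi hn hPn, add_mul, one_mul, add_comm, Finset.mul_sum]
    congr 1
    refine Finset.sum_congr rfl fun d hd => ?_
    rw [mem_monicDivisors hn.ne_zero] at hd
    rw [jacobi_mul_right _ hP.ne_zero hd.1.ne_zero, jacobi_irreducible _ hPi]

/-- The number of residues whose square is congruent to a monic polynomial of top degree,
expressed with the character sum. -/
lemma card_filter_resCoeff_sq (hq : ringChar Fq ≠ 2) {D : Fq[X]} (hD : D.Monic)
    (hsq : Squarefree D) {m : ℕ} (hm : D.natDegree = m + 1) :
    (((lowDegree Fq (m + 1)).filter fun b => resCoeff D m (b ^ 2) = 1).card : ℤ) =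
      (Fintype.card Fq : ℤ) ^ m + ∑ c ∈ monicOfDegree Fq m, jacobi c D := by
  have hdD := degree_eq_natDegree hD.ne_zero
  have h1 : ((lowDegree Fq (m + 1)).filter fun b => resCoeff D m (b ^ 2) = 1).card =
      ∑ c ∈ monicOfDegree Fq m, (sqrtsMod D c).card := by
    rw [Finset.card_eq_sum_card_fiberwise (f := fun b => (b ^ 2) %ₘ D)
      (t := monicOfDegree Fq m)]
    · refine Finset.sum_congr rfl fun c hc => ?_
      congr 1
      ext b
      rw [mem_monicOfDegree] at hc
      have hcd : c.degree < D.degree := by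
        rw [hdD, hm, degree_eq_natDegree hc.1.ne_zero, hc.2]; exact_mod_cast Nat.lt_succ_self m
      rw [sqrtsMod, Finset.mem_filter, Finset.mem_filter, Finset.mem_filter, hm, resCoeff, and_assoc]
      refine and_congr_right fun _ => ?_
      constructor
      · rintro ⟨_, h2⟩
        rw [← h2]; exact dvd_sub_modByMonic _ _
      · intro h2
        have h3 : (b ^ 2) %ₘ D = c := by
          rw [modByMonic_eq_of_dvd_sub hD h2]; exact (modByMonic_eq_self_iff hD).2 hcd
        refine ⟨?_, h3⟩
        rw [h3, ← hc.2]; exact hc.1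
    · intro b hb
      have hb2 := (Finset.mem_filter.1 hb).2
      rw [resCoeff] at hb2
      have h3 := natDegree_le_of_mem_lowDegree (hm ▸ modByMonic_mem_lowDegree hD (b ^ 2))
      have h4 := le_natDegree_of_ne_zero (p := (b ^ 2) %ₘ D) (n := m) (by rw [hb2]; simp)
      have h5 := le_antisymm h3 h4
      simp only [Finset.mem_coe, mem_monicOfDegree]
      exact ⟨by rw [Monic, leadingCoeff, h5, hb2], h5⟩
  rw [h1, Nat.cast_sum, Finset.sum_congr rfl fun c _ => card_sqrtsMod hq c D hD hsq,
    Finset.sum_comm]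
  have hD1 : D ≠ 1 := by rintro rfl; simp at hm
  have hsub : ({1, D} : Finset Fq[X]) ⊆ monicDivisors D := by
    intro d hd
    rw [mem_monicDivisors hD.ne_zero]
    rcases Finset.mem_insert.1 hd with rfl | h
    · exact ⟨monic_one, one_dvd _⟩
    · rw [Finset.mem_singleton] at h; subst h; exact ⟨hD, dvd_rfl⟩
  rw [← Finset.sum_subset hsub, Finset.sum_pair hD1.symm]
  · simp [jacobi_one_right, card_monicOfDegree]
  · intro d hd hd'
    rw [mem_monicDivisors hD.ne_zero] at hd
    rw [Finset.mem_insert, Finset.mem_singleton] at hd'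
    push Not at hd'
    refine sum_monicOfDegree_jacobi_eq_zero hq hd.1 ?_ ?_
    · rintro ⟨r, rfl⟩
      have hu := hsq r hd.2
      exact hd'.1 (hd.1.eq_one_of_isUnit (hu.mul hu))
    · have h2 := natDegree_le_of_dvd hd.2 hD.ne_zero
      by_contra h3
      exact hd'.2 (eq_of_monic_of_dvd_of_natDegree_le hd.1 hD hd.2 (by omega)).symm

end SquareRoots

section CentralValue

lemma resCoeff_add_X_pow_sq {D b : Fq[X]} (hD : D.Monic) {g : ℕ} (hD2 : D.natDegree = 2 * g + 1)
    (hb0 : b ≠ 0) (hb : b.natDegree ≤ 2 * g) (hb' : g < b.natDegree) (a : Fq) :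
    resCoeff D (2 * g) ((b + C a * X ^ (2 * g - b.natDegree)) ^ 2) =
      resCoeff D (2 * g) (b ^ 2) + 2 * a * b.leadingCoeff := by
  have h1 : (b + C a * X ^ (2 * g - b.natDegree)) ^ 2 =
      b ^ 2 + C (2 * a) * (X ^ (2 * g - b.natDegree) * b) +
        C (a ^ 2) * X ^ (2 * (2 * g - b.natDegree)) := by
    rw [C_mul, C_pow, pow_mul']
    rw [show (C 2 : Fq[X]) = 2 from rfl]
    ring
  rw [h1, resCoeff_add, resCoeff_add, resCoeff_C_mul, resCoeff_C_mul,
    resCoeff_X_pow_mul hD hD2 hb0 hb, resCoeff_of_degree_lt (y := X ^ _) hD, coeff_X_pow, if_neg]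
  · ring
  · omega
  · rw [degree_X_pow, degree_eq_natDegree hD.ne_zero]
    norm_cast; omega

lemma card_filter_resCoeff_sq_large (hq : ringChar Fq ≠ 2) {D : Fq[X]} (hD : D.Monic) {g : ℕ}
    (hD2 : D.natDegree = 2 * g + 1) (v w : Fq) :
    (((lowDegree Fq (2 * g + 1)).filter fun b => g < b.natDegree ∧
      resCoeff D (2 * g) (b ^ 2) = v).card) =
    (((lowDegree Fq (2 * g + 1)).filter fun b => g < b.natDegree ∧
      resCoeff D (2 * g) (b ^ 2) = w).card) := by
  have h2 : (2 : Fq) ≠ 0 := Ring.two_ne_zero hq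
  have hlt : ∀ (b : Fq[X]) (a : Fq), b ≠ 0 → g < b.natDegree →
      (C a * X ^ (2 * g - b.natDegree)).degree < b.degree := by
    intro b a hb0 hb
    refine (degree_C_mul_X_pow_le _ _).trans_lt ?_
    rw [degree_eq_natDegree hb0]
    norm_cast; omega
  have hne : ∀ b : Fq[X], g < b.natDegree → b ≠ 0 := by rintro b h rfl; simp at h
  have key : ∀ v w : Fq, ∀ b ∈ (lowDegree Fq (2 * g + 1)).filter (fun b => g < b.natDegree ∧
      resCoeff D (2 * g) (b ^ 2) = v),
      b + C ((w - v) / (2 * b.leadingCoeff)) * X ^ (2 * g - b.natDegree) ∈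
      (lowDegree Fq (2 * g + 1)).filter (fun b => g < b.natDegree ∧
      resCoeff D (2 * g) (b ^ 2) = w) := by
    intro v w b hb
    rw [Finset.mem_filter] at hb ⊢
    obtain ⟨h3, h4, h5⟩ := hb
    have hb0 := hne b h4
    have h6 := hlt b ((w - v) / (2 * b.leadingCoeff)) hb0 h4
    have h7 : b.leadingCoeff ≠ 0 := leadingCoeff_ne_zero.2 hb0
    rw [mem_lowDegree] at h3 ⊢
    refine ⟨by rwa [degree_add_eq_left_of_degree_lt h6],
      by rwa [natDegree_add_eq_left_of_degree_lt h6], ?_⟩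
    rw [resCoeff_add_X_pow_sq hD hD2 hb0 (natDegree_le_of_mem_lowDegree (mem_lowDegree.2 h3)) h4, h5]
    field_simp
    ring
  have inv : ∀ v w : Fq, ∀ b ∈ (lowDegree Fq (2 * g + 1)).filter (fun b => g < b.natDegree ∧
      resCoeff D (2 * g) (b ^ 2) = v),
      (fun b : Fq[X] => b + C ((v - w) / (2 * b.leadingCoeff)) * X ^ (2 * g - b.natDegree))
      (b + C ((w - v) / (2 * b.leadingCoeff)) * X ^ (2 * g - b.natDegree)) = b := by
    intro v w b hb
    rw [Finset.mem_filter] at hb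
    obtain ⟨h3, h4, h5⟩ := hb
    have hb0 := hne b h4
    have h6 := hlt b ((w - v) / (2 * b.leadingCoeff)) hb0 h4
    simp only [natDegree_add_eq_left_of_degree_lt h6, leadingCoeff_add_of_degree_lt' h6]
    rw [show (v - w) / (2 * b.leadingCoeff) = -((w - v) / (2 * b.leadingCoeff)) by ring, C_neg]
    ring
  exact Finset.card_nbij' _ _ (key v w) (key w v) (inv v w) (inv w v)

lemma card_lowDegree_filter_coeff_eq (g : ℕ) (v : Fq) :
    ((lowDegree Fq (g + 1)).filter fun b => b.coeff g = v).card = Fintype.card Fq ^ g := by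
  rw [← card_lowDegree]
  have hXd : ∀ a : Fq, (C a * X ^ g : Fq[X]).degree ≤ g := fun a => degree_C_mul_X_pow_le _ _
  refine Finset.card_nbij' (fun b => b - C v * X ^ g) (fun b => b + C v * X ^ g) ?_ ?_
    (fun b _ => by ring) (fun b _ => by ring)
  · intro b hb
    simp only [Finset.coe_filter, Set.mem_ofPred_eq, mem_lowDegree] at hb
    simp only [Finset.mem_coe, mem_lowDegree]
    rw [degree_lt_iff_coeff_zero]
    intro j hj
    rcases hj.lt_or_eq with h | h
    · rw [coeff_sub, coeff_C_mul_X_pow, if_neg (by omega), sub_zero]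
      exact (degree_lt_iff_coeff_zero _ _).1 hb.1 j (by omega)
    · subst h; rw [coeff_sub, coeff_C_mul_X_pow, if_pos rfl, hb.2, sub_self]
  · intro b hb
    simp only [Finset.mem_coe, mem_lowDegree] at hb
    simp only [Finset.coe_filter, Set.mem_ofPred_eq, mem_lowDegree]
    rw [degree_lt_iff_coeff_zero] at hb ⊢
    refine ⟨fun j hj => ?_, ?_⟩
    · rw [coeff_add, coeff_C_mul_X_pow, if_neg (by omega), hb j (by omega), add_zero]
    · rw [coeff_add, coeff_C_mul_X_pow, if_pos rfl, hb g le_rfl, zero_add]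

lemma card_filter_resCoeff_sq_small (hq : ringChar Fq ≠ 2) {D : Fq[X]} (hD : D.Monic) {g : ℕ}
    (hD2 : D.natDegree = 2 * g + 1) :
    ((lowDegree Fq (2 * g + 1)).filter fun b => ¬ g < b.natDegree ∧
      resCoeff D (2 * g) (b ^ 2) = 1).card = 2 * Fintype.card Fq ^ g := by
  have h2 : (2 : Fq) ≠ 0 := Ring.two_ne_zero hq
  have : (lowDegree Fq (2 * g + 1)).filter (fun b => ¬ g < b.natDegree ∧
      resCoeff D (2 * g) (b ^ 2) = 1) =
      (lowDegree Fq (g + 1)).filter (fun b => b.coeff g = 1) ∪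
      (lowDegree Fq (g + 1)).filter (fun b => b.coeff g = -1) := by
    ext b
    rw [← Finset.filter_or, Finset.mem_filter, Finset.mem_filter, ← and_assoc]
    have h3 : b ∈ lowDegree Fq (2 * g + 1) ∧ ¬ g < b.natDegree ↔ b ∈ lowDegree Fq (g + 1) := by
      constructor
      · rintro ⟨-, h⟩
        rw [mem_lowDegree]
        refine degree_le_natDegree.trans_lt ?_
        norm_cast; omega
      · intro h
        refine ⟨?_, by have := natDegree_le_of_mem_lowDegree h; omega⟩
        rw [mem_lowDegree] at h ⊢
        exact h.trans_le (by norm_cast; omega)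
    rw [h3]
    refine and_congr_right fun hb => ?_
    have hb' := natDegree_le_of_mem_lowDegree hb
    rw [resCoeff_of_degree_lt hD, coeff_pow_of_natDegree_le hb', sq_eq_one_iff]
    refine degree_le_natDegree.trans_lt ?_
    rw [degree_eq_natDegree hD.ne_zero, hD2]
    have := natDegree_pow_le (p := b) (n := 2)
    norm_cast; omega
  rw [this, Finset.card_union_of_disjoint, card_lowDegree_filter_coeff_eq,
    card_lowDegree_filter_coeff_eq, two_mul]
  rw [Finset.disjoint_filter]
  intro b _ h3 h4
  rw [h3] at h4
  apply h2
  linear_combination h4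

lemma card_filter_resCoeff_sq' (hq : ringChar Fq ≠ 2) {D : Fq[X]} (hD : D.Monic) {g : ℕ}
    (hD2 : D.natDegree = 2 * g + 1) :
    ((lowDegree Fq (2 * g + 1)).filter fun b => resCoeff D (2 * g) (b ^ 2) = 1).card =
      Fintype.card Fq ^ (2 * g) + Fintype.card Fq ^ g := by
  have hq0 : 0 < Fintype.card Fq := Fintype.card_pos
  have h1 : Fintype.card Fq * ((lowDegree Fq (2 * g + 1)).filter fun b => g < b.natDegree ∧
      resCoeff D (2 * g) (b ^ 2) = 1).card =
      ((lowDegree Fq (2 * g + 1)).filter fun b => g < b.natDegree).card := by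
    rw [Finset.card_eq_sum_card_fiberwise (f := fun b => resCoeff D (2 * g) (b ^ 2))
      (s := (lowDegree Fq (2 * g + 1)).filter fun b => g < b.natDegree) (t := Finset.univ) (fun _ _ => Finset.mem_coe.2 (Finset.mem_univ _))]
    simp_rw [Finset.filter_filter]
    rw [Finset.sum_congr rfl fun v _ => card_filter_resCoeff_sq_large hq hD hD2 v 1,
      Finset.sum_const, Finset.card_univ, smul_eq_mul]
  have h2 : (lowDegree Fq (2 * g + 1)).filter (fun b => ¬ g < b.natDegree) =
      lowDegree Fq (g + 1) := by
    ext b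
    rw [Finset.mem_filter]
    constructor
    · rintro ⟨-, h⟩
      rw [mem_lowDegree]
      refine degree_le_natDegree.trans_lt ?_
      norm_cast; omega
    · intro h
      refine ⟨?_, by have := natDegree_le_of_mem_lowDegree h; omega⟩
      rw [mem_lowDegree] at h ⊢
      exact h.trans_le (by norm_cast; omega)
  have h3 := Finset.card_filter_add_card_filter_not (s := lowDegree Fq (2 * g + 1))
    (fun b => g < b.natDegree)
  rw [h2, card_lowDegree, card_lowDegree, ← h1] at h3
  have h4 := Finset.card_filter_add_card_filter_not
    (s := (lowDegree Fq (2 * g + 1)).filter fun b => resCoeff D (2 * g) (b ^ 2) = 1)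
    (fun b => g < b.natDegree)
  simp_rw [Finset.filter_filter, and_comm (b := g < _), and_comm (b := ¬ g < _)] at h4
  rw [card_filter_resCoeff_sq_small hq hD hD2] at h4
  rw [← h4]
  set L := ((lowDegree Fq (2 * g + 1)).filter fun b => g < b.natDegree ∧
      resCoeff D (2 * g) (b ^ 2) = 1).card
  have h5 : L + Fintype.card Fq ^ g = Fintype.card Fq ^ (2 * g) := by
    apply Nat.eq_of_mul_eq_mul_left hq0
    rw [mul_add, ← pow_succ', h3, ← pow_succ']
  omega

lemma sum_monicOfDegree_jacobi_top (hq : ringChar Fq ≠ 2) {D : Fq[X]} (hD : D.Monic)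
    (hsq : Squarefree D) {g : ℕ} (hD2 : D.natDegree = 2 * g + 1) :
    ∑ c ∈ monicOfDegree Fq (2 * g), jacobi c D = (Fintype.card Fq : ℤ) ^ g := by
  have h1 := card_filter_resCoeff_sq hq hD hsq hD2
  rw [card_filter_resCoeff_sq' hq hD hD2] at h1
  push_cast at h1
  omega

/-- The functional equation for the coefficients of the `L`-function. -/
lemma sum_jacobi_functional_equation (hq : ringChar Fq ≠ 2) {D : Fq[X]} (hD : D.Monic)
    (hsq : Squarefree D) {g n : ℕ} (hD2 : D.natDegree = 2 * g + 1) (hn : n ≤ 2 * g) :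
    (Fintype.card Fq : ℤ) ^ g * ∑ f ∈ monicOfDegree Fq n, jacobi D f =
      (Fintype.card Fq : ℤ) ^ n * ∑ f ∈ monicOfDegree Fq (2 * g - n), jacobi D f := by
  have h1 := sum_mul_sum_jacobi hq hD hsq hD2 (even_two_mul g) hn
  rw [sum_monicOfDegree_jacobi_top hq hD hsq hD2] at h1
  have h2 : ∀ m : ℕ, ∑ f ∈ monicOfDegree Fq m, jacobi D f =
      quadraticChar Fq (-1) ^ (m * D.natDegree) * ∑ f ∈ monicOfDegree Fq m, jacobi f D := by
    intro m
    rw [Finset.mul_sum]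
    refine Finset.sum_congr rfl fun f hf => ?_
    rw [mem_monicOfDegree] at hf
    rw [jacobi_reciprocity hq hD hf.1, hf.2]
  have h3 : quadraticChar Fq (-1) ^ 2 = 1 := by
    rw [← map_pow]; simp
  have h4 : quadraticChar Fq (-1) ^ (n * D.natDegree) =
      quadraticChar Fq (-1) ^ ((2 * g - n) * D.natDegree) := by
    have h5 : (2 * g - n) * D.natDegree + 2 * (n * D.natDegree) =
      n * D.natDegree + 2 * (g * D.natDegree) := by
      obtain ⟨l, hl⟩ := Nat.exists_eq_add_of_le hn
      rw [hl, Nat.add_sub_cancel_left]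
      have : 2 * (g * D.natDegree) = (n + l) * D.natDegree := by rw [← hl]; ring
      rw [this]; ring
    calc _ = quadraticChar Fq (-1) ^ (n * D.natDegree + 2 * (g * D.natDegree)) := by
          rw [pow_add, pow_mul _ 2, h3, one_pow, mul_one]
      _ = _ := by rw [← h5, pow_add, pow_mul _ 2, h3, one_pow, mul_one]
  rw [h2, h2, h4]
  linear_combination quadraticChar Fq (-1) ^ ((2 * g - n) * D.natDegree) * h1

lemma finsum_monicDeg (n : ℕ) (F : Fq[X] → ℝ) :
    ∑ᶠ f ∈ monicDeg Fq n, F f = ∑ f ∈ monicOfDegree Fq n, F f := by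
  rw [monicOfDegree, finsum_mem_eq_finite_toFinset_sum _ (finite_monicDeg Fq n)]

/-- A partial sum of `∑ χ_D(f) |f|^{-1/2}` over monic polynomials. -/
noncomputable def partialL (y : ℕ) (D : Fq[X]) : ℝ :=
  ∑ f ∈ monicUpTo Fq y, (jacobi D f : ℝ) * (√(Fintype.card Fq : ℝ))⁻¹ ^ f.natDegree

/-- The approximate functional equation. -/
lemma LhalfR_eq (hq : ringChar Fq ≠ 2) {D : Fq[X]} (hD : D.Monic) (hsq : Squarefree D) {g : ℕ}
    (hg : 1 ≤ g) (hD2 : D.natDegree = 2 * g + 1) :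
    LhalfR D = partialL g D + partialL (g - 1) D := by
  have hq0 : (0 : ℝ) < Fintype.card Fq := by exact_mod_cast Fintype.card_pos
  set s : ℝ := (√(Fintype.card Fq : ℝ))⁻¹ with hs
  have hs2 : (Fintype.card Fq : ℝ) * s ^ 2 = 1 := by
    rw [hs, inv_pow, Real.sq_sqrt hq0.le, mul_inv_cancel₀ hq0.ne']
  have hp : ∀ y, partialL y D =
      ∑ n ∈ Finset.range (y + 1), (∑ f ∈ monicOfDegree Fq n, (jacobi D f : ℝ)) * s ^ n := by
    intro y
    rw [partialL, sum_monicUpTo]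
    refine Finset.sum_congr rfl fun n _ => ?_
    rw [Finset.sum_mul]
    exact Finset.sum_congr rfl fun f hf => by rw [(mem_monicOfDegree.1 hf).2]
  rw [LhalfR, hp, hp, hD2]
  simp_rw [finsum_monicDeg]
  rw [show 2 * g + 1 = (g + 1) + g by ring, Finset.sum_range_add, Nat.sub_add_cancel hg]
  congr 1
  rw [← Finset.sum_range_reflect]
  refine Finset.sum_congr rfl fun j hj => ?_
  rw [Finset.mem_range] at hj
  have h1 := sum_jacobi_functional_equation hq hD hsq hD2 (n := j) (by omega)
  have h2 : (Fintype.card Fq : ℝ) ^ g * ∑ f ∈ monicOfDegree Fq j, (jacobi D f : ℝ) =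
      (Fintype.card Fq : ℝ) ^ j * ∑ f ∈ monicOfDegree Fq (2 * g - j), (jacobi D f : ℝ) := by
    exact_mod_cast h1
  have e1 : g + 1 + (g - 1 - j) = 2 * g - j := by omega
  rw [e1]
  obtain ⟨l, rfl⟩ := Nat.exists_eq_add_of_lt hj
  have e2 : 2 * (j + l + 1) - j = j + 2 * (l + 1) := by omega
  rw [e2] at h2 ⊢
  rw [show j + l + 1 = j + (l + 1) by ring, pow_add, mul_assoc] at h2
  have h3 := mul_left_cancel₀ (pow_pos hq0 j).ne' h2
  rw [← h3, pow_add _ j (2 * (l + 1)), pow_mul _ 2 (l + 1), ← hs]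
  have h4 : (Fintype.card Fq : ℝ) ^ (l + 1) * (s ^ 2) ^ (l + 1) = 1 := by
    rw [← mul_pow, hs2, one_pow]
  linear_combination (∑ f ∈ monicOfDegree Fq j, (jacobi D f : ℝ)) * s ^ j * h4

end CentralValue

section Sieve

variable (Fq) in
/-- The monic irreducible polynomials of degree at most `g`. -/
noncomputable def primesUpTo (g : ℕ) : Finset Fq[X] := (monicUpTo Fq g).filter Irreducible

lemma mem_primesUpTo {g : ℕ} {P : Fq[X]} :
    P ∈ primesUpTo Fq g ↔ (P.Monic ∧ P.natDegree ≤ g) ∧ Irreducible P := by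
  rw [primesUpTo, Finset.mem_filter, mem_monicUpTo]

/-- The primes of degree at most `g` whose square divides `B`. -/
noncomputable def squarePrimes (g : ℕ) (B : Fq[X]) : Finset Fq[X] :=
  (primesUpTo Fq g).filter (· ^ 2 ∣ B)

lemma squarePrimes_subset (g : ℕ) (B : Fq[X]) : squarePrimes g B ⊆ primesUpTo Fq g :=
  Finset.filter_subset _ _

lemma monic_prod_of_subset {g : ℕ} {S : Finset Fq[X]} (hS : S ⊆ primesUpTo Fq g) :
    (∏ P ∈ S, P).Monic :=
  monic_prod_of_monic _ _ fun _ hP => (mem_primesUpTo.1 (hS hP)).1.1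

lemma subset_squarePrimes_iff {g : ℕ} {B : Fq[X]} {S : Finset Fq[X]}
    (hS : S ⊆ primesUpTo Fq g) : S ⊆ squarePrimes g B ↔ (∏ P ∈ S, P) ^ 2 ∣ B := by
  constructor
  · intro h
    rw [← Finset.prod_pow]
    refine Finset.prod_dvd_of_coprime ?_ fun P hP => (Finset.mem_filter.1 (h hP)).2
    intro P hP Q hQ hne
    have h1 := mem_primesUpTo.1 (hS hP)
    have h2 := mem_primesUpTo.1 (hS hQ)
    refine (isCoprime_of_not_dvd h1.2 fun hd => hne ?_).pow
    exact eq_of_monic_of_associated h1.1.1 h2.1.1 (h1.2.associated_of_dvd h2.2 hd)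
  · intro h P hP
    have h1 : P ∣ ∏ P ∈ S, P := Finset.dvd_prod_of_mem (fun P => P) hP
    exact Finset.mem_filter.2 ⟨hS hP, (pow_dvd_pow_of_dvd h1 2).trans h⟩

lemma squarefree_iff_squarePrimes {g : ℕ} {B : Fq[X]} (hB : B.Monic)
    (hBd : B.natDegree = 2 * g + 1) : Squarefree B ↔ squarePrimes g B = ∅ := by
  constructor
  · intro h
    refine Finset.eq_empty_of_forall_notMem fun P hP => ?_
    rw [squarePrimes, Finset.mem_filter, mem_primesUpTo] at hP
    exact hP.1.2.not_isUnit (h P (by rw [← pow_two]; exact hP.2))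
  · intro h x hx
    by_contra hu
    have hx0 : x ≠ 0 := by rintro rfl; exact hB.ne_zero (by simpa using hx)
    have hn : (normalize x) ≠ 1 := fun h1 => hu (normalize_eq_one.1 h1)
    obtain ⟨P, hP, hPi, hPd⟩ := exists_monic_irreducible_dvd (monic_normalize hx0) hn
    have hd : P ^ 2 ∣ B := by
      rw [pow_two]
      exact (mul_dvd_mul (dvd_normalize_iff.1 hPd) (dvd_normalize_iff.1 hPd)).trans hx
    have h3 := natDegree_le_of_dvd hd hB.ne_zero
    rw [hP.natDegree_pow] at h3
    have : P ∈ squarePrimes g B :=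
      Finset.mem_filter.2 ⟨mem_primesUpTo.2 ⟨⟨hP, by omega⟩, hPi⟩, hd⟩
    rw [h] at this
    simp at this

/-- The contribution of divisors of small degree to the square-free sieve. -/
noncomputable def sieveMain (g J : ℕ) (B : Fq[X]) : ℝ :=
  ∑ S ∈ (squarePrimes g B).powerset.filter (fun S => (∏ P ∈ S, P).natDegree ≤ J),
    (-1 : ℝ) ^ S.card

/-- The contribution of divisors of large degree to the square-free sieve. -/
noncomputable def sieveTail (g J : ℕ) (B : Fq[X]) : ℝ :=
  ∑ S ∈ (squarePrimes g B).powerset.filter (fun S => ¬ (∏ P ∈ S, P).natDegree ≤ J),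
    (-1 : ℝ) ^ S.card

lemma sieveMain_add_sieveTail (J : ℕ) {g : ℕ} {B : Fq[X]} (hB : B.Monic)
    (hBd : B.natDegree = 2 * g + 1) :
    sieveMain g J B + sieveTail g J B = if Squarefree B then 1 else 0 := by
  rw [sieveMain, sieveTail, Finset.sum_filter_add_sum_filter_not]
  have h := Finset.sum_powerset_neg_one_pow_card (x := squarePrimes g B)
  have h2 : ∑ S ∈ (squarePrimes g B).powerset, (-1 : ℝ) ^ S.card =
      if squarePrimes g B = ∅ then 1 else 0 := by exact_mod_cast congrArg (Int.cast (R := ℝ)) h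
  rw [h2]
  exact if_congr (squarefree_iff_squarePrimes hB hBd).symm rfl rfl

lemma sum_sieveMain_mul_jacobi (hq : ringChar Fq ≠ 2) {g J : ℕ} {h : Fq[X]} (hh : h.Monic)
    (hs : ¬ IsSquare h) (hd : h.natDegree + 2 * J ≤ 2 * g + 1) :
    ∑ B ∈ monicOfDegree Fq (2 * g + 1), sieveMain g J B * (jacobi B h : ℝ) = 0 := by
  have h1 : ∀ B : Fq[X], sieveMain g J B * (jacobi B h : ℝ) =
      ∑ S ∈ (primesUpTo Fq g).powerset.filter (fun S => (∏ P ∈ S, P).natDegree ≤ J),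
        if (∏ P ∈ S, P) ^ 2 ∣ B then (-1 : ℝ) ^ S.card * (jacobi B h : ℝ) else 0 := by
    intro B
    rw [sieveMain, Finset.sum_mul, ← Finset.sum_filter]
    refine Finset.sum_congr ?_ fun _ _ => rfl
    ext S
    simp only [Finset.mem_filter, Finset.mem_powerset]
    constructor
    · rintro ⟨h1, h2⟩
      have h3 := h1.trans (squarePrimes_subset g B)
      exact ⟨⟨h3, h2⟩, (subset_squarePrimes_iff h3).1 h1⟩
    · rintro ⟨⟨h1, h2⟩, h3⟩
      exact ⟨(subset_squarePrimes_iff h1).2 h3, h2⟩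
  simp_rw [h1]
  rw [Finset.sum_comm]
  refine Finset.sum_eq_zero fun S hS => ?_
  rw [Finset.mem_filter, Finset.mem_powerset] at hS
  have hm := monic_prod_of_subset hS.1
  have hm2 := hm.pow 2
  have hd2 : ((∏ P ∈ S, P) ^ 2).natDegree = 2 * (∏ P ∈ S, P).natDegree := hm.natDegree_pow 2
  rw [← Finset.sum_filter, sum_filter_dvd hm2 (by omega)]
  have h2 := sum_monicOfDegree_jacobi_eq_zero hq hh hs
    (N := 2 * g + 1 - ((∏ P ∈ S, P) ^ 2).natDegree) (by omega)
  have h3 : ∑ E ∈ monicOfDegree Fq (2 * g + 1 - ((∏ P ∈ S, P) ^ 2).natDegree),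
      (jacobi E h : ℝ) = 0 := by exact_mod_cast h2
  have h4 : ∀ E : Fq[X], (-1 : ℝ) ^ S.card * (jacobi (E * (∏ P ∈ S, P) ^ 2) h : ℝ) =
      (-1) ^ S.card * (jacobi ((∏ P ∈ S, P) ^ 2) h : ℝ) * (jacobi E h : ℝ) := by
    intro E
    rw [jacobi_mul_left]; push_cast; ring
  simp_rw [h4]
  rw [← Finset.mul_sum, h3, mul_zero]

lemma card_squarePrimes_le {g b : ℕ} (hb : 0 < b) {B : Fq[X]} (hB : B.Monic)
    (hBd : B.natDegree = 2 * g + 1) :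
    (squarePrimes g B).card ≤ (monicUpTo Fq b).card + g / b := by
  rw [← Finset.card_filter_add_card_filter_not (s := squarePrimes g B) (fun P => P.natDegree ≤ b)]
  refine add_le_add (Finset.card_le_card fun P hP => ?_) ?_
  · rw [Finset.mem_filter, squarePrimes, Finset.mem_filter, mem_primesUpTo] at hP
    exact mem_monicUpTo.2 ⟨hP.1.1.1.1, hP.2⟩
  · rw [Nat.le_div_iff_mul_le hb]
    set S := (squarePrimes g B).filter (fun P => ¬ P.natDegree ≤ b) with hS
    have h1 : S ⊆ squarePrimes g B := Finset.filter_subset _ _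
    have h2 := h1.trans (squarePrimes_subset g B)
    have h3 := natDegree_le_of_dvd ((subset_squarePrimes_iff h2).1 h1) hB.ne_zero
    rw [(monic_prod_of_subset h2).natDegree_pow, natDegree_prod_of_monic _ _
      (fun P hP => (mem_primesUpTo.1 (h2 hP)).1.1)] at h3
    have h4 : S.card * b ≤ ∑ P ∈ S, P.natDegree := by
      rw [← smul_eq_mul]
      refine Finset.card_nsmul_le_sum _ _ _ fun P hP => ?_
      have := (Finset.mem_filter.1 hP).2
      omega
    omega

lemma abs_sieveTail_le (J : ℕ) {g b : ℕ} (hb : 0 < b) {B : Fq[X]} (hB : B.Monic)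
    (hBd : B.natDegree = 2 * g + 1) :
    |sieveTail g J B| ≤ 2 ^ ((monicUpTo Fq b).card + g / b) := by
  calc |sieveTail g J B| ≤ ∑ S ∈ (squarePrimes g B).powerset.filter
        (fun S => ¬ (∏ P ∈ S, P).natDegree ≤ J), |(-1 : ℝ) ^ S.card| :=
        Finset.abs_sum_le_sum_abs _ _
    _ ≤ ∑ S ∈ (squarePrimes g B).powerset, |(-1 : ℝ) ^ S.card| :=
        Finset.sum_le_sum_of_subset_of_nonneg (Finset.filter_subset _ _)
          fun _ _ _ => abs_nonneg _
    _ = 2 ^ (squarePrimes g B).card := by simp [Finset.card_powerset]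
    _ ≤ _ := pow_le_pow_right₀ (by norm_num) (card_squarePrimes_le hb hB hBd)

variable (Fq) in
/-- The monic polynomials of degree `2g+1` divisible by the square of some monic polynomial of
degree exceeding `J`. -/
noncomputable def largeSquare (g J : ℕ) : Finset Fq[X] :=
  ((monicUpTo Fq g).filter (fun s => J < s.natDegree)).biUnion
    fun s => (monicOfDegree Fq (2 * g + 1)).filter (s ^ 2 ∣ ·)

lemma mem_largeSquare_of_sieveTail_ne_zero {g J : ℕ} {B : Fq[X]}
    (hB : B ∈ monicOfDegree Fq (2 * g + 1)) (h : sieveTail g J B ≠ 0) : B ∈ largeSquare Fq g J := by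
  obtain ⟨S, hS, -⟩ := Finset.exists_ne_zero_of_sum_ne_zero h
  rw [Finset.mem_filter, Finset.mem_powerset] at hS
  have h1 := hS.1.trans (squarePrimes_subset g B)
  have h2 := (subset_squarePrimes_iff h1).1 hS.1
  have hB' := mem_monicOfDegree.1 hB
  have h3 := natDegree_le_of_dvd h2 hB'.1.ne_zero
  rw [(monic_prod_of_subset h1).natDegree_pow] at h3
  rw [largeSquare, Finset.mem_biUnion]
  exact ⟨∏ P ∈ S, P, Finset.mem_filter.2 ⟨mem_monicUpTo.2 ⟨monic_prod_of_subset h1, by omega⟩,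
    by omega⟩, Finset.mem_filter.2 ⟨hB, h2⟩⟩

lemma card_largeSquare_le (g J : ℕ) :
    ((largeSquare Fq g J).card : ℝ) ≤
      (g + 1) * (Fintype.card Fq : ℝ) ^ (2 * g + 1) / (Fintype.card Fq : ℝ) ^ (J + 1) := by
  have hq1 : (1 : ℝ) ≤ Fintype.card Fq := by exact_mod_cast Fintype.card_pos
  set Q : ℝ := (Fintype.card Fq : ℝ) with hQ
  have hQ0 : 0 < Q := by linarith
  calc ((largeSquare Fq g J).card : ℝ)
      ≤ ∑ s ∈ (monicUpTo Fq g).filter (fun s => J < s.natDegree),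
        (((monicOfDegree Fq (2 * g + 1)).filter (s ^ 2 ∣ ·)).card : ℝ) := by
        exact_mod_cast Finset.card_biUnion_le
    _ ≤ ∑ s ∈ (monicUpTo Fq g).filter (fun s => J < s.natDegree),
        Q ^ (2 * g + 1) / Q ^ (s.natDegree + (J + 1)) := by
        refine Finset.sum_le_sum fun s hs => ?_
        rw [Finset.mem_filter, mem_monicUpTo] at hs
        refine (card_filter_dvd_le (hs.1.1.pow 2)).trans ?_
        rw [hs.1.1.natDegree_pow]
        refine div_le_div_of_nonneg_left (by positivity) (by positivity)
          (pow_le_pow_right₀ hq1 (by omega))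
    _ ≤ ∑ s ∈ monicUpTo Fq g, Q ^ (2 * g + 1) / Q ^ (s.natDegree + (J + 1)) :=
        Finset.sum_le_sum_of_subset_of_nonneg (Finset.filter_subset _ _)
          fun _ _ _ => by positivity
    _ = ∑ j ∈ Finset.range (g + 1), Q ^ j * (Q ^ (2 * g + 1) / Q ^ (j + (J + 1))) :=
        sum_monicUpTo_const g fun j => Q ^ (2 * g + 1) / Q ^ (j + (J + 1))
    _ = ∑ j ∈ Finset.range (g + 1), Q ^ (2 * g + 1) / Q ^ (J + 1) :=
        Finset.sum_congr rfl fun j _ => by rw [pow_add Q j (J + 1)]; field_simp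
    _ = _ := by
        rw [Finset.sum_const, Finset.card_range, nsmul_eq_mul]; push_cast; ring

end Sieve

section MonicSquares

lemma exists_monic_associated {f : Fq[X]} (hf : f ≠ 0) : ∃ d : Fq[X], d.Monic ∧ Associated d f :=
  ⟨normalize f, monic_normalize hf, (associated_normalize f).symm⟩

lemma exists_monic_sq_of_associated {a d : Fq[X]} (ha : a.Monic) (h : Associated (d ^ 2) a) :
    ∃ r : Fq[X], r.Monic ∧ a = r ^ 2 := by
  have hd0 : d ≠ 0 := by
    rintro rfl
    exact ha.ne_zero (by simpa [associated_zero_iff_eq_zero] using h.symm)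
  obtain ⟨r, hr, hrd⟩ := exists_monic_associated hd0
  exact ⟨r, hr, (eq_of_monic_of_associated (hr.pow 2) ha ((hrd.pow_pow).trans h)).symm⟩

lemma exists_monic_sqrt {h : Fq[X]} (hh : h.Monic) (hs : IsSquare h) :
    ∃ r : Fq[X], r.Monic ∧ h = r ^ 2 := by
  obtain ⟨t, rfl⟩ := hs
  exact exists_monic_sq_of_associated (d := t) hh (by rw [pow_two])

lemma exists_monic_gcd {f₁ f₂ : Fq[X]} (h₁ : f₁.Monic) (h₂ : f₂.Monic) :
    ∃ d a b : Fq[X], d.Monic ∧ a.Monic ∧ b.Monic ∧ IsCoprime a b ∧ f₁ = d * a ∧ f₂ = d * b := by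
  have h0 : EuclideanDomain.gcd f₁ f₂ ≠ 0 := fun h =>
    h₁.ne_zero (EuclideanDomain.gcd_eq_zero_iff.1 h).1
  obtain ⟨d, hd, hda⟩ := exists_monic_associated h0
  obtain ⟨a, rfl⟩ := hda.dvd.trans (EuclideanDomain.gcd_dvd_left f₁ f₂)
  obtain ⟨b, rfl⟩ := hda.dvd.trans (EuclideanDomain.gcd_dvd_right (d * a) f₂)
  refine ⟨d, a, b, hd, hd.of_mul_monic_left h₁, hd.of_mul_monic_left h₂, ?_, rfl, rfl⟩
  obtain ⟨u, hu⟩ := hda.symm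
  have h3 := EuclideanDomain.gcd_eq_gcd_ab (d * a) (d * b)
  set x := EuclideanDomain.gcdA (d * a) (d * b)
  set y := EuclideanDomain.gcdB (d * a) (d * b)
  refine ⟨x * u, y * u, mul_left_cancel₀ hd.ne_zero ?_⟩
  rw [mul_one]
  conv_rhs => rw [← hu, h3]
  ring

lemma exists_of_isSquare_mul {f₁ f₂ : Fq[X]} (h₁ : f₁.Monic) (h₂ : f₂.Monic)
    (hs : IsSquare (f₁ * f₂)) : ∃ d α β : Fq[X], (d.Monic ∧ α.Monic ∧ β.Monic) ∧
      f₁ = d * α ^ 2 ∧ f₂ = d * β ^ 2 := by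
  obtain ⟨r, hr, hr2⟩ := exists_monic_sqrt (h₁.mul h₂) hs
  obtain ⟨d, a, b, hd, ha, hb, hab, rfl, rfl⟩ := exists_monic_gcd h₁ h₂
  have hdr : d ∣ r := by
    rw [← IsIntegrallyClosed.pow_dvd_pow_iff (n := 2) two_ne_zero, ← hr2]
    exact ⟨a * b, by ring⟩
  obtain ⟨t, rfl⟩ := hdr
  have h3 : a * b = t ^ 2 := by
    refine mul_left_cancel₀ (pow_ne_zero 2 hd.ne_zero) ?_
    linear_combination hr2
  obtain ⟨α, hα⟩ := exists_associated_pow_of_mul_eq_pow' hab h3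
  obtain ⟨β, hβ⟩ := exists_associated_pow_of_mul_eq_pow' hab.symm (by rw [mul_comm]; exact h3)
  obtain ⟨α', hαm, rfl⟩ := exists_monic_sq_of_associated ha hα
  obtain ⟨β', hβm, rfl⟩ := exists_monic_sq_of_associated hb hβ
  exact ⟨d, α', β', ⟨hd, hαm, hβm⟩, rfl, rfl⟩

end MonicSquares

section Expansion

lemma one_le_card : (1 : ℝ) ≤ (Fintype.card Fq : ℝ) := by exact_mod_cast Fintype.card_pos

variable (Fq) in
/-- Tuples of monic polynomials whose first entry has degree at most `y` and whose other entries
have degree at most `x`. -/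
noncomputable def tuples (l x y : ℕ) : Finset (Fin (l + 1) → Fq[X]) :=
  Fintype.piFinset fun i => if i = 0 then monicUpTo Fq y else monicUpTo Fq x

lemma mem_tuples {l x y : ℕ} {n : Fin (l + 1) → Fq[X]} : n ∈ tuples Fq l x y ↔
    n 0 ∈ monicUpTo Fq y ∧ ∀ i : Fin l, n i.succ ∈ monicUpTo Fq x := by
  rw [tuples, Fintype.mem_piFinset, Fin.forall_fin_succ]
  simp [Fin.succ_ne_zero]

lemma monic_of_mem_tuples {l x y : ℕ} {n : Fin (l + 1) → Fq[X]} (hn : n ∈ tuples Fq l x y)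
    (i : Fin (l + 1)) : (n i).Monic := by
  rw [mem_tuples] at hn
  refine Fin.cases ?_ (fun j => ?_) i
  · exact (mem_monicUpTo.1 hn.1).1
  · exact (mem_monicUpTo.1 (hn.2 j)).1

lemma natDegree_prod_tuples_le {l x y : ℕ} {n : Fin (l + 1) → Fq[X]} (hn : n ∈ tuples Fq l x y) :
    (∏ i, n i).natDegree ≤ y + l * x := by
  rw [natDegree_prod_of_monic _ _ fun i _ => monic_of_mem_tuples hn i, Fin.sum_univ_succ]
  rw [mem_tuples] at hn
  refine add_le_add (mem_monicUpTo.1 hn.1).2 ?_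
  calc ∑ i : Fin l, (n i.succ).natDegree ≤ ∑ i : Fin l, x :=
        Finset.sum_le_sum fun i _ => (mem_monicUpTo.1 (hn.2 i)).2
    _ = l * x := by simp

lemma partialL_mul_partialL_pow (l x y : ℕ) (B : Fq[X]) :
    partialL y B * partialL x B ^ l = ∑ n ∈ tuples Fq l x y,
      (jacobi B (∏ i, n i) : ℝ) * (√(Fintype.card Fq : ℝ))⁻¹ ^ (∏ i, n i).natDegree := by
  have h1 : partialL y B * partialL x B ^ l =
      ∏ i : Fin (l + 1), ∑ f ∈ (if i = 0 then monicUpTo Fq y else monicUpTo Fq x),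
        (jacobi B f : ℝ) * (√(Fintype.card Fq : ℝ))⁻¹ ^ f.natDegree := by
    rw [Fin.prod_univ_succ]
    simp [Fin.succ_ne_zero, partialL]
  rw [h1, Finset.prod_univ_sum, tuples]
  refine Finset.sum_congr rfl fun n hn => ?_
  have hm := monic_of_mem_tuples hn
  rw [Finset.prod_mul_distrib, Finset.prod_pow_eq_pow_sum,
    natDegree_prod_of_monic _ _ fun i _ => hm i, jacobi_prod_right _ _ _ fun i _ => (hm i).ne_zero]
  push_cast
  rfl

/-- The part of `partialL y B * partialL x B ^ l` coming from tuples with square product. -/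
noncomputable def diagPart (l x y : ℕ) (B : Fq[X]) : ℝ :=
  ∑ n ∈ (tuples Fq l x y).filter fun n => IsSquare (∏ i, n i),
    (jacobi B (∏ i, n i) : ℝ) * (√(Fintype.card Fq : ℝ))⁻¹ ^ (∏ i, n i).natDegree

lemma sum_squarefree_sub_diagPart (hq : ringChar Fq ≠ 2) {l x y g J : ℕ}
    (hJ : y + l * x + 2 * J ≤ 2 * g + 1) :
    ∑ D ∈ (monicOfDegree Fq (2 * g + 1)).filter Squarefree,
      (partialL y D * partialL x D ^ l - diagPart l x y D) =
    ∑ B ∈ monicOfDegree Fq (2 * g + 1),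
      sieveTail g J B * (partialL y B * partialL x B ^ l - diagPart l x y B) := by
  have h1 : ∀ B : Fq[X], partialL y B * partialL x B ^ l - diagPart l x y B =
      ∑ n ∈ (tuples Fq l x y).filter fun n => ¬ IsSquare (∏ i, n i),
      (jacobi B (∏ i, n i) : ℝ) * (√(Fintype.card Fq : ℝ))⁻¹ ^ (∏ i, n i).natDegree := by
    intro B
    rw [partialL_mul_partialL_pow, diagPart, sub_eq_iff_eq_add']
    exact (Finset.sum_filter_add_sum_filter_not _ _ _).symm
  have h2 : ∑ B ∈ monicOfDegree Fq (2 * g + 1),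
      sieveMain g J B * (partialL y B * partialL x B ^ l - diagPart l x y B) = 0 := by
    simp_rw [h1, Finset.mul_sum]
    rw [Finset.sum_comm]
    refine Finset.sum_eq_zero fun n hn => ?_
    rw [Finset.mem_filter] at hn
    simp_rw [← mul_assoc]
    rw [← Finset.sum_mul, sum_sieveMain_mul_jacobi hq
      (monic_prod_of_monic _ _ fun i _ => monic_of_mem_tuples hn.1 i) hn.2, zero_mul]
    have := natDegree_prod_tuples_le hn.1
    omega
  refine Eq.trans ?_ ((congrArg (· + _) h2).trans (zero_add _))
  rw [← Finset.sum_add_distrib, Finset.sum_filter]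
  refine Finset.sum_congr rfl fun B hB => ?_
  rw [mem_monicOfDegree] at hB
  rw [← add_mul, sieveMain_add_sieveTail J hB.1 hB.2]
  split_ifs <;> simp

end Expansion

section Bounds

lemma sum_le_sum_of_rel {α β : Type*} {S : Finset α} {T : Finset β} (R : α → β → Prop)
    {u : α → ℝ} {w : β → ℝ} (hw : ∀ t ∈ T, 0 ≤ w t)
    (h : ∀ a ∈ S, ∃ t ∈ T, R a t ∧ u a ≤ w t)
    (hR : ∀ a ∈ S, ∀ b ∈ S, ∀ t, R a t → R b t → a = b) :
    ∑ a ∈ S, u a ≤ ∑ t ∈ T, w t := by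
  choose φ hφT hφR hφu using h
  calc ∑ a ∈ S, u a = ∑ a ∈ S.attach, u a := (Finset.sum_attach _ _).symm
    _ ≤ ∑ a ∈ S.attach, w (φ a a.2) := Finset.sum_le_sum fun a _ => hφu a a.2
    _ = ∑ t ∈ S.attach.image (fun a : {a // a ∈ S} => φ a a.2), w t := by
        rw [Finset.sum_image]
        intro a _ b _ hab
        refine Subtype.ext (hR a a.2 b b.2 _ (hφR a a.2) ?_)
        have hab' : φ a a.2 = φ b b.2 := hab
        rw [hab']
        exact hφR b b.2
    _ ≤ ∑ t ∈ T, w t := by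
        refine Finset.sum_le_sum_of_subset_of_nonneg ?_ fun t ht _ => hw t ht
        intro t ht
        obtain ⟨a, -, rfl⟩ := Finset.mem_image.1 ht
        exact hφT a a.2

lemma inv_sqrt_card_nonneg : 0 ≤ (√(Fintype.card Fq : ℝ))⁻¹ := by positivity

lemma inv_sqrt_card_pow_two_mul (n : ℕ) :
    (√(Fintype.card Fq : ℝ))⁻¹ ^ (2 * n) = ((Fintype.card Fq : ℝ)⁻¹) ^ n := by
  rw [pow_mul, inv_pow _ 2, Real.sq_sqrt (by positivity)]

lemma AD_eq (k g : ℕ) (D : Fq[X]) : AD k g D = partialL (4 * g / (15 * k)) D := by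
  have h1 : {n : Fq[X] | n.Monic ∧ n.natDegree ≤ 4 * g / (15 * k)} =
      ↑(monicUpTo Fq (4 * g / (15 * k))) := by
    ext n
    rw [Finset.mem_coe, mem_monicUpTo]
    exact Iff.rfl
  rw [AD, h1, finsum_mem_coe_finset, partialL]
  refine Finset.sum_congr rfl fun f hf => ?_
  rw [pnorm, if_neg (mem_monicUpTo.1 hf).1.ne_zero, div_eq_mul_inv, inv_pow,
    Real.sqrt_eq_rpow, Real.sqrt_eq_rpow, ← Real.rpow_natCast, ← Real.rpow_natCast,
    ← Real.rpow_mul (by positivity), ← Real.rpow_mul (by positivity), mul_comm (1 / 2 : ℝ)]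

lemma abs_jacobi_cast_le_one (B : Fq[X]) {n : Fq[X]} (hn : n ≠ 0) : |(jacobi B n : ℝ)| ≤ 1 := by
  exact_mod_cast abs_jacobi_le_one B hn

lemma abs_partialL_le (x : ℕ) (B : Fq[X]) :
    |partialL x B| ≤ (x + 1) * √(Fintype.card Fq : ℝ) ^ x := by
  have hq1 := one_le_card (Fq := Fq)
  have hs : (Fintype.card Fq : ℝ) * (√(Fintype.card Fq : ℝ))⁻¹ = √(Fintype.card Fq : ℝ) := by
    rw [← div_eq_mul_inv, Real.div_sqrt]
  calc |partialL x B| ≤ ∑ f ∈ monicUpTo Fq x,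
        |(jacobi B f : ℝ) * (√(Fintype.card Fq : ℝ))⁻¹ ^ f.natDegree| :=
        Finset.abs_sum_le_sum_abs _ _
    _ ≤ ∑ f ∈ monicUpTo Fq x, (√(Fintype.card Fq : ℝ))⁻¹ ^ f.natDegree := by
        refine Finset.sum_le_sum fun f hf => ?_
        rw [abs_mul, abs_of_nonneg (pow_nonneg inv_sqrt_card_nonneg _)]
        exact mul_le_of_le_one_left (pow_nonneg inv_sqrt_card_nonneg _)
          (abs_jacobi_cast_le_one B (mem_monicUpTo.1 hf).1.ne_zero)
    _ = ∑ j ∈ Finset.range (x + 1), √(Fintype.card Fq : ℝ) ^ j := by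
        rw [sum_monicUpTo_const x fun j => (√(Fintype.card Fq : ℝ))⁻¹ ^ j]
        refine Finset.sum_congr rfl fun j _ => ?_
        rw [← mul_pow, hs]
    _ ≤ ∑ j ∈ Finset.range (x + 1), √(Fintype.card Fq : ℝ) ^ x :=
        Finset.sum_le_sum fun j hj => pow_le_pow_right₀ (Real.one_le_sqrt.2 hq1)
          (Nat.lt_succ_iff.1 (Finset.mem_range.1 hj))
    _ = _ := by simp

lemma sum_monicUpTo_inv_card_pow (n : ℕ) :
    ∑ f ∈ monicUpTo Fq n, ((Fintype.card Fq : ℝ)⁻¹) ^ f.natDegree = n + 1 := by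
  have hq1 := one_le_card (Fq := Fq)
  rw [sum_monicUpTo_const n fun j => ((Fintype.card Fq : ℝ)⁻¹) ^ j]
  rw [Finset.sum_congr rfl fun j _ => show _ = (1 : ℝ) by
    rw [← mul_pow, mul_inv_cancel₀ (by linarith), one_pow]]
  simp

lemma sum_square_pairs_le (y : ℕ) :
    ∑ p ∈ (monicUpTo Fq y ×ˢ monicUpTo Fq y).filter (fun p => IsSquare (p.1 * p.2)),
      (√(Fintype.card Fq : ℝ))⁻¹ ^ (p.1 * p.2).natDegree ≤ ((y : ℝ) + 1) ^ 3 := by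
  set Q : ℝ := (Fintype.card Fq : ℝ) with hQ
  have h1 : ∑ t ∈ monicUpTo Fq y ×ˢ (monicUpTo Fq y ×ˢ monicUpTo Fq y),
      Q⁻¹ ^ t.1.natDegree * (Q⁻¹ ^ t.2.1.natDegree * Q⁻¹ ^ t.2.2.natDegree) =
      ((y : ℝ) + 1) ^ 3 := by
    rw [Finset.sum_product]
    simp_rw [Finset.sum_product, ← Finset.mul_sum, ← Finset.sum_mul]
    rw [hQ, sum_monicUpTo_inv_card_pow]
    ring
  rw [← h1]
  refine sum_le_sum_of_rel
    (fun p t => p.1 = t.1 * t.2.1 ^ 2 ∧ p.2 = t.1 * t.2.2 ^ 2) (fun t _ => by positivity) ?_ ?_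
  · rintro ⟨f₁, f₂⟩ hp
    rw [Finset.mem_filter, Finset.mem_product, mem_monicUpTo, mem_monicUpTo] at hp
    obtain ⟨⟨⟨h₁, hd₁⟩, ⟨h₂, hd₂⟩⟩, hs⟩ := hp
    obtain ⟨d, α, β, ⟨hd, hα, hβ⟩, rfl, rfl⟩ := exists_of_isSquare_mul h₁ h₂ hs
    simp only at hd₁ hd₂ ⊢
    have e₁ : (d * α ^ 2).natDegree = d.natDegree + 2 * α.natDegree := by
      rw [hd.natDegree_mul (hα.pow 2), hα.natDegree_pow]
    have e₂ : (d * β ^ 2).natDegree = d.natDegree + 2 * β.natDegree := by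
      rw [hd.natDegree_mul (hβ.pow 2), hβ.natDegree_pow]
    refine ⟨(d, α, β), ?_, ⟨rfl, rfl⟩, ?_⟩
    · simp only [Finset.mem_product, mem_monicUpTo]
      refine ⟨⟨hd, ?_⟩, ⟨hα, ?_⟩, ⟨hβ, ?_⟩⟩ <;> omega
    · rw [h₁.natDegree_mul h₂, e₁, e₂,
        show d.natDegree + 2 * α.natDegree + (d.natDegree + 2 * β.natDegree) =
          2 * (d.natDegree + (α.natDegree + β.natDegree)) by ring,
        inv_sqrt_card_pow_two_mul, pow_add, pow_add]
  · rintro a - b - t ⟨h1, h2⟩ ⟨h3, h4⟩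
    exact Prod.ext (h1.trans h3.symm) (h2.trans h4.symm)

lemma sum_partialL_sq_le (hq : ringChar Fq ≠ 2) {y g : ℕ} (hy : y ≤ g) :
    ∑ B ∈ monicOfDegree Fq (2 * g + 1), partialL y B ^ 2 ≤
      (Fintype.card Fq : ℝ) ^ (2 * g + 1) * ((g : ℝ) + 1) ^ 3 := by
  have h1 : ∀ B : Fq[X], partialL y B ^ 2 = ∑ p ∈ monicUpTo Fq y ×ˢ monicUpTo Fq y,
      (jacobi B (p.1 * p.2) : ℝ) * (√(Fintype.card Fq : ℝ))⁻¹ ^ (p.1 * p.2).natDegree := by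
    intro B
    rw [pow_two, partialL, Finset.sum_mul_sum, Finset.sum_product]
    refine Finset.sum_congr rfl fun f₁ h₁ => Finset.sum_congr rfl fun f₂ h₂ => ?_
    have h₁ := (mem_monicUpTo.1 h₁).1
    have h₂ := (mem_monicUpTo.1 h₂).1
    rw [jacobi_mul_right B h₁.ne_zero h₂.ne_zero, h₁.natDegree_mul h₂, pow_add]
    push_cast
    ring
  simp_rw [h1]
  rw [Finset.sum_comm]
  simp_rw [← Finset.sum_mul]
  calc _ ≤ ∑ p ∈ monicUpTo Fq y ×ˢ monicUpTo Fq y, if IsSquare (p.1 * p.2) then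
        (Fintype.card Fq : ℝ) ^ (2 * g + 1) *
          (√(Fintype.card Fq : ℝ))⁻¹ ^ (p.1 * p.2).natDegree else 0 := by
        refine Finset.sum_le_sum fun p hp => ?_
        rw [Finset.mem_product, mem_monicUpTo, mem_monicUpTo] at hp
        have hm := hp.1.1.mul hp.2.1
        split_ifs with hs
        · refine mul_le_mul_of_nonneg_right ?_ (pow_nonneg inv_sqrt_card_nonneg _)
          calc ∑ B ∈ monicOfDegree Fq (2 * g + 1), (jacobi B (p.1 * p.2) : ℝ) ≤
              ∑ B ∈ monicOfDegree Fq (2 * g + 1), (1 : ℝ) := Finset.sum_le_sum fun B _ =>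
                (abs_le.1 (abs_jacobi_cast_le_one B hm.ne_zero)).2
            _ = _ := by simp [card_monicOfDegree]
        · have := sum_monicOfDegree_jacobi_eq_zero hq hm hs (N := 2 * g + 1)
            (by rw [hp.1.1.natDegree_mul hp.2.1]; omega)
          rw [← Int.cast_sum, this, Int.cast_zero, zero_mul]
    _ = (Fintype.card Fq : ℝ) ^ (2 * g + 1) *
        ∑ p ∈ (monicUpTo Fq y ×ˢ monicUpTo Fq y).filter (fun p => IsSquare (p.1 * p.2)),
          (√(Fintype.card Fq : ℝ))⁻¹ ^ (p.1 * p.2).natDegree := by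
        rw [← Finset.sum_filter, Finset.mul_sum]
    _ ≤ _ := by
        refine mul_le_mul_of_nonneg_left ((sum_square_pairs_le y).trans ?_) (by positivity)
        gcongr

lemma card_monicUpTo_le (x : ℕ) :
    ((monicUpTo Fq x).card : ℝ) ≤ (x + 1) * (Fintype.card Fq : ℝ) ^ x := by
  have h := sum_monicUpTo_const (Fq := Fq) x fun _ => 1
  simp only [mul_one, Finset.sum_const, nsmul_eq_mul] at h
  rw [h]
  calc _ ≤ ∑ j ∈ Finset.range (x + 1), (Fintype.card Fq : ℝ) ^ x :=
        Finset.sum_le_sum fun j hj => pow_le_pow_right₀ one_le_card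
          (Nat.lt_succ_iff.1 (Finset.mem_range.1 hj))
    _ = _ := by simp

lemma abs_diagPart_le (l x y : ℕ) (B : Fq[X]) :
    |diagPart l x y B| ≤ ((x + 1) * (Fintype.card Fq : ℝ) ^ x) ^ l * (y + l * x + 1) := by
  set Q : ℝ := (Fintype.card Fq : ℝ) with hQ
  calc |diagPart l x y B| ≤ ∑ n ∈ (tuples Fq l x y).filter fun n => IsSquare (∏ i, n i),
      |(jacobi B (∏ i, n i) : ℝ) * (√Q)⁻¹ ^ (∏ i, n i).natDegree| :=
        Finset.abs_sum_le_sum_abs _ _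
    _ ≤ ∑ n ∈ (tuples Fq l x y).filter fun n => IsSquare (∏ i, n i),
        (√Q)⁻¹ ^ (∏ i, n i).natDegree := by
        refine Finset.sum_le_sum fun n hn => ?_
        rw [Finset.mem_filter] at hn
        rw [abs_mul, abs_of_nonneg (pow_nonneg inv_sqrt_card_nonneg _)]
        exact mul_le_of_le_one_left (pow_nonneg inv_sqrt_card_nonneg _)
          (abs_jacobi_cast_le_one B
            (monic_prod_of_monic _ _ fun i _ => monic_of_mem_tuples hn.1 i).ne_zero)
    _ ≤ ∑ t ∈ (Fintype.piFinset fun _ : Fin l => monicUpTo Fq x) ×ˢ monicUpTo Fq (y + l * x),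
        Q⁻¹ ^ t.2.natDegree := by
        refine sum_le_sum_of_rel (fun n t => (∀ i, (n i).Monic) ∧ (fun i => n (Fin.succ i)) = t.1 ∧
          ∏ i, n i = t.2 ^ 2) (fun t _ => by positivity) ?_ ?_
        · intro n hn
          rw [Finset.mem_filter] at hn
          have hm := monic_of_mem_tuples hn.1
          obtain ⟨r, hr, hr2⟩ := exists_monic_sqrt (monic_prod_of_monic _ _ fun i _ => hm i) hn.2
          have hd := natDegree_prod_tuples_le hn.1
          rw [hr2, hr.natDegree_pow] at hd
          refine ⟨(fun i => n (Fin.succ i), r), ?_, ⟨hm, rfl, hr2⟩, ?_⟩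
          · rw [Finset.mem_product, Fintype.mem_piFinset, mem_monicUpTo]
            exact ⟨(mem_tuples.1 hn.1).2, hr, (by omega : r.natDegree ≤ y + l * x)⟩
          · rw [hr2, hr.natDegree_pow, inv_sqrt_card_pow_two_mul]
        · rintro a - b - t ⟨ha, ha1, ha2⟩ ⟨hb, hb1, hb2⟩
          have htail : (fun i => a (Fin.succ i)) = fun i => b (Fin.succ i) := ha1.trans hb1.symm
          have h0 : a 0 = b 0 := by
            have h3 := ha2.trans hb2.symm
            rw [Fin.prod_univ_succ, Fin.prod_univ_succ] at h3
            have h4 : ∏ i : Fin l, a i.succ = ∏ i : Fin l, b i.succ :=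
              Finset.prod_congr rfl fun i _ => congrFun htail i
            rw [h4] at h3
            exact mul_right_cancel₀ (monic_prod_of_monic _ _ fun i _ => hb _).ne_zero h3
          funext i
          refine Fin.cases h0 (fun j => congrFun htail j) i
    _ = ((monicUpTo Fq x).card : ℝ) ^ l * (y + l * x + 1) := by
        rw [Finset.sum_product, hQ]
        simp only [sum_monicUpTo_inv_card_pow, Finset.sum_const, Fintype.card_piFinset, nsmul_eq_mul]
        push_cast
        simp
    _ ≤ _ := by
        gcongr
        exact card_monicUpTo_le x

end Bounds

section OffDiagonal

lemma sum_mul_pow_sq_le (hq : ringChar Fq ≠ 2) (l x : ℕ) {y g : ℕ} (hy : y ≤ g) :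
    ∑ B ∈ monicOfDegree Fq (2 * g + 1), (partialL y B * partialL x B ^ l) ^ 2 ≤
      (Fintype.card Fq : ℝ) ^ (2 * g + 1) * ((g : ℝ) + 1) ^ 3 *
        (((x : ℝ) + 1) ^ (2 * l) * (Fintype.card Fq : ℝ) ^ (l * x)) := by
  calc _ ≤ ∑ B ∈ monicOfDegree Fq (2 * g + 1), partialL y B ^ 2 *
        (((x : ℝ) + 1) ^ (2 * l) * (Fintype.card Fq : ℝ) ^ (l * x)) := by
        refine Finset.sum_le_sum fun B _ => ?_
        rw [mul_pow, ← pow_mul, mul_comm l 2, pow_mul _ 2 l]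
        refine mul_le_mul_of_nonneg_left ?_ (sq_nonneg _)
        calc (partialL x B ^ 2) ^ l ≤ (((x + 1) * √(Fintype.card Fq : ℝ) ^ x) ^ 2) ^ l := by
              refine pow_le_pow_left₀ (sq_nonneg _) (sq_le_sq' ?_ ?_) l
              · exact (abs_le.1 (abs_partialL_le x B)).1
              · exact (abs_le.1 (abs_partialL_le x B)).2
          _ = _ := by
              rw [mul_pow, mul_pow, ← pow_mul, ← pow_mul _ x 2, mul_comm x 2, pow_mul _ 2 x,
                Real.sq_sqrt (by positivity), ← pow_mul, mul_comm x l]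
    _ ≤ _ := by
        rw [← Finset.sum_mul]
        exact mul_le_mul_of_nonneg_right (sum_partialL_sq_le hq hy) (by positivity)

lemma largeSquare_subset (g J : ℕ) : largeSquare Fq g J ⊆ monicOfDegree Fq (2 * g + 1) :=
  Finset.biUnion_subset.2 fun _ _ => Finset.filter_subset _ _

lemma abs_sum_squarefree_sub_diagPart_le (hq : ringChar Fq ≠ 2) {l x y g J b : ℕ} (hb : 0 < b)
    (hy : y ≤ g) (hX : l * x ≤ g) (hJ : y + l * x + 2 * J ≤ 2 * g + 1) (hXJ : l * x ≤ J + 1) :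
    |∑ D ∈ (monicOfDegree Fq (2 * g + 1)).filter Squarefree,
      (partialL y D * partialL x D ^ l - diagPart l x y D)| ≤
    3 * (Fintype.card Fq : ℝ) ^ (2 * g + 1) * (((g : ℝ) + 1) ^ 2 * ((x : ℝ) + 1) ^ l) *
      (2 ^ ((monicUpTo Fq b).card + g / b) *
        √((Fintype.card Fq : ℝ) ^ (l * x) / (Fintype.card Fq : ℝ) ^ (J + 1))) := by
  have hq1 := one_le_card (Fq := Fq)
  set Q : ℝ := (Fintype.card Fq : ℝ) with hQ
  have hQ0 : 0 < Q := by linarith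
  set ρ : ℝ := Q ^ (l * x) / Q ^ (J + 1) with hρ
  set M : ℝ := 2 ^ ((monicUpTo Fq b).card + g / b) with hM
  set N := 2 * g + 1 with hN
  have hρ0 : 0 ≤ ρ := by positivity
  have hρ1 : ρ ≤ 1 := div_le_one_of_le₀ (pow_le_pow_right₀ hq1 hXJ) (by positivity)
  have hρs : ρ ≤ √ρ := Real.le_sqrt_of_sq_le (by nlinarith)
  have hT := card_largeSquare_le (Fq := Fq) g J
  set T := largeSquare Fq g J with hTdef
  set F : Fq[X] → ℝ := fun B => partialL y B * partialL x B ^ l with hF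
  set δ : ℝ := ((x + 1) * Q ^ x) ^ l * (y + l * x + 1) with hδ
  have hδ2 : (T.card : ℝ) * δ ≤
      2 * Q ^ N * (((g : ℝ) + 1) ^ 2 * ((x : ℝ) + 1) ^ l) * ρ := by
    have h1 : (y : ℝ) + l * x + 1 ≤ 2 * (g + 1) := by
      have : ((y + l * x + 1 : ℕ) : ℝ) ≤ ((2 * (g + 1) : ℕ) : ℝ) := by
        exact_mod_cast (by omega)
      push_cast at this
      exact this
    calc (T.card : ℝ) * δ ≤ ((g + 1) * Q ^ N / Q ^ (J + 1)) *
          (((x + 1) * Q ^ x) ^ l * (2 * (g + 1))) :=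
          mul_le_mul hT (mul_le_mul_of_nonneg_left h1 (by positivity)) (by positivity)
            (by positivity)
      _ = _ := by
          rw [hρ, mul_pow, ← pow_mul, mul_comm x l]
          ring
  have hF2 : ∑ B ∈ T, |F B| ≤ Q ^ N * (((g : ℝ) + 1) ^ 2 * ((x : ℝ) + 1) ^ l) * √ρ := by
    have h1 : (∑ B ∈ T, |F B|) ^ 2 ≤ T.card * ∑ B ∈ T, |F B| ^ 2 := sq_sum_le_card_mul_sum_sq
    have h2 : ∑ B ∈ T, |F B| ^ 2 ≤ Q ^ N * ((g : ℝ) + 1) ^ 3 *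
        (((x : ℝ) + 1) ^ (2 * l) * Q ^ (l * x)) := by
      simp_rw [sq_abs]
      exact (Finset.sum_le_sum_of_subset_of_nonneg (largeSquare_subset g J)
        fun _ _ _ => sq_nonneg _).trans (sum_mul_pow_sq_le hq l x hy)
    refine abs_le_of_sq_le_sq' ?_ (by positivity) |>.2
    calc (∑ B ∈ T, |F B|) ^ 2 ≤ ((g + 1) * Q ^ N / Q ^ (J + 1)) * (Q ^ N * ((g : ℝ) + 1) ^ 3 *
        (((x : ℝ) + 1) ^ (2 * l) * Q ^ (l * x))) :=
          h1.trans (mul_le_mul hT h2 (Finset.sum_nonneg fun _ _ => sq_nonneg _) (by positivity))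
      _ = _ := by
          rw [mul_pow _ (√ρ), Real.sq_sqrt hρ0, hρ]
          ring
  rw [sum_squarefree_sub_diagPart hq hJ]
  calc |∑ B ∈ monicOfDegree Fq N, sieveTail g J B * (F B - diagPart l x y B)| ≤
      ∑ B ∈ monicOfDegree Fq N, |sieveTail g J B * (F B - diagPart l x y B)| :=
        Finset.abs_sum_le_sum_abs _ _
    _ = ∑ B ∈ T, |sieveTail g J B * (F B - diagPart l x y B)| := by
        refine (Finset.sum_subset (largeSquare_subset g J) fun B hB hBT => ?_).symm
        have : sieveTail g J B = 0 := by
          by_contra h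
          exact hBT (mem_largeSquare_of_sieveTail_ne_zero hB h)
        rw [this, zero_mul, abs_zero]
    _ ≤ ∑ B ∈ T, M * (|F B| + δ) := by
        refine Finset.sum_le_sum fun B hB => ?_
        have hB' := mem_monicOfDegree.1 (largeSquare_subset g J hB)
        rw [abs_mul]
        exact mul_le_mul (abs_sieveTail_le J hb hB'.1 hB'.2)
          ((abs_sub _ _).trans (add_le_add le_rfl (abs_diagPart_le l x y B))) (abs_nonneg _)
          (by positivity)
    _ = M * (∑ B ∈ T, |F B| + T.card * δ) := by
        rw [← Finset.mul_sum, Finset.sum_add_distrib, Finset.sum_const, nsmul_eq_mul]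
    _ ≤ M * (Q ^ N * (((g : ℝ) + 1) ^ 2 * ((x : ℝ) + 1) ^ l) * √ρ +
        2 * Q ^ N * (((g : ℝ) + 1) ^ 2 * ((x : ℝ) + 1) ^ l) * √ρ) := by
        refine mul_le_mul_of_nonneg_left (add_le_add hF2 (hδ2.trans ?_)) (by positivity)
        exact mul_le_mul_of_nonneg_left hρs (by positivity)
    _ = _ := by ring

lemma two_le_card : (2 : ℝ) ≤ (Fintype.card Fq : ℝ) := by
  exact_mod_cast Fintype.one_lt_card (α := Fq)

/-- For `θ = 2 ^ (-1 / 40)`, the saving in the off-diagonal terms is at least `θ ^ g`. -/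
lemma sieve_loss_mul_saving_le {C g X J : ℕ} (hJ : 10 * X + g ≤ 10 * (J + 1)) :
    (2 : ℝ) ^ (C + g / 40) *
      √((Fintype.card Fq : ℝ) ^ X / (Fintype.card Fq : ℝ) ^ (J + 1)) ≤
      2 ^ C * ((2 : ℝ) ^ (-(1 / 40 : ℝ))) ^ g := by
  have hq2 := two_le_card (Fq := Fq)
  set Q : ℝ := (Fintype.card Fq : ℝ)
  have hQ0 : 0 < Q := by linarith
  rw [pow_add, mul_assoc]
  refine mul_le_mul_of_nonneg_left ?_ (by positivity)
  refine le_of_pow_le_pow_left₀ (n := 40) (by norm_num) (by positivity) ?_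
  have h1 : (((2 : ℝ) ^ (-(1 / 40 : ℝ))) ^ g) ^ 40 = (2 ^ g)⁻¹ := by
    rw [← pow_mul, mul_comm g 40, pow_mul, ← Real.rpow_natCast _ 40, ← Real.rpow_mul (by norm_num)]
    norm_num
    rw [one_div, inv_pow]
  have h2 : √(Q ^ X / Q ^ (J + 1)) ^ 40 = ((Q ^ X / Q ^ (J + 1)) ^ 10) ^ 2 := by
    rw [show 40 = 2 * 20 by norm_num, pow_mul, Real.sq_sqrt (by positivity), ← pow_mul]
  have h3 : (Q ^ X / Q ^ (J + 1)) ^ 10 ≤ (2 ^ g)⁻¹ := by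
    rw [div_pow, ← pow_mul, ← pow_mul, div_le_iff₀ (by positivity), mul_comm (2 ^ g)⁻¹,
      ← div_eq_mul_inv, le_div_iff₀ (by positivity)]
    calc Q ^ (X * 10) * 2 ^ g ≤ Q ^ (X * 10) * Q ^ g := by gcongr
      _ = Q ^ (X * 10 + g) := (pow_add _ _ _).symm
      _ ≤ _ := pow_le_pow_right₀ (by linarith) (by omega)
  rw [mul_pow, h1, h2, ← pow_mul]
  calc (2 : ℝ) ^ (g / 40 * 40) * ((Q ^ X / Q ^ (J + 1)) ^ 10) ^ 2 ≤
      2 ^ g * ((2 ^ g)⁻¹) ^ 2 := by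
        gcongr
        · norm_num
        · exact Nat.div_mul_le_self g 40
    _ = _ := by
        rw [pow_two, ← mul_assoc, mul_inv_cancel₀ (by positivity), one_mul]

lemma tendsto_pow_mul_saving (C l : ℕ) :
    Tendsto (fun g : ℕ => 3 * ((g : ℝ) + 1) ^ (l + 2) *
      (2 ^ C * ((2 : ℝ) ^ (-(1 / 40 : ℝ))) ^ g)) atTop (nhds 0) := by
  set θ : ℝ := (2 : ℝ) ^ (-(1 / 40 : ℝ)) with hθ
  have h0 : 0 < θ := by positivity
  have h1 : θ < 1 := Real.rpow_lt_one_of_one_lt_of_neg (by norm_num) (by norm_num)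
  have h := (tendsto_pow_const_mul_const_pow_of_abs_lt_one (l + 2)
    (by rwa [abs_of_pos h0])).comp (tendsto_add_atTop_nat 1)
  have h2 := h.const_mul (3 * 2 ^ C * θ⁻¹)
  rw [mul_zero] at h2
  refine h2.congr fun g => ?_
  simp only [Function.comp]
  push_cast
  rw [pow_succ θ g]
  field_simp

/-- The off-diagonal terms are negligible. -/
lemma exists_abs_sum_squarefree_sub_diagPart_le (hq : ringChar Fq ≠ 2) (k : ℕ) (hk : 2 ≤ k) :
    ∃ G : ℕ, ∀ g ≥ G, ∀ y ≤ g, |∑ D ∈ (monicOfDegree Fq (2 * g + 1)).filter Squarefree,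
      (partialL y D * partialL (4 * g / (15 * k)) D ^ (k - 1) -
        diagPart (k - 1) (4 * g / (15 * k)) y D)| ≤ (Fintype.card Fq : ℝ) ^ (2 * g + 1) := by
  have h := (tendsto_pow_mul_saving (monicUpTo Fq 40).card (k - 1)).eventually
    (eventually_le_nhds zero_lt_one)
  obtain ⟨G, hG⟩ := eventually_atTop.1 h
  refine ⟨G, fun g hg y hy => ?_⟩
  set l := k - 1 with hl
  set x := 4 * g / (15 * k) with hx
  have h1 : 15 * (l * x) ≤ 4 * g := by
    calc 15 * (l * x) = 15 * l * x := by ring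
      _ ≤ 15 * k * x := Nat.mul_le_mul_right _ (by omega)
      _ ≤ 4 * g := Nat.mul_div_le _ _
  have h2 : x ≤ g := by
    refine Nat.div_le_of_le_mul ?_
    nlinarith
  have hJ : 10 * (l * x) + g ≤ 10 * ((g + 1 - l * x) / 2 + 1) := by omega
  refine (abs_sum_squarefree_sub_diagPart_le hq (J := (g + 1 - l * x) / 2) (b := 40) (by norm_num)
    hy (by omega) (by omega) (by omega)).trans ?_
  have h3 := sieve_loss_mul_saving_le (Fq := Fq) (C := (monicUpTo Fq 40).card) hJ
  have h4 := hG g hg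
  set Q : ℝ := (Fintype.card Fq : ℝ)
  calc _ ≤ 3 * Q ^ (2 * g + 1) * (((g : ℝ) + 1) ^ 2 * ((g : ℝ) + 1) ^ l) *
        (2 ^ (monicUpTo Fq 40).card * ((2 : ℝ) ^ (-(1 / 40 : ℝ))) ^ g) := by
        refine mul_le_mul ?_ h3 (by positivity) (by positivity)
        gcongr
    _ = Q ^ (2 * g + 1) * (3 * ((g : ℝ) + 1) ^ (l + 2) *
        (2 ^ (monicUpTo Fq 40).card * ((2 : ℝ) ^ (-(1 / 40 : ℝ))) ^ g)) := by ring
    _ ≤ Q ^ (2 * g + 1) * 1 := mul_le_mul_of_nonneg_left h4 (by positivity)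
    _ = _ := mul_one _

end OffDiagonal

section Rough

/-- A monic polynomial all of whose nontrivial monic divisors have degree larger than `b`. -/
def IsRough (b : ℕ) (r : Fq[X]) : Prop :=
  r.Monic ∧ ∀ d : Fq[X], d.Monic → d ∣ r → d ≠ 1 → b < d.natDegree

variable (Fq) in
/-- The rough monic polynomials of degree at most `Y`. -/
noncomputable def roughUpTo (b Y : ℕ) : Finset Fq[X] := (monicUpTo Fq Y).filter (IsRough b)

lemma mem_roughUpTo {b Y : ℕ} {r : Fq[X]} :
    r ∈ roughUpTo Fq b Y ↔ (r.Monic ∧ r.natDegree ≤ Y) ∧ IsRough b r := by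
  rw [roughUpTo, Finset.mem_filter, mem_monicUpTo]

variable (Fq) in
/-- The logarithmic mass of the rough polynomials of degree at most `Y`. -/
noncomputable def roughMass (b Y : ℕ) : ℝ :=
  ∑ r ∈ roughUpTo Fq b Y, (Fintype.card Fq : ℝ)⁻¹ ^ r.natDegree

lemma roughMass_nonneg (b Y : ℕ) : 0 ≤ roughMass Fq b Y :=
  Finset.sum_nonneg fun _ _ => by positivity

variable (Fq) in
/-- The product of the monic polynomials of degree between `1` and `b`. -/
noncomputable def smallProd (b : ℕ) : Fq[X] :=
  ∏ d ∈ (monicUpTo Fq b).filter (· ≠ 1), d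

lemma monic_smallProd (b : ℕ) : (smallProd Fq b).Monic :=
  monic_prod_of_monic _ _ fun _ hd => (mem_monicUpTo.1 (Finset.mem_filter.1 hd).1).1

lemma natDegree_smallProd_pos {b : ℕ} (hb : 0 < b) : 0 < (smallProd Fq b).natDegree := by
  have h : (X : Fq[X]) ∣ smallProd Fq b := by
    refine Finset.dvd_prod_of_mem (fun d => d) ?_
    rw [Finset.mem_filter, mem_monicUpTo]
    exact ⟨⟨monic_X, by rw [natDegree_X]; omega⟩, fun h => by simpa using congrArg natDegree h⟩
  have := natDegree_le_of_dvd h (monic_smallProd b).ne_zero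
  rw [natDegree_X] at this
  omega

lemma monic_smallProd_mul_add_one {b : ℕ} (hb : 0 < b) {t : Fq[X]} (ht : t.Monic) :
    (smallProd Fq b * t + 1).Monic ∧
      (smallProd Fq b * t + 1).natDegree = (smallProd Fq b).natDegree + t.natDegree := by
  have h1 := (monic_smallProd (Fq := Fq) b).mul ht
  have h2 := (monic_smallProd (Fq := Fq) b).natDegree_mul ht
  have h3 := natDegree_smallProd_pos (Fq := Fq) hb
  have h4 : (1 : Fq[X]).degree < (smallProd Fq b * t).degree := by
    rw [degree_one, degree_eq_natDegree h1.ne_zero, h2]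
    exact_mod_cast (by omega : 0 < _)
  exact ⟨h1.add_of_left h4, by rw [natDegree_add_eq_left_of_degree_lt h4, h2]⟩

lemma isRough_smallProd_mul_add_one {b : ℕ} (hb : 0 < b) {t : Fq[X]} (ht : t.Monic) :
    IsRough b (smallProd Fq b * t + 1) := by
  refine ⟨(monic_smallProd_mul_add_one hb ht).1, fun d hd hdr hd1 => ?_⟩
  by_contra h
  push Not at h
  have h1 : d ∣ smallProd Fq b := by
    refine Finset.dvd_prod_of_mem (fun d => d) ?_
    rw [Finset.mem_filter, mem_monicUpTo]
    exact ⟨⟨hd, h⟩, hd1⟩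
  have h2 : d ∣ 1 := (dvd_add_right (h1.mul_right t)).1 hdr
  exact hd1 (hd.eq_one_of_isUnit (isUnit_of_dvd_one h2))

lemma le_roughMass {b Y : ℕ} (hb : 0 < b) (hY : (smallProd Fq b).natDegree ≤ Y) :
    (Fintype.card Fq : ℝ)⁻¹ ^ (smallProd Fq b).natDegree *
      ((Y : ℝ) - (smallProd Fq b).natDegree + 1) ≤ roughMass Fq b Y := by
  set m := (smallProd Fq b).natDegree with hm
  have h := sum_monicUpTo_inv_card_pow (Fq := Fq) (Y - m)
  rw [Nat.cast_sub hY] at h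
  rw [← h, Finset.mul_sum, roughMass]
  refine sum_le_sum_of_rel (fun t r => smallProd Fq b * t + 1 = r) (fun _ _ => by positivity) ?_ ?_
  · intro t ht
    rw [mem_monicUpTo] at ht
    have h1 := monic_smallProd_mul_add_one hb ht.1
    refine ⟨_, ?_, rfl, ?_⟩
    · rw [mem_roughUpTo]
      exact ⟨⟨h1.1, by omega⟩, isRough_smallProd_mul_add_one hb ht.1⟩
    · rw [h1.2, pow_add]
  · rintro a - c - r h1 h2
    exact mul_left_cancel₀ (monic_smallProd b).ne_zero (add_right_cancel (h1.trans h2.symm))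

lemma sum_roughUpTo_dvd_le (b Y : ℕ) {d : Fq[X]} (hd : d.Monic) :
    ∑ r ∈ roughUpTo Fq b Y, (if d ∣ r then (Fintype.card Fq : ℝ)⁻¹ ^ r.natDegree else 0) ≤
      (Fintype.card Fq : ℝ)⁻¹ ^ d.natDegree * roughMass Fq b Y := by
  rw [← Finset.sum_filter, roughMass, Finset.mul_sum]
  refine sum_le_sum_of_rel (fun r t => r = d * t) (fun _ _ => by positivity) ?_ ?_
  · intro r hr
    rw [Finset.mem_filter, mem_roughUpTo] at hr
    obtain ⟨⟨⟨hr, hrY⟩, hrough⟩, t, rfl⟩ := hr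
    have ht := hd.of_mul_monic_left hr
    have hdeg := hd.natDegree_mul ht
    refine ⟨t, ?_, rfl, by rw [hdeg, pow_add]⟩
    rw [mem_roughUpTo]
    exact ⟨⟨ht, by omega⟩, ht, fun e he het => hrough.2 e he (het.mul_left d)⟩
  · rintro a - c - t h1 h2
    exact h1.trans h2.symm

lemma sum_large_inv_sq_le (b Y : ℕ) :
    ∑ d ∈ (monicUpTo Fq Y).filter (b < ·.natDegree),
      ((Fintype.card Fq : ℝ)⁻¹ ^ d.natDegree) ^ 2 ≤
      (Fintype.card Fq : ℝ)⁻¹ ^ b / ((Fintype.card Fq : ℝ) - 1) := by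
  have hq2 := two_le_card (Fq := Fq)
  set Q : ℝ := (Fintype.card Fq : ℝ) with hQ
  have hQ1 : Q⁻¹ < 1 := inv_lt_one_of_one_lt₀ (by linarith)
  rw [Finset.sum_filter]
  rw [sum_monicUpTo_const Y fun j => if b < j then (Q⁻¹ ^ j) ^ 2 else 0]
  calc ∑ j ∈ Finset.range (Y + 1), Q ^ j * (if b < j then (Q⁻¹ ^ j) ^ 2 else 0) =
      ∑ j ∈ (Finset.range (Y + 1)).filter (b < ·), Q⁻¹ ^ j := by
        rw [Finset.sum_filter]
        refine Finset.sum_congr rfl fun j _ => ?_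
        split_ifs
        · rw [pow_two, ← mul_assoc, ← mul_pow, mul_inv_cancel₀ (by linarith), one_pow, one_mul]
        · exact mul_zero _
    _ = ∑ j ∈ Finset.Ico (b + 1) (Y + 1), Q⁻¹ ^ j := by
        refine Finset.sum_congr ?_ fun _ _ => rfl
        ext j
        simp only [Finset.mem_filter, Finset.mem_range, Finset.mem_Ico]
        omega
    _ ≤ Q⁻¹ ^ (b + 1) / (1 - Q⁻¹) := geom_sum_Ico_le_of_lt_one (by positivity) hQ1
    _ = _ := by
        have : Q - 1 ≠ 0 := by linarith
        rw [pow_succ]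
        field_simp

lemma card_squarefree_ge (hq : 3 ≤ Fintype.card Fq) (g : ℕ) :
    (Fintype.card Fq : ℝ) ^ (2 * g + 1) / 2 ≤
      (((monicOfDegree Fq (2 * g + 1)).filter Squarefree).card : ℝ) := by
  have hq3 : (3 : ℝ) ≤ Fintype.card Fq := by exact_mod_cast hq
  have h1 : (((monicOfDegree Fq (2 * g + 1)).filter (¬ Squarefree ·)).card : ℝ) ≤
      (Fintype.card Fq : ℝ) ^ (2 * g + 1) / 2 := by
    set Q : ℝ := (Fintype.card Fq : ℝ) with hQ
    have hsub : (monicOfDegree Fq (2 * g + 1)).filter (¬ Squarefree ·) ⊆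
        ((monicUpTo Fq g).filter (0 < ·.natDegree)).biUnion
          fun s => (monicOfDegree Fq (2 * g + 1)).filter (s ^ 2 ∣ ·) := by
      intro D hD
      rw [Finset.mem_filter] at hD
      have hD' := mem_monicOfDegree.1 hD.1
      have hns := hD.2
      rw [Squarefree] at hns
      push Not at hns
      obtain ⟨t, ht, htu⟩ := hns
      have ht0 : t ≠ 0 := by
        rintro rfl
        rw [mul_zero, zero_dvd_iff] at ht
        exact hD'.1.ne_zero ht
      obtain ⟨s, hs, hst⟩ := exists_monic_associated ht0
      have hsD : s ^ 2 ∣ D := (hst.pow_pow.dvd).trans (by rwa [pow_two])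
      rw [Finset.mem_biUnion]
      refine ⟨s, ?_, Finset.mem_filter.2 ⟨hD.1, hsD⟩⟩
      have hdeg := natDegree_le_of_dvd hsD hD'.1.ne_zero
      rw [hs.natDegree_pow] at hdeg
      rw [Finset.mem_filter, mem_monicUpTo]
      refine ⟨⟨hs, by omega⟩, ?_⟩
      rw [hs.natDegree_pos]
      rintro rfl
      exact htu (hst.isUnit isUnit_one)
    calc (((monicOfDegree Fq (2 * g + 1)).filter (¬ Squarefree ·)).card : ℝ) ≤
        ∑ s ∈ (monicUpTo Fq g).filter (0 < ·.natDegree),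
          (((monicOfDegree Fq (2 * g + 1)).filter (s ^ 2 ∣ ·)).card : ℝ) := by
          exact_mod_cast (Finset.card_le_card hsub).trans Finset.card_biUnion_le
      _ ≤ ∑ s ∈ (monicUpTo Fq g).filter (0 < ·.natDegree),
          Q ^ (2 * g + 1) * (Q⁻¹ ^ s.natDegree) ^ 2 := by
          refine Finset.sum_le_sum fun s hs => ?_
          have hs := (mem_monicUpTo.1 (Finset.mem_filter.1 hs).1).1
          refine (card_filter_dvd_le (hs.pow 2)).trans_eq ?_
          rw [hs.natDegree_pow, div_eq_mul_inv, ← pow_mul, mul_comm s.natDegree, inv_pow]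
      _ ≤ Q ^ (2 * g + 1) * (Q⁻¹ ^ 0 / (Q - 1)) := by
          rw [← Finset.mul_sum]
          exact mul_le_mul_of_nonneg_left (sum_large_inv_sq_le 0 g) (by positivity)
      _ ≤ _ := by
          rw [pow_zero, div_eq_mul_inv _ (2 : ℝ)]
          refine mul_le_mul_of_nonneg_left ?_ (by positivity)
          rw [← one_div]
          exact one_div_le_one_div_of_le (by norm_num) (by linarith)
  have h2 := Finset.card_filter_add_card_filter_not (s := monicOfDegree Fq (2 * g + 1)) Squarefree
  rw [card_monicOfDegree] at h2
  have h3 : (((monicOfDegree Fq (2 * g + 1)).filter Squarefree).card : ℝ) +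
      (((monicOfDegree Fq (2 * g + 1)).filter (¬ Squarefree ·)).card : ℝ) =
      (Fintype.card Fq : ℝ) ^ (2 * g + 1) := by exact_mod_cast h2
  linarith

end Rough

section PairTuples

lemma prod_mul_prod_sym2 {ι M : Type*} [Fintype ι] [CommMonoid M] (f : Sym2 ι → M) :
    ∏ i, (f s(i, i) * ∏ j, f s(i, j)) = (∏ e, f e) ^ 2 := by
  have h1 : ∏ i, f s(i, i) = ∏ e : Sym2 ι, f e ^ (Finset.univ.filter fun i => s(i, i) = e).card := by
    rw [← Finset.prod_fiberwise _ (fun i => s(i, i))]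
    refine Finset.prod_congr rfl fun e _ => Finset.prod_eq_pow_card ?_
    intro i hi
    rw [(Finset.mem_filter.1 hi).2]
  have h2 : ∏ i, ∏ j, f s(i, j) =
      ∏ e : Sym2 ι, f e ^ (Finset.univ.filter fun p : ι × ι => s(p.1, p.2) = e).card := by
    rw [← Fintype.prod_prod_type' (fun i j => f s(i, j)),
      ← Finset.prod_fiberwise _ (fun p : ι × ι => s(p.1, p.2))]
    refine Finset.prod_congr rfl fun e _ => Finset.prod_eq_pow_card ?_
    intro p hp
    rw [(Finset.mem_filter.1 hp).2]
  rw [Finset.prod_mul_distrib, h1, h2, ← Finset.prod_mul_distrib, ← Finset.prod_pow]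
  refine Finset.prod_congr rfl fun e _ => ?_
  rw [← pow_add]
  congr 1
  induction e using Sym2.ind with | _ a b => ?_
  by_cases hab : a = b
  · subst hab
    have e1 : (Finset.univ.filter fun i => s(i, i) = s(a, a)) = {a} := by
      ext i
      simp
    have e2 : (Finset.univ.filter fun p : ι × ι => s(p.1, p.2) = s(a, a)) = {(a, a)} := by
      ext ⟨i, j⟩
      simp
    rw [e1, e2, Finset.card_singleton, Finset.card_singleton]
  · have e1 : (Finset.univ.filter fun i => s(i, i) = s(a, b)) = ∅ := by
      ext i
      simp only [Finset.mem_filter, Finset.mem_univ, true_and, Finset.notMem_empty, iff_false,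
        Sym2.eq_iff]
      rintro (⟨h1, h2⟩ | ⟨h1, h2⟩)
      · exact hab (h1.symm.trans h2)
      · exact hab (h2.symm.trans h1)
    have e2 : (Finset.univ.filter fun p : ι × ι => s(p.1, p.2) = s(a, b)) = {(a, b), (b, a)} := by
      ext ⟨i, j⟩
      simp
    rw [e1, e2, Finset.card_empty, Finset.card_pair]
    intro h
    exact hab (Prod.ext_iff.1 h).1

variable {ι : Type*} [Fintype ι]

/-- The tuple with entries `r_ii ^ 2 * ∏_{j ≠ i} r_ij`, whose product is a square. -/
noncomputable def pairTuple (r : Sym2 ι → Fq[X]) (i : ι) : Fq[X] := r s(i, i) * ∏ j, r s(i, j)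

lemma monic_pairTuple {r : Sym2 ι → Fq[X]} (hr : ∀ e, (r e).Monic) (i : ι) :
    (pairTuple r i).Monic :=
  (hr _).mul (monic_prod_of_monic _ _ fun _ _ => hr _)

lemma natDegree_pairTuple_le {r : Sym2 ι → Fq[X]} (hr : ∀ e, (r e).Monic) {Y : ℕ}
    (hY : ∀ e, (r e).natDegree ≤ Y) (i : ι) :
    (pairTuple r i).natDegree ≤ (Fintype.card ι + 1) * Y := by
  rw [pairTuple, (hr _).natDegree_mul (monic_prod_of_monic _ _ fun _ _ => hr _),
    natDegree_prod_of_monic _ _ fun _ _ => hr _]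
  calc _ ≤ Y + ∑ j : ι, Y := add_le_add (hY _) (Finset.sum_le_sum fun j _ => hY _)
    _ = _ := by simp; ring

lemma prod_pairTuple (r : Sym2 ι → Fq[X]) : ∏ i, pairTuple r i = (∏ e, r e) ^ 2 :=
  prod_mul_prod_sym2 r

lemma pairTuple_eq_mul (r : Sym2 ι → Fq[X]) (i j : ι) :
    pairTuple r i = r s(i, j) * (r s(i, i) * ∏ m ∈ Finset.univ.erase j, r s(i, m)) := by
  rw [pairTuple, ← Finset.mul_prod_erase _ _ (Finset.mem_univ j)]
  ring

lemma dvd_of_dvd_pairTuple {r : Sym2 ι → Fq[X]} (hr : Pairwise fun e e' => IsCoprime (r e) (r e'))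
    {i j : ι} (hij : i ≠ j) {d : Fq[X]} (hi : d ∣ pairTuple r i) (hj : d ∣ pairTuple r j) :
    d ∣ r s(i, j) := by
  rw [pairTuple_eq_mul r i j] at hi
  rw [pairTuple_eq_mul r j i, Sym2.eq_swap] at hj
  have hne : ∀ m m', m ≠ j → s(i, m) ≠ s(j, m') := by
    intro m m' hm h
    rw [Sym2.eq_iff] at h
    rcases h with ⟨h, -⟩ | ⟨-, h⟩
    · exact hij h
    · exact hm h
  have hcop : IsCoprime (r s(i, i) * ∏ m ∈ Finset.univ.erase j, r s(i, m))
      (r s(j, j) * ∏ m ∈ Finset.univ.erase i, r s(j, m)) := by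
    have h1 : ∀ m, m ≠ j → IsCoprime (r s(i, m))
        (r s(j, j) * ∏ m ∈ Finset.univ.erase i, r s(j, m)) := fun m hm =>
      IsCoprime.mul_right (hr (hne _ _ hm)) (IsCoprime.prod_right fun m' _ => hr (hne _ _ hm))
    exact IsCoprime.mul_left (h1 i hij)
      (IsCoprime.prod_left fun m hm => h1 m (Finset.ne_of_mem_erase hm))
  obtain ⟨u, v, huv⟩ := hcop
  have h2 : r s(i, j) = u * (r s(i, j) * (r s(i, i) * ∏ m ∈ Finset.univ.erase j, r s(i, m))) +
      v * (r s(i, j) * (r s(j, j) * ∏ m ∈ Finset.univ.erase i, r s(j, m))) := by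
    linear_combination (-r s(i, j)) * huv
  rw [h2]
  exact dvd_add (hi.mul_left u) (hj.mul_left v)

lemma pairTuple_injective {r r' : Sym2 ι → Fq[X]} (hm : ∀ e, (r e).Monic)
    (hm' : ∀ e, (r' e).Monic) (hr : Pairwise fun e e' => IsCoprime (r e) (r e'))
    (hr' : Pairwise fun e e' => IsCoprime (r' e) (r' e')) (h : pairTuple r = pairTuple r') :
    r = r' := by
  have hdvd : ∀ (r : Sym2 ι → Fq[X]) (i j : ι), r s(i, j) ∣ pairTuple r i := fun r i j =>
    ⟨_, pairTuple_eq_mul r i j⟩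
  have hoff : ∀ i j, i ≠ j → r s(i, j) = r' s(i, j) := by
    intro i j hij
    refine eq_of_monic_of_associated (hm _) (hm' _) (associated_of_dvd_dvd ?_ ?_)
    · refine dvd_of_dvd_pairTuple hr' hij ?_ ?_
      · rw [← h]
        exact hdvd r i j
      · rw [← h, Sym2.eq_swap]
        exact hdvd r j i
    · refine dvd_of_dvd_pairTuple hr hij ?_ ?_
      · rw [h]
        exact hdvd r' i j
      · rw [h, Sym2.eq_swap]
        exact hdvd r' j i
  funext e
  induction e using Sym2.ind with | _ i j => ?_
  by_cases hij : i = j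
  · subst hij
    have h1 := congrFun h i
    rw [pairTuple_eq_mul r i i, pairTuple_eq_mul r' i i,
      Finset.prod_congr rfl fun m hm => hoff i m (Finset.ne_of_mem_erase hm).symm, ← mul_assoc,
      ← mul_assoc] at h1
    have h2 := mul_right_cancel₀ (monic_prod_of_monic _ _ fun m _ => hm' _).ne_zero h1
    rw [← pow_two, ← pow_two] at h2
    exact eq_of_monic_of_associated (hm _) (hm' _)
      (associated_of_dvd_dvd ((IsIntegrallyClosed.pow_dvd_pow_iff two_ne_zero).1 h2.dvd)
        ((IsIntegrallyClosed.pow_dvd_pow_iff two_ne_zero).1 h2.symm.dvd))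
  · exact hoff i j hij

end PairTuples

section Diagonal

variable {E : Type*} [Fintype E] [DecidableEq E]

lemma sum_pi_roughUpTo (b Y : ℕ) :
    ∑ r ∈ Fintype.piFinset fun _ : E => roughUpTo Fq b Y,
      ∏ e, (Fintype.card Fq : ℝ)⁻¹ ^ (r e).natDegree = roughMass Fq b Y ^ Fintype.card E := by
  rw [← Finset.prod_univ_sum (fun _ : E => roughUpTo Fq b Y)
    fun _ f => (Fintype.card Fq : ℝ)⁻¹ ^ f.natDegree]
  simp [roughMass]

lemma sum_pi_roughUpTo_dvd_le (b Y : ℕ) (S : Finset E) {d : Fq[X]} (hd : d.Monic) :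
    ∑ r ∈ Fintype.piFinset fun _ : E => roughUpTo Fq b Y,
      (∏ e, (Fintype.card Fq : ℝ)⁻¹ ^ (r e).natDegree) * (if ∀ e ∈ S, d ∣ r e then 1 else 0) ≤
      roughMass Fq b Y ^ Fintype.card E *
        ((Fintype.card Fq : ℝ)⁻¹ ^ d.natDegree) ^ S.card := by
  have h1 : ∀ r : E → Fq[X], (∏ e, (Fintype.card Fq : ℝ)⁻¹ ^ (r e).natDegree) *
      (if ∀ e ∈ S, d ∣ r e then 1 else 0) =
      ∏ e, if e ∈ S → d ∣ r e then (Fintype.card Fq : ℝ)⁻¹ ^ (r e).natDegree else 0 := by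
    intro r
    rw [Finset.prod_ite_zero, mul_ite, mul_one, mul_zero]
    simp
  simp_rw [h1]
  rw [← Finset.prod_univ_sum (fun _ : E => roughUpTo Fq b Y)
    fun e f => if e ∈ S → d ∣ f then (Fintype.card Fq : ℝ)⁻¹ ^ f.natDegree else 0]
  calc _ ≤ ∏ e : E, (roughMass Fq b Y *
        if e ∈ S then (Fintype.card Fq : ℝ)⁻¹ ^ d.natDegree else 1) := by
        refine Finset.prod_le_prod (fun e _ => Finset.sum_nonneg fun f _ => ?_) fun e _ => ?_
        · split_ifs <;> positivity
        · by_cases he : e ∈ S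
          · simp only [he, if_true, true_imp_iff]
            rw [mul_comm]
            exact sum_roughUpTo_dvd_le b Y hd
          · simp [he, roughMass]
    _ = _ := by
        rw [Finset.prod_mul_distrib, Finset.prod_ite_mem, Finset.prod_const, Finset.prod_const,
          Finset.card_univ, Finset.univ_inter]

lemma exists_large_common_divisor {b Y : ℕ} {D f : Fq[X]} (hD : D.Monic)
    (hf : f ∈ roughUpTo Fq b Y) (h : ¬ IsCoprime D f) :
    ∃ d ∈ (monicUpTo Fq Y).filter (b < ·.natDegree), d ∣ D ∧ d ∣ f := by
  rw [mem_roughUpTo] at hf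
  obtain ⟨d, a, c, hd, -, -, hac, rfl, rfl⟩ := exists_monic_gcd hD hf.1.1
  refine ⟨d, ?_, dvd_mul_right _ _, dvd_mul_right _ _⟩
  rw [Finset.mem_filter, mem_monicUpTo]
  refine ⟨⟨hd, (natDegree_le_of_dvd (dvd_mul_right d c) hf.1.1.ne_zero).trans hf.1.2⟩,
    hf.2.2 d hd (dvd_mul_right d c) ?_⟩
  rintro rfl
  exact h (by simpa using hac)

/-- A bound for the proportion of pairs lost by imposing coprimality conditions on `r`. -/
noncomputable def coprimalityLoss (b Y : ℕ) (r : E → Fq[X]) : ℝ :=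
  ∑ p ∈ Finset.univ.offDiag, ∑ d ∈ (monicUpTo Fq Y).filter (b < ·.natDegree),
    (if ∀ e ∈ ({p.1, p.2} : Finset E), d ∣ r e then 1 else 0) +
  ∑ e : E, ∑ d ∈ (monicUpTo Fq Y).filter (b < ·.natDegree),
    (Fintype.card Fq : ℝ)⁻¹ ^ d.natDegree * (if ∀ e' ∈ ({e} : Finset E), d ∣ r e' then 1 else 0)

lemma le_card_coprime (hq : 3 ≤ Fintype.card Fq) (g : ℕ) {b Y : ℕ} {r : E → Fq[X]}
    (hr : ∀ e, r e ∈ roughUpTo Fq b Y) :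
    (Fintype.card Fq : ℝ) ^ (2 * g + 1) * (1 / 2 - coprimalityLoss b Y r) ≤
      if Pairwise fun e e' => IsCoprime (r e) (r e') then
        ((((monicOfDegree Fq (2 * g + 1)).filter Squarefree).filter
          fun D => IsCoprime D (∏ e, r e)).card : ℝ) else 0 := by
  set Q : ℝ := (Fintype.card Fq : ℝ) with hQ
  set L := (monicUpTo Fq Y).filter (b < ·.natDegree) with hL
  have hpos1 : ∀ p : E × E, 0 ≤ ∑ d ∈ L,
      (if ∀ e ∈ ({p.1, p.2} : Finset E), d ∣ r e then (1 : ℝ) else 0) := fun p =>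
    Finset.sum_nonneg fun d _ => by split_ifs <;> norm_num
  have hpos2 : ∀ e : E, 0 ≤ ∑ d ∈ L, Q⁻¹ ^ d.natDegree *
      (if ∀ e' ∈ ({e} : Finset E), d ∣ r e' then 1 else 0) := fun e =>
    Finset.sum_nonneg fun d _ => by split_ifs <;> positivity
  split_ifs with hgood
  · have h1 : ((((monicOfDegree Fq (2 * g + 1)).filter Squarefree).filter
        fun D => ¬ IsCoprime D (∏ e, r e)).card : ℝ) ≤ Q ^ (2 * g + 1) * ∑ e : E, ∑ d ∈ L,
        Q⁻¹ ^ d.natDegree * (if ∀ e' ∈ ({e} : Finset E), d ∣ r e' then 1 else 0) := by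
      have hsub : ((monicOfDegree Fq (2 * g + 1)).filter Squarefree).filter
          (fun D => ¬ IsCoprime D (∏ e, r e)) ⊆ Finset.univ.biUnion fun e : E =>
            (L.filter (· ∣ r e)).biUnion fun d => (monicOfDegree Fq (2 * g + 1)).filter (d ∣ ·) := by
        intro D hD
        rw [Finset.mem_filter, Finset.mem_filter] at hD
        have hDm := (mem_monicOfDegree.1 hD.1.1).1
        obtain ⟨e, he⟩ : ∃ e, ¬ IsCoprime D (r e) := by
          by_contra h
          push Not at h
          exact hD.2 (IsCoprime.prod_right fun e _ => h e)
        obtain ⟨d, hd, hdD, hde⟩ := exists_large_common_divisor hDm (hr e) he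
        simp only [Finset.mem_biUnion, Finset.mem_univ, true_and]
        exact ⟨e, d, Finset.mem_filter.2 ⟨hd, hde⟩, Finset.mem_filter.2 ⟨hD.1.1, hdD⟩⟩
      calc _ ≤ ∑ e : E, ∑ d ∈ L.filter (· ∣ r e),
            (((monicOfDegree Fq (2 * g + 1)).filter (d ∣ ·)).card : ℝ) := by
            have := (Finset.card_le_card hsub).trans (Finset.card_biUnion_le.trans
              (Finset.sum_le_sum fun e _ => Finset.card_biUnion_le))
            exact_mod_cast this
        _ ≤ ∑ e : E, ∑ d ∈ L.filter (· ∣ r e), Q ^ (2 * g + 1) * Q⁻¹ ^ d.natDegree := by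
            refine Finset.sum_le_sum fun e _ => Finset.sum_le_sum fun d hd => ?_
            refine (card_filter_dvd_le
              (mem_monicUpTo.1 (Finset.mem_filter.1 (Finset.mem_filter.1 hd).1).1).1).trans_eq ?_
            rw [div_eq_mul_inv, inv_pow]
        _ = _ := by
            rw [Finset.mul_sum]
            refine Finset.sum_congr rfl fun e _ => ?_
            rw [Finset.sum_filter, Finset.mul_sum]
            refine Finset.sum_congr rfl fun d _ => ?_
            simp only [Finset.mem_singleton, forall_eq]
            split_ifs <;> simp
    have h2 := Finset.card_filter_add_card_filter_not
      (s := (monicOfDegree Fq (2 * g + 1)).filter Squarefree) fun D => IsCoprime D (∏ e, r e)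
    have h3 : ((((monicOfDegree Fq (2 * g + 1)).filter Squarefree).filter
        fun D => IsCoprime D (∏ e, r e)).card : ℝ) +
      ((((monicOfDegree Fq (2 * g + 1)).filter Squarefree).filter
        fun D => ¬ IsCoprime D (∏ e, r e)).card : ℝ) =
      (((monicOfDegree Fq (2 * g + 1)).filter Squarefree).card : ℝ) := by exact_mod_cast h2
    have h4 := card_squarefree_ge hq g
    have h5 : Q ^ (2 * g + 1) * (∑ e : E, ∑ d ∈ L, Q⁻¹ ^ d.natDegree *
        (if ∀ e' ∈ ({e} : Finset E), d ∣ r e' then 1 else 0)) ≤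
        Q ^ (2 * g + 1) * coprimalityLoss b Y r :=
      mul_le_mul_of_nonneg_left (le_add_of_nonneg_left (Finset.sum_nonneg fun p _ => hpos1 p))
        (by positivity)
    linarith
  · have h1 : 1 ≤ coprimalityLoss b Y r := by
      rw [Pairwise] at hgood
      push Not at hgood
      obtain ⟨e, e', hne, hcop⟩ := hgood
      have hrm := (mem_roughUpTo.1 (hr e)).1.1
      obtain ⟨d, hd, h1, h2⟩ := exists_large_common_divisor hrm (hr e') hcop
      refine le_add_of_le_of_nonneg ?_ (Finset.sum_nonneg fun e _ => hpos2 e)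
      refine le_trans ?_ (Finset.single_le_sum (f := fun p : E × E => ∑ d ∈ L,
        (if ∀ e ∈ ({p.1, p.2} : Finset E), d ∣ r e then (1 : ℝ) else 0)) (fun p _ => hpos1 p)
        (show (e, e') ∈ _ from Finset.mem_offDiag.2 ⟨Finset.mem_univ e, Finset.mem_univ e', hne⟩))
      refine le_trans ?_ (Finset.single_le_sum (f := fun d : Fq[X] =>
        (if ∀ i ∈ ({e, e'} : Finset E), d ∣ r i then (1 : ℝ) else 0))
        (fun d _ => by split_ifs <;> norm_num) hd)
      rw [if_pos]
      intro i hi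
      rw [Finset.mem_insert, Finset.mem_singleton] at hi
      rcases hi with rfl | rfl
      exacts [h1, h2]
    exact mul_nonpos_of_nonneg_of_nonpos (by positivity) (by linarith)

lemma sum_coprimalityLoss_le {b : ℕ} (Y : ℕ)
    (hb : 8 * (Fintype.card E) ^ 2 ≤ b) (hq : 3 ≤ Fintype.card Fq) :
    ∑ r ∈ Fintype.piFinset fun _ : E => roughUpTo Fq b Y,
      (∏ e, (Fintype.card Fq : ℝ)⁻¹ ^ (r e).natDegree) * coprimalityLoss b Y r ≤
      roughMass Fq b Y ^ Fintype.card E / 4 := by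
  have hq3 : (3 : ℝ) ≤ Fintype.card Fq := by exact_mod_cast hq
  set Q : ℝ := (Fintype.card Fq : ℝ) with hQ
  set L := (monicUpTo Fq Y).filter (b < ·.natDegree) with hL
  set U := roughMass Fq b Y with hU
  set K := Fintype.card E with hK
  have hU0 : 0 ≤ U := roughMass_nonneg b Y
  set w : (E → Fq[X]) → ℝ := fun r => ∏ e, Q⁻¹ ^ (r e).natDegree with hw
  have hLm : ∀ d ∈ L, d.Monic := fun d hd => (mem_monicUpTo.1 (Finset.mem_filter.1 hd).1).1
  have hLs : ∑ d ∈ L, (Q⁻¹ ^ d.natDegree) ^ 2 ≤ Q⁻¹ ^ b := by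
    refine (sum_large_inv_sq_le b Y).trans (div_le_self (by positivity) ?_)
    linarith
  have h1 : ∀ p ∈ (Finset.univ : Finset E).offDiag,
      ∑ r ∈ Fintype.piFinset fun _ : E => roughUpTo Fq b Y, ∑ d ∈ L,
        w r * (if ∀ e ∈ ({p.1, p.2} : Finset E), d ∣ r e then 1 else 0) ≤ U ^ K * Q⁻¹ ^ b := by
    intro p hp
    rw [Finset.sum_comm]
    refine (Finset.sum_le_sum fun d hd => sum_pi_roughUpTo_dvd_le b Y _ (hLm d hd)).trans ?_
    rw [Finset.card_pair (Finset.mem_offDiag.1 hp).2.2, ← Finset.mul_sum]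
    exact mul_le_mul_of_nonneg_left hLs (by positivity)
  have h2 : ∀ e : E,
      ∑ r ∈ Fintype.piFinset fun _ : E => roughUpTo Fq b Y, ∑ d ∈ L,
        w r * (Q⁻¹ ^ d.natDegree * (if ∀ e' ∈ ({e} : Finset E), d ∣ r e' then 1 else 0)) ≤
        U ^ K * Q⁻¹ ^ b := by
    intro e
    rw [Finset.sum_comm]
    simp_rw [mul_left_comm (w _), ← Finset.mul_sum]
    refine (Finset.sum_le_sum fun d hd => mul_le_mul_of_nonneg_left
      (sum_pi_roughUpTo_dvd_le b Y _ (hLm d hd)) (by positivity)).trans ?_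
    refine le_trans (le_of_eq ?_) (mul_le_mul_of_nonneg_left hLs (pow_nonneg hU0 K))
    rw [Finset.mul_sum]
    refine Finset.sum_congr rfl fun d _ => ?_
    rw [Finset.card_singleton]
    ring
  have hsplit : ∑ r ∈ Fintype.piFinset fun _ : E => roughUpTo Fq b Y, w r * coprimalityLoss b Y r =
      (∑ p ∈ (Finset.univ : Finset E).offDiag,
        ∑ r ∈ Fintype.piFinset fun _ : E => roughUpTo Fq b Y, ∑ d ∈ L,
        w r * (if ∀ e ∈ ({p.1, p.2} : Finset E), d ∣ r e then 1 else 0)) +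
      ∑ e : E, ∑ r ∈ Fintype.piFinset fun _ : E => roughUpTo Fq b Y, ∑ d ∈ L,
        w r * (Q⁻¹ ^ d.natDegree * (if ∀ e' ∈ ({e} : Finset E), d ∣ r e' then 1 else 0)) := by
    rw [Finset.sum_comm, Finset.sum_comm (s := (Finset.univ : Finset E)), ← Finset.sum_add_distrib]
    refine Finset.sum_congr rfl fun r _ => ?_
    rw [coprimalityLoss, mul_add, Finset.mul_sum, Finset.mul_sum]
    simp_rw [Finset.mul_sum]
    rfl
  have hKb : (2 * K ^ 2 : ℝ) * Q⁻¹ ^ b ≤ 1 / 4 := by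
    have h3 : (8 * K ^ 2 : ℝ) ≤ Q ^ b := by
      calc (8 * K ^ 2 : ℝ) ≤ b := by exact_mod_cast hb
        _ ≤ 2 ^ b := by exact_mod_cast Nat.lt_two_pow_self.le
        _ ≤ Q ^ b := by gcongr; linarith
    rw [inv_pow, ← div_eq_mul_inv, div_le_iff₀ (by positivity)]
    linarith
  rw [hsplit]
  calc _ ≤ (∑ p ∈ (Finset.univ : Finset E).offDiag, U ^ K * Q⁻¹ ^ b) +
        ∑ e : E, U ^ K * Q⁻¹ ^ b :=
        add_le_add (Finset.sum_le_sum h1) (Finset.sum_le_sum fun e _ => h2 e)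
    _ ≤ U ^ K * (2 * K ^ 2 * Q⁻¹ ^ b) := by
        rw [Finset.sum_const, Finset.sum_const, Finset.offDiag_card, nsmul_eq_mul, nsmul_eq_mul,
          Finset.card_univ, ← add_mul, ← hK]
        have h4 : ((K * K - K : ℕ) : ℝ) + K ≤ 2 * K ^ 2 := by
          have : K * K - K + K ≤ 2 * K ^ 2 := by
            have := Nat.le_mul_self K
            rw [pow_two]
            omega
          exact_mod_cast this
        calc _ ≤ (2 * K ^ 2 : ℝ) * (U ^ K * Q⁻¹ ^ b) :=
              mul_le_mul_of_nonneg_right h4 (by positivity)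
          _ = _ := by ring
    _ ≤ U ^ K * (1 / 4) := mul_le_mul_of_nonneg_left hKb (by positivity)
    _ = _ := by ring

lemma jacobi_sq_eq_ite (D : Fq[X]) {r : Fq[X]} (hr : r ≠ 0) :
    (jacobi D (r ^ 2) : ℝ) = if IsCoprime D r then 1 else 0 := by
  rw [jacobi_pow_right D (by assumption)]
  split_ifs with h
  · rw [jacobi_sq h]
    simp
  · rw [(jacobi_eq_zero_iff hr).2 h]
    simp

lemma sum_pairTuple_le_diagPart {l x y b Y : ℕ} (hY : (l + 2) * Y ≤ x) (hxy : x ≤ y) (D : Fq[X]) :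
    ∑ r ∈ (Fintype.piFinset fun _ : Sym2 (Fin (l + 1)) => roughUpTo Fq b Y).filter
      (fun r => Pairwise fun e e' => IsCoprime (r e) (r e')),
      (∏ e, (Fintype.card Fq : ℝ)⁻¹ ^ (r e).natDegree) *
        (if IsCoprime D (∏ e, r e) then 1 else 0) ≤ diagPart l x y D := by
  rw [diagPart]
  refine sum_le_sum_of_rel (fun r n => pairTuple r = n) ?_ ?_ ?_
  · intro n hn
    rw [Finset.mem_filter] at hn
    obtain ⟨r, hr, hr2⟩ := exists_monic_sqrt
      (monic_prod_of_monic _ _ fun i _ => monic_of_mem_tuples hn.1 i) hn.2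
    rw [hr2, jacobi_sq_eq_ite D hr.ne_zero]
    exact mul_nonneg (by split_ifs <;> norm_num) (pow_nonneg inv_sqrt_card_nonneg _)
  · intro r hr
    rw [Finset.mem_filter, Fintype.mem_piFinset] at hr
    have hm : ∀ e, (r e).Monic := fun e => (mem_roughUpTo.1 (hr.1 e)).1.1
    have hdeg : ∀ i, (pairTuple r i).natDegree ≤ x := fun i => by
      refine (natDegree_pairTuple_le hm (fun e => (mem_roughUpTo.1 (hr.1 e)).1.2) i).trans ?_
      rwa [Fintype.card_fin]
    have hmp : (∏ e, r e).Monic := monic_prod_of_monic _ _ fun e _ => hm e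
    refine ⟨pairTuple r, ?_, rfl, ?_⟩
    · rw [Finset.mem_filter, mem_tuples, prod_pairTuple]
      refine ⟨⟨mem_monicUpTo.2 ⟨monic_pairTuple hm 0, (hdeg 0).trans hxy⟩, fun i =>
        mem_monicUpTo.2 ⟨monic_pairTuple hm _, hdeg _⟩⟩, IsSquare.sq _⟩
    · rw [prod_pairTuple, jacobi_sq_eq_ite D hmp.ne_zero, hmp.natDegree_pow,
        inv_sqrt_card_pow_two_mul, natDegree_prod_of_monic _ _ fun e _ => hm e,
        Finset.prod_pow_eq_pow_sum, mul_comm]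
  · intro r hr r' hr' n h h'
    rw [Finset.mem_filter, Fintype.mem_piFinset] at hr hr'
    exact pairTuple_injective (fun e => (mem_roughUpTo.1 (hr.1 e)).1.1)
      (fun e => (mem_roughUpTo.1 (hr'.1 e)).1.1) hr.2 hr'.2 (h.trans h'.symm)

lemma sum_diagPart_ge (hq : 3 ≤ Fintype.card Fq) (g : ℕ) {l x y b Y : ℕ}
    (hb : 8 * (Fintype.card (Sym2 (Fin (l + 1)))) ^ 2 ≤ b)
    (hY : (l + 2) * Y ≤ x) (hxy : x ≤ y) :
    (Fintype.card Fq : ℝ) ^ (2 * g + 1) *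
      (roughMass Fq b Y ^ Fintype.card (Sym2 (Fin (l + 1))) / 4) ≤
      ∑ D ∈ (monicOfDegree Fq (2 * g + 1)).filter Squarefree, diagPart l x y D := by
  refine le_trans ?_ (Finset.sum_le_sum fun D _ => sum_pairTuple_le_diagPart (b := b) hY hxy D)
  rw [Finset.sum_comm, Finset.sum_filter]
  set Q : ℝ := (Fintype.card Fq : ℝ) with hQ
  set E := Sym2 (Fin (l + 1))
  have h1 := sum_coprimalityLoss_le (Fq := Fq) (E := E) Y hb hq
  have h2 := sum_pi_roughUpTo (Fq := Fq) (E := E) b Y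
  set w : (E → Fq[X]) → ℝ := fun r => ∏ e, Q⁻¹ ^ (r e).natDegree with hw
  calc _ ≤ Q ^ (2 * g + 1) * ∑ r ∈ Fintype.piFinset fun _ : E => roughUpTo Fq b Y,
        (w r * (1 / 2) - w r * coprimalityLoss b Y r) := by
        refine mul_le_mul_of_nonneg_left ?_ (by positivity)
        rw [Finset.sum_sub_distrib, ← Finset.sum_mul]
        have h2' : ∑ r ∈ Fintype.piFinset fun _ : E => roughUpTo Fq b Y, w r =
          roughMass Fq b Y ^ Fintype.card E := h2
        rw [h2']
        linarith
    _ ≤ _ := by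
        rw [Finset.mul_sum]
        refine Finset.sum_le_sum fun r hr => ?_
        have hw0 : 0 ≤ w r := Finset.prod_nonneg fun e _ => by positivity
        have h3 := mul_le_mul_of_nonneg_left
          (le_card_coprime hq g (Fintype.mem_piFinset.1 hr)) hw0
        calc _ = w r * (Q ^ (2 * g + 1) * (1 / 2 - coprimalityLoss b Y r)) := by ring
          _ ≤ _ := h3
          _ = _ := by
              split_ifs
              · rw [← Finset.mul_sum, Finset.sum_ite, Finset.sum_const_zero, add_zero,
                  Finset.sum_const, nsmul_eq_mul, mul_one]
              · exact mul_zero _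

end Diagonal

section OddCharacteristic

lemma three_le_card (hq : ringChar Fq ≠ 2) : 3 ≤ Fintype.card Fq := by
  have h2 := Fintype.one_lt_card (α := Fq)
  by_contra h
  have h3 : Fintype.card Fq = 2 := by omega
  have h4 : ringChar Fq ∣ 2 := ringChar.dvd (by rw [← h3]; exact Nat.cast_card_eq_zero Fq)
  rcases (Nat.dvd_prime Nat.prime_two).1 h4 with h5 | h5
  · exact CharP.ringChar_ne_one h5
  · exact hq h5

lemma finsum_Hset (g : ℕ) (F : Fq[X] → ℝ) :
    ∑ᶠ D ∈ Hset Fq g, F D = ∑ D ∈ (monicOfDegree Fq (2 * g + 1)).filter Squarefree, F D := by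
  have h1 : Hset Fq g = ↑((monicOfDegree Fq (2 * g + 1)).filter Squarefree) := by
    ext D
    rw [Finset.mem_coe, Finset.mem_filter, mem_monicOfDegree]
    constructor
    · rintro ⟨h1, h2, h3⟩
      exact ⟨⟨h1, h3⟩, h2⟩
    · rintro ⟨⟨h1, h3⟩, h2⟩
      exact ⟨h1, h2, h3⟩
  rw [h1, finsum_mem_coe_finset]

/-- The rough mass grows linearly. -/
lemma exists_linear_le_roughMass {b : ℕ} (hb : 0 < b) {m : ℕ} (hm : 0 < m) :
    ∃ c : ℝ, 0 < c ∧ ∃ G : ℕ, ∀ g ≥ G, c * g ≤ roughMass Fq b (4 * g / m) := by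
  have hq1 := one_le_card (Fq := Fq)
  set d := (smallProd Fq b).natDegree with hd
  set Q : ℝ := (Fintype.card Fq : ℝ)
  have hm' : (0 : ℝ) < m := by exact_mod_cast hm
  refine ⟨Q⁻¹ ^ d * (2 / m), by positivity, d * m, fun g hg => ?_⟩
  have h1 : d ≤ 4 * g / m := (Nat.le_div_iff_mul_le hm).2 (by omega)
  refine le_trans ?_ (le_roughMass hb h1)
  rw [mul_assoc]
  refine mul_le_mul_of_nonneg_left ?_ (by positivity)
  have h2 : (4 * g : ℝ) / m ≤ ((4 * g / m : ℕ) : ℝ) + 1 := by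
    have := (Nat.lt_div_mul_add hm (a := 4 * g)).le
    rw [div_le_iff₀ hm', add_mul, one_mul]
    exact_mod_cast this
  have h3 : (d : ℝ) ≤ 2 / m * g := by
    rw [div_mul_eq_mul_div, le_div_iff₀ hm']
    have : (d * m : ℝ) ≤ g := by exact_mod_cast hg
    linarith
  have h4 : (4 * g : ℝ) / m = 2 / m * g + 2 / m * g := by ring
  linarith

theorem S1_lower_bound_odd (hq : ringChar Fq ≠ 2) (k : ℕ) (hk : 2 ≤ k) :
    ∃ c : ℝ, 0 < c ∧ ∃ G : ℕ, ∀ g : ℕ, G ≤ g →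
      c * (Fintype.card Fq : ℝ) ^ (2 * g + 1) * (g : ℝ) ^ (k * (k + 1) / 2) ≤
        ∑ᶠ D ∈ Hset Fq g, LhalfR D * AD k g D ^ (k - 1) := by
  have hq1 := one_le_card (Fq := Fq)
  obtain ⟨l, rfl⟩ : ∃ l, k = l + 1 := ⟨k - 1, by omega⟩
  have hK : Fintype.card (Sym2 (Fin (l + 1))) = (l + 1) * (l + 1 + 1) / 2 := by
    rw [Sym2.card, Fintype.card_fin, Nat.choose_two_right, Nat.add_sub_cancel, mul_comm]
  rw [← hK]
  set K := Fintype.card (Sym2 (Fin (l + 1))) with hKdef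
  have hK0 : K ≠ 0 := Fintype.card_ne_zero
  set b := 8 * K ^ 2 with hb
  have hb0 : 0 < b := by positivity
  obtain ⟨c, hc, G₁, hG₁⟩ := exists_linear_le_roughMass (Fq := Fq) hb0
    (m := 15 * (l + 1) * (l + 2)) (by positivity)
  obtain ⟨G₂, hG₂⟩ := exists_abs_sum_squarefree_sub_diagPart_le hq (l + 1) hk
  obtain ⟨G₃, hG₃⟩ := exists_nat_ge (8 / c)
  refine ⟨c ^ K / 4, by positivity, max (max G₁ G₂) (max G₃ 2), fun g hg => ?_⟩
  have hg1 : G₁ ≤ g := by omega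
  have hg2 : G₂ ≤ g := by omega
  have hg3 : G₃ ≤ g := by omega
  have hg4 : 2 ≤ g := by omega
  set x := 4 * g / (15 * (l + 1)) with hx
  set N := 2 * g + 1 with hN
  set Q : ℝ := (Fintype.card Fq : ℝ) with hQ
  have hU : c * g ≤ roughMass Fq b (x / (l + 2)) := by
    rw [hx, Nat.div_div_eq_div_mul]
    exact hG₁ g hg1
  have hxg : x ≤ g - 1 := by
    have : 15 * (l + 1) * x ≤ 4 * g := Nat.mul_div_le _ _
    have h2 : 15 * x ≤ 15 * (l + 1) * x := Nat.mul_le_mul_right _ (by omega)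
    omega
  have hcg : 8 ≤ c * g := by
    have : (G₃ : ℝ) ≤ g := by exact_mod_cast hg3
    rw [← div_le_iff₀' hc]
    linarith
  have hcgK : (8 : ℝ) ≤ (c * g) ^ K :=
    hcg.trans (le_self_pow₀ (by linarith) hK0)
  have hdiag : ∀ y, x ≤ y → Q ^ N * ((c * g) ^ K / 4) ≤
      ∑ D ∈ (monicOfDegree Fq N).filter Squarefree, diagPart l x y D := by
    intro y hxy
    refine le_trans ?_ (sum_diagPart_ge (three_le_card hq) g (b := b) (Y := x / (l + 2)) le_rfl
      (Nat.mul_div_le _ _) hxy)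
    refine mul_le_mul_of_nonneg_left ?_ (by positivity)
    gcongr
  have hmain : ∀ y, x ≤ y → y ≤ g → Q ^ N * ((c * g) ^ K / 4) - Q ^ N ≤
      ∑ D ∈ (monicOfDegree Fq N).filter Squarefree, partialL y D * partialL x D ^ l := by
    intro y hxy hyg
    have h1 := (abs_le.1 (hG₂ g hg2 y hyg)).1
    rw [Finset.sum_sub_distrib] at h1
    have h2 := hdiag y hxy
    simp only [Nat.add_sub_cancel] at h1
    linarith
  have h1 := hmain g (by omega) le_rfl
  have h2 := hmain (g - 1) hxg (by omega)
  rw [finsum_Hset]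
  calc c ^ K / 4 * Q ^ N * (g : ℝ) ^ K = Q ^ N * ((c * g) ^ K / 4) := by rw [mul_pow]; ring
    _ ≤ Q ^ N * ((c * g) ^ K / 2 - 2) := by
        refine mul_le_mul_of_nonneg_left ?_ (by positivity)
        linarith
    _ ≤ ∑ D ∈ (monicOfDegree Fq N).filter Squarefree, (partialL g D * partialL x D ^ l +
        partialL (g - 1) D * partialL x D ^ l) := by
        rw [Finset.sum_add_distrib]
        linarith
    _ = _ := by
        refine Finset.sum_congr rfl fun D hD => ?_
        rw [Finset.mem_filter, mem_monicOfDegree] at hD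
        rw [LhalfR_eq hq hD.1.1 hD.2 (by omega) hD.1.2, AD_eq, add_mul, Nat.add_sub_cancel]

end OddCharacteristic

section CharTwo

lemma sum_range_card_pow_succ_le (g : ℕ) :
    ∑ d ∈ Finset.range g, Fintype.card Fq ^ (d + 1) ≤ Fintype.card Fq ^ (g + 1) := by
  have hq : 2 ≤ Fintype.card Fq := Fintype.one_lt_card
  induction g with
  | zero => simp
  | succ g ih =>
    rw [Finset.sum_range_succ]
    have h : Fintype.card Fq ^ (g + 1 + 1) = Fintype.card Fq ^ (g + 1) * Fintype.card Fq :=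
      pow_succ _ _
    nlinarith [Nat.mul_le_mul_left (Fintype.card Fq ^ (g + 1)) hq]

/-- A lower bound for the number of monic irreducible polynomials of odd degree. -/
lemma card_pow_le_card_irreducible (g : ℕ) :
    Fintype.card Fq ^ (2 * g + 1) ≤
      (2 * g + 1) * ((monicOfDegree Fq (2 * g + 1)).filter Irreducible).card +
        Fintype.card Fq ^ (g + 1) := by
  obtain ⟨p, hp⟩ := CharP.exists Fq
  have : Fact p.Prime := ⟨CharP.char_is_prime Fq p⟩
  set N := 2 * g + 1 with hN
  have : NeZero N := ⟨by omega⟩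
  set L := FiniteField.Extension Fq p N
  have : Fintype L := Fintype.ofFinite L
  have hL : Fintype.card L = Fintype.card Fq ^ N := by
    rw [Fintype.card_eq_nat_card, FiniteField.natCard_extension, Nat.card_eq_fintype_card]
  have hq : 1 < Fintype.card Fq := Fintype.one_lt_card
  have hcover : (Finset.univ : Finset L) ⊆
      ((monicOfDegree Fq N).filter Irreducible).biUnion (fun P => (P.aroots L).toFinset) ∪
        (Finset.range g).biUnion
          (fun d => (X ^ Fintype.card Fq ^ (d + 1) - X : L[X]).roots.toFinset) := by
    intro a _
    have hint : IsIntegral Fq a := Algebra.IsIntegral.isIntegral a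
    have hirr := minpoly.irreducible hint
    have hdvd : (minpoly Fq a).natDegree ∣ N := by
      have := minpoly.degree_dvd hint
      rwa [FiniteField.finrank_extension] at this
    by_cases hd : (minpoly Fq a).natDegree = N
    · refine Finset.mem_union_left _ (Finset.mem_biUnion.2 ⟨minpoly Fq a, ?_, ?_⟩)
      · exact Finset.mem_filter.2 ⟨mem_monicOfDegree.2 ⟨minpoly.monic hint, hd⟩, hirr⟩
      · simp [hirr.ne_zero]
    · refine Finset.mem_union_right _ (Finset.mem_biUnion.2 ⟨(minpoly Fq a).natDegree - 1, ?_, ?_⟩)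
      · obtain ⟨e, he⟩ := hdvd
        have he2 : 2 ≤ e := by
          rcases e with _ | _ | e
          · omega
          · omega
          · omega
        have hpos := hirr.natDegree_pos
        rw [Finset.mem_range]
        have := Nat.mul_le_mul_left (minpoly Fq a).natDegree he2
        omega
      · rw [Nat.sub_add_cancel hirr.natDegree_pos]
        have h1 : minpoly Fq a ∣ X ^ Nat.card Fq ^ (minpoly Fq a).natDegree - X :=
          hirr.natDegree_dvd_iff_dvd_X_pow_card_pow_sub_X.1 dvd_rfl
        have h2 := aeval_eq_zero_of_dvd_aeval_eq_zero h1 (minpoly.aeval Fq a)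
        rw [Nat.card_eq_fintype_card] at h2
        rw [Multiset.mem_toFinset, mem_roots
          (FiniteField.X_pow_card_pow_sub_X_ne_zero L hirr.natDegree_pos.ne' hq)]
        simpa using h2
  have hcard := Finset.card_le_card hcover
  rw [Finset.card_univ, hL] at hcard
  refine hcard.trans ((Finset.card_union_le _ _).trans (Nat.add_le_add ?_ ?_))
  · rw [mul_comm]
    refine Finset.card_biUnion_le_card_mul _ _ _ fun P hP => ?_
    rw [Finset.mem_filter, mem_monicOfDegree] at hP
    refine (Multiset.toFinset_card_le _).trans ((card_roots' _).trans_eq ?_)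
    rw [natDegree_map, hP.1.2]
  · refine Finset.card_biUnion_le.trans (le_trans (Finset.sum_le_sum fun d _ => ?_)
      (sum_range_card_pow_succ_le (Fq := Fq) g))
    refine (Multiset.toFinset_card_le _).trans ((card_roots' _).trans_eq ?_)
    exact FiniteField.X_pow_card_pow_sub_X_natDegree_eq L d.succ_ne_zero hq

lemma quadCharP_nonneg (h2 : ringChar Fq = 2) (D : Fq[X]) {P : Fq[X]} (hP : Irreducible P) :
    0 ≤ quadCharP D P := by
  have := Fact.mk hP
  have := finite_adjoinRoot hP.ne_zero
  have hchar : ringChar (AdjoinRoot P) = 2 := by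
    rw [← h2]
    exact (Algebra.ringChar_eq Fq (AdjoinRoot P)).symm
  have hsq : ∃ x : Fq[X], P ∣ x ^ 2 - D := by
    obtain ⟨y, hy⟩ := FiniteField.isSquare_of_char_two hchar (AdjoinRoot.mk P D)
    obtain ⟨x, rfl⟩ := AdjoinRoot.mk_surjective y
    refine ⟨x, ?_⟩
    rw [← map_mul, eq_comm, AdjoinRoot.mk_eq_mk, ← pow_two] at hy
    exact hy
  unfold quadCharP
  rw [if_pos hsq]
  split_ifs <;> norm_num

lemma jacobi_nonneg (h2 : ringChar Fq = 2) (D f : Fq[X]) :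
    0 ≤ jacobi D f := by
  refine Multiset.prod_nonneg fun a ha => ?_
  obtain ⟨P, hP, rfl⟩ := Multiset.mem_map.1 ha
  exact quadCharP_nonneg h2 D (UniqueFactorizationMonoid.irreducible_of_factor P hP)

lemma jacobi_eq_one (h2 : ringChar Fq = 2) {D f : Fq[X]} (h : IsCoprime D f) :
    jacobi D f = 1 := by
  have h1 := jacobi_sq h
  nlinarith [jacobi_nonneg h2 D f]

lemma one_le_partialL (h2 : ringChar Fq = 2) (y : ℕ) (D : Fq[X]) : 1 ≤ partialL y D := by
  have h1 : (1 : Fq[X]) ∈ monicUpTo Fq y := mem_monicUpTo.2 ⟨monic_one, by simp⟩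
  refine le_trans ?_ (Finset.single_le_sum (fun f _ => ?_) h1)
  · simp [jacobi_one_right]
  · have := jacobi_nonneg h2 D f
    have : (0 : ℝ) ≤ jacobi D f := by exact_mod_cast this
    positivity

lemma LhalfR_summand_nonneg (h2 : ringChar Fq = 2) (D : Fq[X]) (n : ℕ) :
    0 ≤ (∑ᶠ f ∈ monicDeg Fq n, (jacobi D f : ℝ)) * (√(Fintype.card Fq : ℝ))⁻¹ ^ n := by
  rw [finsum_monicDeg]
  refine mul_nonneg (Finset.sum_nonneg fun f _ => ?_) (by positivity)
  exact_mod_cast jacobi_nonneg h2 D f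

lemma LhalfR_nonneg (h2 : ringChar Fq = 2) (D : Fq[X]) : 0 ≤ LhalfR D :=
  Finset.sum_nonneg fun n _ => LhalfR_summand_nonneg h2 D n

lemma card_pow_le_LhalfR (h2 : ringChar Fq = 2) {D : Fq[X]} (hD : Irreducible D) {g : ℕ}
    (hg : D.natDegree = 2 * g + 1) : (Fintype.card Fq : ℝ) ^ g ≤ LhalfR D := by
  refine le_trans ?_ (Finset.single_le_sum (fun n _ => LhalfR_summand_nonneg h2 D n)
    (Finset.mem_range.2 (by omega : 2 * g < D.natDegree)))
  rw [finsum_monicDeg]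
  have hone : ∀ f ∈ monicOfDegree Fq (2 * g), (jacobi D f : ℝ) = 1 := by
    intro f hf
    rw [mem_monicOfDegree] at hf
    have hcop : IsCoprime D f := by
      refine (hD.coprime_iff_not_dvd).2 fun h => ?_
      have := natDegree_le_of_dvd h hf.1.ne_zero
      omega
    rw [jacobi_eq_one h2 hcop]
    norm_num
  have hq : (Fintype.card Fq : ℝ) ≠ 0 := by
    have := two_le_card (Fq := Fq)
    positivity
  rw [Finset.sum_congr rfl hone, Finset.sum_const, card_monicOfDegree, inv_sqrt_card_pow_two_mul,
    nsmul_eq_mul, mul_one, Nat.cast_pow, two_mul, pow_add, mul_assoc, ← mul_pow,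
    mul_inv_cancel₀ hq, one_pow, mul_one]

lemma S1_lower_bound_char_two (h2 : ringChar Fq = 2) (k : ℕ) :
    ∃ c : ℝ, 0 < c ∧ ∃ G : ℕ, ∀ g : ℕ, G ≤ g →
      c * (Fintype.card Fq : ℝ) ^ (2 * g + 1) * (g : ℝ) ^ (k * (k + 1) / 2) ≤
        ∑ᶠ D ∈ Hset Fq g, LhalfR D * AD k g D ^ (k - 1) := by
  set K := k * (k + 1) / 2
  set Q : ℝ := (Fintype.card Fq : ℝ) with hQ
  have hQ2 : 2 ≤ Q := two_le_card
  have hlim : Tendsto (fun g : ℕ => (g : ℝ) ^ (K + 1) * (1 / 2 : ℝ) ^ g) atTop (nhds 0) :=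
    tendsto_pow_const_mul_const_pow_of_abs_lt_one (K + 1) (by norm_num [abs_lt])
  obtain ⟨G, hG⟩ := eventually_atTop.1 (hlim.eventually (ge_mem_nhds (by norm_num : (0 : ℝ) < 1)))
  refine ⟨1 / 6, by norm_num, max G 1, fun g hg => ?_⟩
  have hg1 : 1 ≤ g := by omega
  have hgK : (g : ℝ) ^ (K + 1) ≤ Q ^ g := by
    have h := hG g (by omega)
    rw [one_div, inv_pow, ← div_eq_mul_inv, div_le_one (by positivity)] at h
    exact h.trans (pow_le_pow_left₀ (by norm_num) hQ2 g)
  set I := (monicOfDegree Fq (2 * g + 1)).filter Irreducible with hI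
  have hcount : Q ^ (2 * g + 1) ≤ 6 * g * (I.card : ℝ) := by
    have h : Q ^ (2 * g + 1) ≤ (2 * g + 1) * (I.card : ℝ) + Q ^ (g + 1) := by
      rw [hQ, hI]
      exact_mod_cast card_pow_le_card_irreducible (Fq := Fq) g
    have h' : 2 * Q ^ (g + 1) ≤ Q ^ (2 * g + 1) := by
      calc 2 * Q ^ (g + 1) ≤ Q * Q ^ (g + 1) := by gcongr
        _ = Q ^ (g + 2) := by ring
        _ ≤ Q ^ (2 * g + 1) := pow_le_pow_right₀ (by linarith) (by omega)
    have hgr : (1 : ℝ) ≤ g := by exact_mod_cast hg1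
    nlinarith [mul_nonneg (sub_nonneg.2 hgr) (Nat.cast_nonneg (α := ℝ) I.card)]
  rw [finsum_Hset]
  calc 1 / 6 * Q ^ (2 * g + 1) * (g : ℝ) ^ K ≤ 1 / 6 * (6 * g * (I.card : ℝ)) * (g : ℝ) ^ K := by
        gcongr
    _ = I.card * (g : ℝ) ^ (K + 1) := by ring
    _ ≤ I.card * Q ^ g := by gcongr
    _ = ∑ D ∈ I, Q ^ g := by rw [Finset.sum_const, nsmul_eq_mul]
    _ ≤ ∑ D ∈ I, LhalfR D * AD k g D ^ (k - 1) := by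
        refine Finset.sum_le_sum fun D hD => ?_
        rw [hI, Finset.mem_filter, mem_monicOfDegree] at hD
        rw [AD_eq]
        exact (card_pow_le_LhalfR h2 hD.2 hD.1.2).trans (le_mul_of_one_le_right
          (LhalfR_nonneg h2 D) (one_le_pow₀ (one_le_partialL h2 _ D)))
    _ ≤ _ := by
        refine Finset.sum_le_sum_of_subset_of_nonneg (fun D hD => ?_) fun D _ _ => ?_
        · rw [hI, Finset.mem_filter] at hD
          exact Finset.mem_filter.2 ⟨hD.1, hD.2.squarefree⟩
        · rw [AD_eq]
          exact mul_nonneg (LhalfR_nonneg h2 D)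
            (pow_nonneg (zero_le_one.trans (one_le_partialL h2 _ D)) _)

end CharTwo

/-- lower bound for `S₁ = Σ_{D ∈ H_{2g+1}} L(1/2,χ_D) A(D)^{k-1}`. -/
theorem S1_lower_bound (k : ℕ) (hke : Even k) (hk : 2 ≤ k) :
    ∃ c : ℝ, 0 < c ∧ ∃ G : ℕ, ∀ g : ℕ, G ≤ g →
      c * (Fintype.card Fq : ℝ) ^ (2 * g + 1) * (g : ℝ) ^ (k * (k + 1) / 2)
        ≤ ∑ᶠ D ∈ Hset Fq g, LhalfR D * AD k g D ^ (k - 1) := by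
  by_cases hq : ringChar Fq = 2
  · exact S1_lower_bound_char_two hq k
  · exact S1_lower_bound_odd hq k hk
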